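/- arXiv:math/0606752 — 7 statements merged into one kernel-verified Lean document; each statement's English description precedes it below -/
import Mathlib

section
/- For all real numbers v > 0, c > 0 and x > 0, sup over t ∈ [0, 1/c) of ( t·x − ∫₀ᵗ (v/(2c))·((1 − cs)^{−2} − 1) ds ) equals (v/c²)·(1 + cx/v − √(1 + 2cx/v)). -/
open Real

/-- Closed form of the integral of the Bernstein rate function. -/
theorem integral_bernstein_rate (v c t : ℝ) (hc : 0 < c) (ht : 0 ≤ t) (htc : 0 < 1 - c * t) :
    ∫ s in (0:ℝ)..t, (v / (2 * c)) * (((1 - c * s) ^ 2)⁻¹ - 1) =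
      v * t ^ 2 / (2 * (1 - c * t)) := by
  have hpos : ∀ s ∈ Set.uIcc 0 t, 1 - c * s ≠ 0 := by
    intro s hs
    rw [Set.uIcc_of_le ht] at hs
    nlinarith [mul_le_mul_of_nonneg_left hs.2 hc.le]
  have hderiv : ∀ s ∈ Set.uIcc 0 t,
      HasDerivAt (fun s => v / (2 * c) * (c⁻¹ * (1 - c * s)⁻¹ - s))
        ((v / (2 * c)) * (((1 - c * s) ^ 2)⁻¹ - 1)) s := by
    intro s hs
    have hlin : HasDerivAt (fun s => 1 - c * s) (-c) s := by
      simpa using ((hasDerivAt_id s).const_mul c).const_sub 1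
    have h := (((hlin.fun_inv (hpos s hs)).const_mul c⁻¹).sub (hasDerivAt_id s)).const_mul
      (v / (2 * c))
    refine h.congr_deriv ?_
    have := hpos s hs
    field_simp
  have hcont : ContinuousOn (fun s => (v / (2 * c)) * (((1 - c * s) ^ 2)⁻¹ - 1))
      (Set.uIcc 0 t) := by
    refine continuousOn_const.mul (ContinuousOn.sub (ContinuousOn.inv₀ (by fun_prop) ?_)
      continuousOn_const)
    exact fun s hs => pow_ne_zero 2 (hpos s hs)
  rw [intervalIntegral.integral_eq_sub_of_hasDerivAt hderiv hcont.intervalIntegrable]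
  have := htc.ne'
  simp only [mul_zero, sub_zero, inv_one]
  field_simp
  ring

/-- Completing the square in the Legendre transform of the Bernstein rate function. -/
theorem bernstein_legendre_eq_sub_sq (v c x t r : ℝ) (hv : v ≠ 0) (hc : c ≠ 0)
    (htc : 1 - c * t ≠ 0) (hr : r ^ 2 = 1 + 2 * c * x / v) :
    t * x - v * t ^ 2 / (2 * (1 - c * t)) =
      (v / c ^ 2) * (1 + c * x / v - r) -
        v / (2 * c ^ 2) * (((1 - c * t) * r - 1) ^ 2 / (1 - c * t)) := by
  have hx : x = v * (r ^ 2 - 1) / (2 * c) := by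
    rw [hr]
    field_simp
    ring
  obtain ⟨u, hu⟩ : ∃ u, u = 1 - c * t := ⟨_, rfl⟩
  have ht : t = (1 - u) / c := by
    rw [hu]
    field_simp
    ring
  rw [← hu] at htc ⊢
  rw [hx, ht]
  field_simp
  ring

/-- Legendre transform computation for the Bernstein-type rate function:
for `v, c, x > 0`,
`sup_{0 ≤ t < 1/c} (tx − ∫₀ᵗ (v/(2c))((1 − cs)⁻² − 1) ds) = (v/c²)(1 + cx/v − √(1 + 2cx/v))`. -/
theorem stmt2 (v c x : ℝ) (hv : 0 < v) (hc : 0 < c) (hx : 0 < x) :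
    sSup ((fun t : ℝ => t * x - ∫ s in (0:ℝ)..t, (v / (2 * c)) * (((1 - c * s) ^ 2)⁻¹ - 1)) ''
        Set.Ico (0 : ℝ) (1 / c)) =
      (v / c ^ 2) * (1 + c * x / v - Real.sqrt (1 + 2 * c * x / v)) := by
  have hq : 0 < 2 * c * x / v := by positivity
  have hr2 : √(1 + 2 * c * x / v) ^ 2 = 1 + 2 * c * x / v := Real.sq_sqrt (by positivity)
  have hr1 : 1 ≤ √(1 + 2 * c * x / v) := Real.one_le_sqrt.2 (by linarith)
  set r := √(1 + 2 * c * x / v)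
  have hr0 : 0 < r := by linarith
  have hvalue : ∀ t ∈ Set.Ico 0 (1 / c), 0 < 1 - c * t ∧
      t * x - ∫ s in (0:ℝ)..t, (v / (2 * c)) * (((1 - c * s) ^ 2)⁻¹ - 1) =
        (v / c ^ 2) * (1 + c * x / v - r) -
          v / (2 * c ^ 2) * (((1 - c * t) * r - 1) ^ 2 / (1 - c * t)) := by
    intro t ht
    have htc : 0 < 1 - c * t := by linarith [(lt_div_iff₀' hc).1 ht.2]
    rw [integral_bernstein_rate v c t hc ht.1 htc,
      bernstein_legendre_eq_sub_sq v c x t r hv.ne' hc.ne' htc.ne' hr2]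
    exact ⟨htc, rfl⟩
  have hmem : (1 - r⁻¹) / c ∈ Set.Ico 0 (1 / c) :=
    ⟨div_nonneg (sub_nonneg.2 (inv_le_one_of_one_le₀ hr1)) hc.le,
      div_lt_div_of_pos_right (by linarith [inv_pos.2 hr0]) hc⟩
  refine IsGreatest.csSup_eq ⟨⟨(1 - r⁻¹) / c, hmem, ?_⟩, ?_⟩
  · have hu : (1 - c * ((1 - r⁻¹) / c)) * r - 1 = 0 := by
      field_simp
      ring
    simp only [(hvalue _ hmem).2, hu]
    simp
  · rintro _ ⟨t, ht, rfl⟩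
    obtain ⟨htc, heq⟩ := hvalue t ht
    simp only [heq]
    exact sub_le_self _ (by positivity)
end

section
/- Let λ > 0 and let X = (X₁,…,X_d) be a random vector whose components are i.i.d., each Poisson distributed with parameter λ (so X takes values in ℕ^d ⊂ ℝ^d). Let f : ℝ^d → ℝ and b₁,…,b_d ∈ ℝ be such that |f(x + u e_k) − f(x)| ≤ b_k|u| for all u ∈ ℝ, x ∈ ℝ^d and k = 1,…,d, where e₁,…,e_d is the canonical basis of ℝ^d. Set b = max_{1≤k≤d} b_k > 0 and ā² = sup_{x ∈ ℝ^d} Σ_{k=1}^d λ·|f(x + e_k) − f(x)|², and assume 0 < ā² < ∞. Then for all x > 0, P( f(X) − E f(X) ≥ x ) ≤ exp( −(ā²/b²)·ℓ(bx/ā²) ), where ℓ(u) = (1+u)log(1+u) − u. -/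
open MeasureTheory ProbabilityTheory Real
open scoped ENNReal NNReal

open Filter Topology

/-- The quadratic bound `e^y - 1 - y ≤ y² (e^c - 1 - c) / c²` for `|y| ≤ c`. -/
lemma exp_sub_one_sub_le_sq_mul {y c : ℝ} (hc : 0 < c) (hy : |y| ≤ c) :
    Real.exp y - 1 - y ≤ y ^ 2 * ((Real.exp c - 1 - c) / c ^ 2) := by
  have hs (z : ℝ) : HasSum (fun n : ℕ => z ^ (n + 2) / (n + 2).factorial)
      (Real.exp z - 1 - z) := by
    have h := (hasSum_nat_add_iff' 2).2 (NormedSpace.expSeries_div_hasSum_exp (𝔸 := ℝ) z)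
    rw [← Real.exp_eq_exp_ℝ] at h
    simpa [Finset.sum_range_succ, sub_sub] using h
  refine hasSum_le (fun n => ?_) (hs y) (((hs c).div_const (c ^ 2)).mul_left (y ^ 2))
  have h1 : y ^ n ≤ c ^ n := (le_abs_self _).trans <| by
    rw [abs_pow]; exact pow_le_pow_left₀ (abs_nonneg _) hy n
  have h2 : y ^ 2 * (c ^ (n + 2) / (n + 2).factorial / c ^ 2)
      = y ^ 2 * c ^ n / (n + 2).factorial := by
    field_simp
    ring
  rw [h2, pow_add, mul_comm (y ^ n)]
  gcongr

section LatticeWalk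

variable {d : ℕ}

/-- Law of a step of the lazy walk that jumps along each canonical basis vector with
probability `ε`. -/
noncomputable def latticeStep (d : ℕ) (ε : ℝ) : Measure (EuclideanSpace ℝ (Fin d)) :=
  ENNReal.ofReal (1 - d * ε) • Measure.dirac 0 +
    ∑ k, ENNReal.ofReal ε • Measure.dirac (EuclideanSpace.single k 1)

/-- Law at time `n`, started from the origin, of the walk with steps `latticeStep d ε`. -/
noncomputable def latticeWalk (d : ℕ) (ε : ℝ) : ℕ → Measure (EuclideanSpace ℝ (Fin d))
  | 0 => Measure.dirac 0
  | n + 1 => latticeWalk d ε n ∗ latticeStep d ε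

lemma isProbabilityMeasure_latticeStep {ε : ℝ} (hε : 0 ≤ ε) (hd : d * ε ≤ 1) :
    IsProbabilityMeasure (latticeStep d ε) := by
  constructor
  simp only [latticeStep, Measure.coe_add, Measure.coe_smul, Measure.coe_finsetSum,
    Pi.add_apply, Pi.smul_apply, Finset.sum_apply, measure_univ, smul_eq_mul, mul_one,
    Finset.sum_const, Finset.card_univ, Fintype.card_fin, nsmul_eq_mul]
  rw [← ENNReal.ofReal_natCast, ← ENNReal.ofReal_mul (by positivity),
    ← ENNReal.ofReal_add (by linarith) (by positivity)]
  simp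

lemma isProbabilityMeasure_latticeWalk {ε : ℝ} (hε : 0 ≤ ε) (hd : d * ε ≤ 1) (n : ℕ) :
    IsProbabilityMeasure (latticeWalk d ε n) := by
  have := isProbabilityMeasure_latticeStep hε hd
  induction n with
  | zero => rw [latticeWalk]; infer_instance
  | succ n ih => rw [latticeWalk]; infer_instance

variable {V : Type*} [NormedAddCommGroup V]

lemma integrable_latticeStep (ε : ℝ) (h : EuclideanSpace ℝ (Fin d) → V) :
    Integrable h (latticeStep d ε) := by
  refine ((integrable_dirac (by simp)).smul_measure ENNReal.ofReal_ne_top).add_measure ?_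
  rw [integrable_finsetSum_measure]
  exact fun k _ => (integrable_dirac (by simp)).smul_measure ENNReal.ofReal_ne_top

variable [NormedSpace ℝ V] [CompleteSpace V]

lemma integral_latticeStep {ε : ℝ} (hε : 0 ≤ ε) (hd : d * ε ≤ 1)
    (h : EuclideanSpace ℝ (Fin d) → V) :
    ∫ y, h y ∂(latticeStep d ε) =
      h 0 + ∑ k, ε • (h (EuclideanSpace.single k 1) - h 0) := by
  have hi (k : Fin d) : Integrable h
      (ENNReal.ofReal ε • Measure.dirac (EuclideanSpace.single k (1 : ℝ))) :=
    (integrable_dirac (by simp)).smul_measure ENNReal.ofReal_ne_top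
  rw [latticeStep, integral_add_measure
    ((integrable_dirac (by simp)).smul_measure ENNReal.ofReal_ne_top)
    (integrable_finsetSum_measure.2 fun k _ => hi k),
    integral_finsetSum_measure fun k _ => hi k]
  simp only [integral_smul_measure, integral_dirac, ENNReal.toReal_ofReal hε,
    ENNReal.toReal_ofReal (sub_nonneg.2 hd), smul_sub, Finset.sum_sub_distrib,
    Finset.sum_const, Finset.card_univ, Fintype.card_fin]
  rw [sub_smul, one_smul, mul_smul, Nat.cast_smul_eq_nsmul]
  abel

lemma charFun_latticeWalk {ε : ℝ} (hε : 0 ≤ ε) (hd : d * ε ≤ 1) (n : ℕ)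
    (t : EuclideanSpace ℝ (Fin d)) :
    charFun (latticeWalk d ε n) t =
      (1 + ε * ∑ k, (Complex.exp (t k * Complex.I) - 1)) ^ n := by
  have := isProbabilityMeasure_latticeStep hε hd
  have := isProbabilityMeasure_latticeWalk hε hd
  induction n with
  | zero => simp [latticeWalk, charFun_dirac]
  | succ n ih =>
    rw [latticeWalk, charFun_conv, ih, pow_succ, charFun_apply, integral_latticeStep hε hd]
    congr 1
    rw [Finset.mul_sum]
    simp [EuclideanSpace.inner_single_left, -Finset.sum_sub_distrib]

/-- One-step exponential moment bound. -/
lemma integral_exp_latticeStep_le {ε : ℝ} (hε : 0 ≤ ε) (hd : d * ε ≤ 1)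
    (h : EuclideanSpace ℝ (Fin d) → ℝ) {b v t : ℝ} (hb : 0 < b) (ht : 0 < t)
    (hfb : ∀ k, |h (EuclideanSpace.single k 1) - h 0| ≤ b)
    (hfv : ∑ k, ε * (h (EuclideanSpace.single k 1) - h 0) ^ 2 ≤ v) :
    ∫ y, Real.exp (t * h y) ∂(latticeStep d ε) ≤
      Real.exp (t * ∫ y, h y ∂(latticeStep d ε) +
        v * ((Real.exp (t * b) - 1 - t * b) / b ^ 2)) := by
  rw [integral_latticeStep hε hd, integral_latticeStep hε hd]
  set D : Fin d → ℝ := fun k => h (EuclideanSpace.single k 1) - h 0 with hD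
  set ψ := (Real.exp (t * b) - 1 - t * b) / b ^ 2 with hψ
  have hψ0 : 0 ≤ ψ := div_nonneg (by linarith [Real.add_one_le_exp (t * b)]) (by positivity)
  have h1 (k : Fin d) : Real.exp (t * D k) - 1 ≤ t * D k + D k ^ 2 * ψ := by
    have := exp_sub_one_sub_le_sq_mul (y := t * D k) (c := t * b) (by positivity)
      (by rw [abs_mul, abs_of_pos ht]; exact mul_le_mul_of_nonneg_left (hfb k) ht.le)
    have h2 : (t * D k) ^ 2 * ((Real.exp (t * b) - 1 - t * b) / (t * b) ^ 2) = D k ^ 2 * ψ := by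
      rw [hψ]; field_simp
    linarith
  have h3 (k : Fin d) : ε • (Real.exp (t * h (EuclideanSpace.single k 1)) - Real.exp (t * h 0)) =
      Real.exp (t * h 0) * (ε * (Real.exp (t * D k) - 1)) := by
    have : t * h (EuclideanSpace.single k 1) = t * h 0 + t * D k := by simp only [hD]; ring
    rw [this, Real.exp_add, smul_eq_mul]; ring
  have h4 : ∑ k, ε * (Real.exp (t * D k) - 1) ≤ t * ∑ k, ε * D k + v * ψ := by
    calc ∑ k, ε * (Real.exp (t * D k) - 1) ≤ ∑ k, (t * (ε * D k) + ε * D k ^ 2 * ψ) :=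
          Finset.sum_le_sum fun k _ => by nlinarith [mul_le_mul_of_nonneg_left (h1 k) hε]
      _ = t * ∑ k, ε * D k + (∑ k, ε * D k ^ 2) * ψ := by
          rw [Finset.sum_add_distrib, Finset.mul_sum, Finset.sum_mul]
      _ ≤ _ := by gcongr
  rw [Finset.sum_congr rfl fun k _ => h3 k, ← Finset.mul_sum]
  calc Real.exp (t * h 0) + Real.exp (t * h 0) * ∑ k, ε * (Real.exp (t * D k) - 1)
      = Real.exp (t * h 0) * (∑ k, ε * (Real.exp (t * D k) - 1) + 1) := by ring
    _ ≤ Real.exp (t * h 0) * Real.exp (t * ∑ k, ε * D k + v * ψ) := by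
        gcongr
        linarith [Real.add_one_le_exp (t * ∑ k, ε * D k + v * ψ)]
    _ = _ := by
        rw [← Real.exp_add]
        simp only [smul_eq_mul, hD]
        ring_nf

/-- Exponential moment bound for bounded continuous functions of the walk. -/
lemma integral_exp_latticeWalk_le {ε : ℝ} (hε : 0 ≤ ε) (hd : d * ε ≤ 1)
    {b v t : ℝ} (hb : 0 < b) (ht : 0 < t) (n : ℕ) (f : EuclideanSpace ℝ (Fin d) → ℝ)
    (hfc : Continuous f) {M : ℝ} (hM : ∀ x, |f x| ≤ M)
    (hfb : ∀ x k, |f (x + EuclideanSpace.single k 1) - f x| ≤ b)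
    (hfv : ∀ x, ∑ k, ε * (f (x + EuclideanSpace.single k 1) - f x) ^ 2 ≤ v) :
    ∫ x, Real.exp (t * f x) ∂(latticeWalk d ε n) ≤
      Real.exp (t * ∫ x, f x ∂(latticeWalk d ε n) +
        n * (v * ((Real.exp (t * b) - 1 - t * b) / b ^ 2))) := by
  have hstep := isProbabilityMeasure_latticeStep hε hd
  have hwalk := isProbabilityMeasure_latticeWalk hε hd
  set ψ := (Real.exp (t * b) - 1 - t * b) / b ^ 2
  induction n generalizing f with
  | zero => simp [latticeWalk]
  | succ n ih =>
    have integrable_bdd {μ : Measure (EuclideanSpace ℝ (Fin d))} [IsProbabilityMeasure μ]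
        (g : EuclideanSpace ℝ (Fin d) → ℝ) (hg : Continuous g) (hgM : ∀ x, |g x| ≤ M) :
        Integrable g μ :=
      .of_bound hg.aestronglyMeasurable M (.of_forall hgM)
    have integrable_exp {μ : Measure (EuclideanSpace ℝ (Fin d))} [IsProbabilityMeasure μ]
        (g : EuclideanSpace ℝ (Fin d) → ℝ) (hg : Continuous g) (hgM : ∀ x, |g x| ≤ M) :
        Integrable (fun x => Real.exp (t * g x)) μ := by
      refine .of_bound (by fun_prop) (Real.exp (t * M)) (.of_forall fun x => ?_)
      rw [Real.norm_eq_abs, Real.abs_exp]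
      gcongr
      exact (le_abs_self _).trans (hgM x)
    rw [latticeWalk, integral_conv (integrable_exp f hfc hM), integral_conv (integrable_bdd f hfc hM)]
    set S : EuclideanSpace ℝ (Fin d) → ℝ := fun x => ∫ y, f (x + y) ∂(latticeStep d ε) with hS
    have hSc : Continuous S := by
      simp only [hS, integral_latticeStep hε hd]
      fun_prop
    have hSM (x) : |S x| ≤ M := by
      simpa using norm_integral_le_of_norm_le_const (μ := latticeStep d ε)
        (f := fun y => f (x + y)) (.of_forall fun y => hM (x + y))
    have hSD (x k) : S (x + EuclideanSpace.single k 1) - S x =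
        ∫ y, (f (x + y + EuclideanSpace.single k 1) - f (x + y)) ∂(latticeStep d ε) := by
      rw [integral_sub (integrable_latticeStep _ _) (integrable_latticeStep _ _)]
      simp only [hS, add_right_comm]
    have hSb (x k) : |S (x + EuclideanSpace.single k 1) - S x| ≤ b := by
      rw [hSD]
      simpa using norm_integral_le_of_norm_le_const (μ := latticeStep d ε)
        (f := fun y => f (x + y + EuclideanSpace.single k 1) - f (x + y))
        (.of_forall fun y => hfb (x + y) k)
    have hSv (x) : ∑ k, ε * (S (x + EuclideanSpace.single k 1) - S x) ^ 2 ≤ v := by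
      calc ∑ k, ε * (S (x + EuclideanSpace.single k 1) - S x) ^ 2
          ≤ ∑ k, ε * ∫ y, (f (x + y + EuclideanSpace.single k 1) - f (x + y)) ^ 2
              ∂(latticeStep d ε) := by
            gcongr with k
            rw [hSD]
            exact (even_two.convexOn_pow (𝕜 := ℝ)).map_integral_le (by fun_prop) isClosed_univ
              (by simp) (integrable_latticeStep _ _) (integrable_latticeStep _ _)
        _ = ∫ y, ∑ k, ε * (f (x + y + EuclideanSpace.single k 1) - f (x + y)) ^ 2
              ∂(latticeStep d ε) := by
            rw [integral_finsetSum _ fun k _ => integrable_latticeStep _ _]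
            simp only [integral_const_mul]
        _ ≤ ∫ _, v ∂(latticeStep d ε) :=
            integral_mono (integrable_latticeStep _ _) (integrable_latticeStep _ _)
              fun y => hfv (x + y)
        _ = v := by simp
    have hone (x) : ∫ y, Real.exp (t * f (x + y)) ∂(latticeStep d ε) ≤
        Real.exp (t * S x) * Real.exp (v * ψ) := by
      rw [← Real.exp_add]
      exact integral_exp_latticeStep_le hε hd (fun y => f (x + y)) hb ht
        (fun k => by simpa using hfb x k) (by simpa using hfv x)
    calc ∫ x, ∫ y, Real.exp (t * f (x + y)) ∂(latticeStep d ε) ∂(latticeWalk d ε n)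
        ≤ ∫ x, Real.exp (t * S x) * Real.exp (v * ψ) ∂(latticeWalk d ε n) := by
          refine integral_mono_of_nonneg (.of_forall fun x => ?_)
            ((integrable_exp S hSc hSM).mul_const _) (.of_forall hone)
          exact integral_nonneg fun y => (Real.exp_pos _).le
      _ ≤ Real.exp (t * ∫ x, S x ∂(latticeWalk d ε n) + n * (v * ψ)) * Real.exp (v * ψ) := by
          rw [integral_mul_const]
          gcongr
          exact ih S hSc hSM hSb hSv
      _ = _ := by
          rw [← Real.exp_add]
          push_cast
          ring_nf

end LatticeWalk

section Poisson

variable {d : ℕ}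

/-- The law on Euclidean space of a vector of i.i.d. Poisson components. -/
noncomputable def poissonVector (d : ℕ) (lam : ℝ≥0) : Measure (EuclideanSpace ℝ (Fin d)) :=
  (Measure.pi fun _ : Fin d => (poissonMeasure lam).map (fun n : ℕ => (n : ℝ))).map
    (WithLp.toLp 2)

instance (lam : ℝ≥0) : IsProbabilityMeasure (poissonVector d lam) :=
  Measure.isProbabilityMeasure_map (by fun_prop)

lemma charFun_poissonVector (lam : ℝ≥0) (t : EuclideanSpace ℝ (Fin d)) :
    charFun (poissonVector d lam) t =
      Complex.exp (lam * ∑ k, (Complex.exp (t k * Complex.I) - 1)) := by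
  rw [poissonVector, charFun_pi, Finset.mul_sum, Complex.exp_sum]
  exact Finset.prod_congr rfl fun k _ => charFun_map_cast_poissonMeasure lam (t k)

lemma integrable_poissonVector_eval (lam : ℝ≥0) (k : Fin d) :
    Integrable (fun x : EuclideanSpace ℝ (Fin d) => x k) (poissonVector d lam) := by
  rw [poissonVector, integrable_map_measure (by fun_prop) (by fun_prop)]
  refine integrable_comp_eval (X := fun _ : Fin d => ℝ) (i := k) (f := fun x : ℝ => x) ?_
  rw [integrable_map_measure (by fun_prop) (by fun_prop), integrable_poissonMeasure_iff]
  rw [← summable_nat_add_iff 1]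
  refine ((Real.summable_pow_div_factorial (lam : ℝ)).mul_left
    (Real.exp (-lam) * lam)).congr fun n => ?_
  have : ((n + 1 : ℕ) : ℝ) ≠ 0 := by positivity
  simp only [Function.comp, Real.norm_natCast, Nat.factorial_succ, Nat.cast_mul]
  field_simp
  ring

/-- The Poisson vector is the weak limit of walks with `n + m` steps of rate `λ / (n + m)`. -/
lemma tendsto_integral_latticeWalk (lam : ℝ≥0) {m : ℕ} (hm : d * (lam : ℝ) ≤ m) (hm0 : 0 < m)
    (g : BoundedContinuousFunction (EuclideanSpace ℝ (Fin d)) ℝ) :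
    Tendsto (fun n : ℕ => ∫ x, g x ∂(latticeWalk d (lam / (n + m : ℕ)) (n + m))) atTop
      (𝓝 (∫ x, g x ∂(poissonVector d lam))) := by
  have hε (n : ℕ) : 0 ≤ (lam : ℝ) / (n + m : ℕ) := by positivity
  have hd (n : ℕ) : d * ((lam : ℝ) / (n + m : ℕ)) ≤ 1 := by
    rw [← mul_div_assoc, div_le_one (by positivity)]
    push_cast
    linarith [n.cast_nonneg (α := ℝ)]
  let μ (n : ℕ) : ProbabilityMeasure (EuclideanSpace ℝ (Fin d)) :=
    ⟨latticeWalk d (lam / (n + m : ℕ)) (n + m),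
      isProbabilityMeasure_latticeWalk (hε n) (hd n) _⟩
  let ν : ProbabilityMeasure (EuclideanSpace ℝ (Fin d)) := ⟨poissonVector d lam, inferInstance⟩
  have hμν : Tendsto μ atTop (𝓝 ν) := by
    refine ProbabilityMeasure.tendsto_iff_tendsto_charFun.2 fun t => ?_
    simp only [μ, ν, ProbabilityMeasure.coe_mk, charFun_poissonVector,
      charFun_latticeWalk (hε _) (hd _)]
    refine ((tendsto_add_atTop_iff_nat m).2 (Complex.tendsto_one_add_div_pow_exp
      (lam * ∑ k, (Complex.exp (t k * Complex.I) - 1)))).congr fun n => ?_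
    push_cast
    rw [div_mul_eq_mul_div]
  exact ProbabilityMeasure.tendsto_iff_forall_integral_tendsto.1 hμν g

/-- Exponential moment bound for bounded continuous functions of a Poisson vector. -/
lemma integral_exp_poissonVector_le (lam : ℝ≥0) {b v t : ℝ} (hb : 0 < b) (ht : 0 < t)
    (f : EuclideanSpace ℝ (Fin d) → ℝ) (hfc : Continuous f) {M : ℝ} (hM : ∀ x, |f x| ≤ M)
    (hfb : ∀ x k, |f (x + EuclideanSpace.single k 1) - f x| ≤ b)
    (hfv : ∀ x, ∑ k, (lam : ℝ) * (f (x + EuclideanSpace.single k 1) - f x) ^ 2 ≤ v) :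
    ∫ x, Real.exp (t * f x) ∂(poissonVector d lam) ≤
      Real.exp (t * ∫ x, f x ∂(poissonVector d lam) +
        v * ((Real.exp (t * b) - 1 - t * b) / b ^ 2)) := by
  obtain ⟨m, hm⟩ := exists_nat_ge (d * (lam : ℝ) + 1)
  have hm0 : 0 < m := by
    have : (0 : ℝ) < m := lt_of_lt_of_le (by positivity) hm
    exact_mod_cast this
  have hm' : d * (lam : ℝ) ≤ m := by linarith
  have l1 := tendsto_integral_latticeWalk lam hm' hm0 (.ofNormedAddCommGroup f hfc M hM)
  have l2 := tendsto_integral_latticeWalk lam hm' hm0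
    (.ofNormedAddCommGroup (fun x => Real.exp (t * f x)) (by fun_prop) (Real.exp (t * M))
      fun x => by
        rw [Real.norm_eq_abs, Real.abs_exp]
        gcongr
        exact (le_abs_self _).trans (hM x))
  simp only [BoundedContinuousFunction.coe_ofNormedAddCommGroup] at l1 l2
  refine le_of_tendsto_of_tendsto' l2 (((l1.const_mul t).add_const _).rexp) fun n => ?_
  have hn : (0 : ℝ) < (n + m : ℕ) := by positivity
  have h := integral_exp_latticeWalk_le (ε := lam / (n + m : ℕ)) (v := v / (n + m : ℕ))
    (by positivity) (by
      rw [← mul_div_assoc, div_le_one hn]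
      push_cast
      linarith [n.cast_nonneg (α := ℝ)]) hb ht (n + m) f hfc hM hfb (fun x => by
        simp_rw [div_mul_eq_mul_div, ← Finset.sum_div]
        gcongr
        exact hfv x)
  have e (z : ℝ) : ((n + m : ℕ) : ℝ) * (v / (n + m : ℕ) * z) = v * z := by field_simp
  rwa [e] at h

/-- Exponential moment bound for integrable continuous functions of a Poisson vector. -/
lemma lintegral_exp_poissonVector_le (lam : ℝ≥0) {b v t : ℝ} (hb : 0 < b) (ht : 0 < t)
    (f : EuclideanSpace ℝ (Fin d) → ℝ) (hfc : Continuous f)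
    (hfi : Integrable f (poissonVector d lam))
    (hfb : ∀ x k, |f (x + EuclideanSpace.single k 1) - f x| ≤ b)
    (hfv : ∀ x, ∑ k, (lam : ℝ) * (f (x + EuclideanSpace.single k 1) - f x) ^ 2 ≤ v) :
    ∫⁻ x, ENNReal.ofReal (Real.exp (t * f x)) ∂(poissonVector d lam) ≤
      ENNReal.ofReal (Real.exp (t * ∫ x, f x ∂(poissonVector d lam) +
        v * ((Real.exp (t * b) - 1 - t * b) / b ^ 2))) := by
  set F : ℕ → EuclideanSpace ℝ (Fin d) → ℝ := fun n x => max (-(n : ℝ)) (min (n : ℝ) (f x))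
    with hF
  have hFc (n) : Continuous (F n) := by fun_prop
  have hFM (n x) : |F n x| ≤ n :=
    abs_le.2 ⟨le_max_left _ _, max_le (by linarith [n.cast_nonneg (α := ℝ)]) (min_le_left _ _)⟩
  have hFabs (n x) : |F n x| ≤ |f x| := by
    have hn := n.cast_nonneg (α := ℝ)
    refine abs_le.2 ⟨?_, ?_⟩
    · exact (le_min (by linarith [abs_nonneg (f x)]) (neg_abs_le _)).trans (le_max_right _ _)
    · exact max_le (by linarith [abs_nonneg (f x)]) ((min_le_right _ _).trans (le_abs_self _))
  have hFD (n x y) : |F n x - F n y| ≤ |f x - f y| := by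
    have h1 := abs_max_sub_max_le_max (-(n : ℝ)) (min (n : ℝ) (f x)) (-(n : ℝ)) (min (n : ℝ) (f y))
    have h2 := abs_min_sub_min_le_max (n : ℝ) (f x) (n : ℝ) (f y)
    simp only [sub_self, abs_zero, abs_nonneg, sup_of_le_right] at h1 h2
    exact h1.trans h2
  have hFlim (x) : Tendsto (fun n => F n x) atTop (𝓝 (f x)) := by
    obtain ⟨N, hN⟩ := exists_nat_ge |f x|
    refine tendsto_const_nhds.congr' ?_
    filter_upwards [eventually_ge_atTop N] with n hn
    have h1 : |f x| ≤ n := hN.trans (by exact_mod_cast hn)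
    rw [abs_le] at h1
    simp only [hF]
    rw [min_eq_right h1.2, max_eq_right h1.1]
  have hbound (n) := integral_exp_poissonVector_le lam hb ht (F n) (hFc n) (hFM n)
    (fun x k => (hFD n _ _).trans (hfb x k))
    (fun x => (Finset.sum_le_sum fun k _ => mul_le_mul_of_nonneg_left
      (sq_le_sq.2 (hFD n (x + EuclideanSpace.single k 1) x)) lam.2).trans (hfv x))
  have hEF : Tendsto (fun n => ∫ x, F n x ∂(poissonVector d lam)) atTop
      (𝓝 (∫ x, f x ∂(poissonVector d lam))) :=
    tendsto_integral_of_dominated_convergence (fun x => |f x|)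
      (fun n => (hFc n).aestronglyMeasurable) hfi.abs (fun n => .of_forall (hFabs n))
      (.of_forall hFlim)
  have hexp (n) : ∫⁻ x, ENNReal.ofReal (Real.exp (t * F n x)) ∂(poissonVector d lam) ≤
      ENNReal.ofReal (Real.exp (t * ∫ x, F n x ∂(poissonVector d lam) +
        v * ((Real.exp (t * b) - 1 - t * b) / b ^ 2))) := by
    rw [← ofReal_integral_eq_lintegral_ofReal _ (.of_forall fun x => (Real.exp_pos _).le)]
    · exact ENNReal.ofReal_le_ofReal (hbound n)
    · refine .of_bound (by fun_prop) (Real.exp (t * n)) (.of_forall fun x => ?_)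
      rw [Real.norm_eq_abs, Real.abs_exp]
      gcongr
      exact (le_abs_self _).trans (hFM n x)
  calc ∫⁻ x, ENNReal.ofReal (Real.exp (t * f x)) ∂(poissonVector d lam)
      = ∫⁻ x, liminf (fun n => ENNReal.ofReal (Real.exp (t * F n x))) atTop
          ∂(poissonVector d lam) := by
        refine lintegral_congr fun x => (Tendsto.liminf_eq ?_).symm
        exact ENNReal.tendsto_ofReal (((hFlim x).const_mul t).rexp)
    _ ≤ liminf (fun n => ∫⁻ x, ENNReal.ofReal (Real.exp (t * F n x))
          ∂(poissonVector d lam)) atTop := lintegral_liminf_le fun n => by fun_prop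
    _ ≤ liminf (fun n => ENNReal.ofReal (Real.exp (t * ∫ x, F n x ∂(poissonVector d lam) +
          v * ((Real.exp (t * b) - 1 - t * b) / b ^ 2)))) atTop :=
        liminf_le_liminf (.of_forall hexp)
    _ = _ := Tendsto.liminf_eq (ENNReal.tendsto_ofReal
        (((hEF.const_mul t).add_const _).rexp))

end Poisson

/-- A function that is Lipschitz along each coordinate is Lipschitz for the weighted `ℓ¹`
distance. -/
lemma abs_sub_le_sum_of_coordinatewise {d : ℕ} {f : EuclideanSpace ℝ (Fin d) → ℝ}
    {c : Fin d → ℝ}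
    (hf : ∀ (u : ℝ) (x : EuclideanSpace ℝ (Fin d)) (k : Fin d),
      |f (x + u • EuclideanSpace.single k 1) - f x| ≤ c k * |u|)
    (x y : EuclideanSpace ℝ (Fin d)) : |f x - f y| ≤ ∑ k, c k * |x k - y k| := by
  have key (s : Finset (Fin d)) :
      |f (y + ∑ k ∈ s, (x k - y k) • EuclideanSpace.single k (1 : ℝ)) - f y| ≤
        ∑ k ∈ s, c k * |x k - y k| := by
    induction s using Finset.induction_on with
    | empty => simp
    | insert a s ha ih =>
      rw [Finset.sum_insert ha, Finset.sum_insert ha,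
        add_comm (_ • EuclideanSpace.single a (1 : ℝ)), ← add_assoc]
      exact (abs_sub_le _ _ _).trans (add_le_add (hf _ _ _) ih)
  have hx : y + ∑ k, (x k - y k) • EuclideanSpace.single k (1 : ℝ) = x := by
    ext j
    simp [Pi.single_apply]
  simpa only [hx] using key Finset.univ

/-- Bennett–Prokhorov type concentration (Corollary 1 of the paper) for a vector
of i.i.d. Poisson(λ) components: if `|f(x + u eₖ) − f(x)| ≤ bₖ|u|` for all `u, x, k`,
`b = maxₖ bₖ > 0` and `ā² = sup_x Σₖ λ |f(x + eₖ) − f(x)|²` with `0 < ā² < ∞`, then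
`P(f(X) − E f(X) ≥ x) ≤ exp(−(ā²/b²) ℓ(bx/ā²))` where `ℓ(u) = (1+u)log(1+u) − u`. -/
theorem stmt4
    {Ω : Type*} [MeasureSpace Ω] [IsProbabilityMeasure (ℙ : Measure Ω)]
    {d : ℕ} (lam : ℝ≥0) (hlam : 0 < lam)
    (X : Ω → EuclideanSpace ℝ (Fin d)) (hX : Measurable X)
    (hlaw : Measure.map (fun ω k => X ω k) ℙ =
      Measure.pi fun _ : Fin d => (poissonMeasure lam).map (fun n : ℕ => (n : ℝ)))
    (f : EuclideanSpace ℝ (Fin d) → ℝ) (bk : Fin d → ℝ) (b : ℝ)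
    (hf : ∀ (u : ℝ) (x : EuclideanSpace ℝ (Fin d)) (k : Fin d),
      |f (x + u • EuclideanSpace.single k 1) - f x| ≤ bk k * |u|)
    (hb : IsGreatest (Set.range bk) b) (hb0 : 0 < b)
    (abar2 : ℝ) (habar0 : 0 < abar2)
    (habar : IsLUB {y : ℝ | ∃ x : EuclideanSpace ℝ (Fin d),
      y = ∑ k, (lam : ℝ) * |f (x + EuclideanSpace.single k 1) - f x| ^ 2} abar2)
    (x : ℝ) (hx : 0 < x) :
    ℙ {ω | f (X ω) - (∫ ω', f (X ω')) ≥ x} ≤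
      ENNReal.ofReal (Real.exp (-(abar2 / b ^ 2) *
        ((1 + b * x / abar2) * Real.log (1 + b * x / abar2) - b * x / abar2))) := by
  have hcoord := abs_sub_le_sum_of_coordinatewise hf
  have hbk (k : Fin d) : 0 ≤ bk k := by simpa using (abs_nonneg _).trans (hf 1 0 k)
  have hfc : Continuous f := by
    refine (LipschitzWith.of_dist_le_mul (K := (∑ k, bk k).toNNReal)
      fun y z => ?_).continuous
    rw [Real.dist_eq, dist_eq_norm, Real.coe_toNNReal _ (Finset.sum_nonneg fun k _ => hbk k),
      Finset.sum_mul]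
    exact (hcoord y z).trans (Finset.sum_le_sum fun k _ =>
      mul_le_mul_of_nonneg_left (PiLp.norm_apply_le (y - z) k) (hbk k))
  have hmap : Measure.map X ℙ = poissonVector d lam := by
    rw [poissonVector, ← hlaw, Measure.map_map (by fun_prop) (by fun_prop)]
    rfl
  have hfi : Integrable f (poissonVector d lam) := by
    refine ((integrable_const |f 0|).add (integrable_finsetSum Finset.univ fun k _ =>
      (integrable_poissonVector_eval lam k).abs.const_mul (bk k))).mono'
      hfc.aestronglyMeasurable (.of_forall fun y => ?_)
    have h := hcoord y 0
    simp only [PiLp.zero_apply, sub_zero] at h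
    simp only [Real.norm_eq_abs, Pi.add_apply]
    linarith [abs_sub_abs_le_abs_sub (f y) (f 0)]
  have hfb (y : EuclideanSpace ℝ (Fin d)) (k : Fin d) :
      |f (y + EuclideanSpace.single k 1) - f y| ≤ b :=
    (by simpa using hf 1 y k : _ ≤ bk k).trans (hb.2 ⟨k, rfl⟩)
  have hfv (y : EuclideanSpace ℝ (Fin d)) :
      ∑ k, (lam : ℝ) * (f (y + EuclideanSpace.single k 1) - f y) ^ 2 ≤ abar2 :=
    habar.1 ⟨y, by simp only [sq_abs]⟩
  have hmean : ∫ ω', f (X ω') = ∫ y, f y ∂(poissonVector d lam) := by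
    rw [← hmap, integral_map hX.aemeasurable hfc.aestronglyMeasurable]
  set u := b * x / abar2 with hu
  have hu0 : 0 < u := by positivity
  have hlog : 0 < Real.log (1 + u) := Real.log_pos (by linarith)
  set t := Real.log (1 + u) / b with ht
  have ht0 : 0 < t := div_pos hlog hb0
  have hexp := lintegral_exp_poissonVector_le lam hb0 ht0 f hfc hfi hfb hfv
  rw [← hmap, lintegral_map (by fun_prop) hX, hmap] at hexp
  set m := ∫ y, f y ∂(poissonVector d lam)
  have hmarkov := meas_ge_le_lintegral_div (μ := (ℙ : Measure Ω))
    (f := fun ω => ENNReal.ofReal (Real.exp (t * f (X ω))))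
    (ε := ENNReal.ofReal (Real.exp (t * (m + x)))) (by fun_prop)
    (by simp [Real.exp_pos]) ENNReal.ofReal_ne_top
  calc ℙ {ω | f (X ω) - (∫ ω', f (X ω')) ≥ x}
      ≤ ℙ {ω | ENNReal.ofReal (Real.exp (t * (m + x))) ≤
          ENNReal.ofReal (Real.exp (t * f (X ω)))} := by
        refine measure_mono fun ω hω => ENNReal.ofReal_le_ofReal ?_
        rw [Set.mem_ofPred_eq, hmean] at hω
        gcongr
        linarith
    _ ≤ _ := hmarkov
    _ ≤ _ := ENNReal.div_le_div_right hexp _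
    _ = _ := by
        rw [← ENNReal.ofReal_div_of_pos (Real.exp_pos _), ← Real.exp_sub]
        congr 2
        have htb : t * b = Real.log (1 + u) := by rw [ht]; field_simp
        have hxu : x = abar2 * u / b := by rw [hu]; field_simp
        rw [htb, Real.exp_log (by linarith), hxu, ht]
        field_simp
        ring
end

section
/- Let X = (X₁,…,X_d) be a random vector whose components are i.i.d., each with the two-sided (symmetric) exponential distribution on ℝ with density x ↦ (1/2)e^{−|x|} with respect to Lebesgue measure. Let f : ℝ^d → ℝ and b₁,…,b_d ∈ ℝ be such that |f(x + u e_k) − f(x)| ≤ b_k|u| for all u ∈ ℝ, x ∈ ℝ^d and k = 1,…,d, where e₁,…,e_d is the canonical basis of ℝ^d. Set b = max_{1≤k≤d} b_k > 0 and ã² = sup over x ∈ ℝ^d and u ∈ ℝ, u ≠ 0, of Σ_{k=1}^d |f(x + u e_k) − f(x)|²/u², and assume 0 < ã² < ∞. Then for all x > 0, P( f(X) − E f(X) ≥ x ) ≤ exp( −(4ã²/b²)·( 1 + bx/(4ã²) − √(1 + bx/(2ã²)) ) ). -/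
open MeasureTheory ProbabilityTheory Real
open scoped ENNReal

lemma LipschitzWith.contDiff_comp_absolutelyContinuousOnInterval {ψ φ : ℝ → ℝ} {K : NNReal}
    (hψ : ContDiff ℝ 1 ψ) (hφ : LipschitzWith K φ) (a b : ℝ) :
    AbsolutelyContinuousOnInterval (fun t => ψ (φ t)) a b := by
  obtain ⟨M, hM⟩ := (isCompact_uIcc (a := a) (b := b)).exists_bound_of_continuousOn
    hφ.continuous.continuousOn
  obtain ⟨L, hL⟩ := (hψ.contDiffOn (s := Set.Icc (-M) M)).exists_lipschitzOnWith (by decide)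
    (convex_Icc _ _) isCompact_Icc
  refine (hL.comp (hφ.lipschitzOnWith (s := Set.uIcc a b)) ?_).absolutelyContinuousOnInterval
  intro t ht
  exact abs_le.1 (hM t ht)

lemma integral_Ioi_comp_mul_exp_neg_eq {ψ ψ' φ : ℝ → ℝ} {K : NNReal}
    (hψ : ContDiff ℝ 1 ψ) (hψ' : ∀ y, HasDerivAt ψ (ψ' y) y) (hφ : LipschitzWith K φ)
    (h0 : ψ (φ 0) = 0)
    (hlim : Filter.Tendsto (fun t => ψ (φ t) * exp (-t)) Filter.atTop (nhds 0))
    (hi : IntegrableOn (fun t => ψ (φ t) * exp (-t)) (Set.Ioi 0))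
    (hi' : IntegrableOn (fun t => ψ' (φ t) * deriv φ t * exp (-t)) (Set.Ioi 0)) :
    ∫ t in Set.Ioi 0, ψ (φ t) * exp (-t) = ∫ t in Set.Ioi 0, ψ' (φ t) * deriv φ t * exp (-t) := by
  have key : ∀ R : ℝ, ∫ t in (0 : ℝ)..R, (ψ' (φ t) * deriv φ t * exp (-t) - ψ (φ t) * exp (-t))
      = ψ (φ R) * exp (-R) := by
    intro R
    have hac := (hφ.contDiff_comp_absolutelyContinuousOnInterval hψ 0 R)
    have hexp : AbsolutelyContinuousOnInterval (fun t : ℝ => exp (-t)) 0 R :=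
      ContDiffOn.absolutelyContinuousOnInterval (by fun_prop)
    have h := (hac.fun_mul hexp).integral_deriv_eq_sub
    simp only [h0, zero_mul, sub_zero] at h
    rw [← h]
    refine intervalIntegral.integral_congr_ae ?_
    filter_upwards [hφ.ae_differentiableAt (μ := volume)] with t ht _
    have h1 := ((hψ' (φ t)).comp t ht.hasDerivAt).mul ((hasDerivAt_neg t).exp)
    have h2 := h1.deriv
    simp only [Function.comp_def] at h2
    erw [h2]
    ring
  have h1 := intervalIntegral_tendsto_integral_Ioi 0 (hi'.sub hi) Filter.tendsto_id
  simp only [id, Pi.sub_apply, key] at h1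
  have h2 := tendsto_nhds_unique h1 hlim
  rw [integral_sub hi' hi] at h2
  linarith

lemma one_add_abs_add_sq_le {ε : ℝ} (hε : 0 < ε) (y : ℝ) :
    1 + |y| + y ^ 2 ≤ (1 + 1 / ε + 2 / ε ^ 2) * exp (ε * |y|) := by
  have h := Real.quadratic_le_exp_of_nonneg (x := ε * |y|) (by positivity)
  have h1 : |y| ≤ 1 / ε * exp (ε * |y|) := by
    rw [div_mul_eq_mul_div, le_div_iff₀ hε]; nlinarith [sq_nonneg (ε * |y|)]
  have h2 : y ^ 2 ≤ 2 / ε ^ 2 * exp (ε * |y|) := by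
    rw [div_mul_eq_mul_div, le_div_iff₀ (by positivity)]
    have : 0 ≤ ε * |y| := by positivity
    nlinarith [sq_abs y]
  have h3 : 1 ≤ exp (ε * |y|) := Real.one_le_exp (by positivity)
  linarith

/-- Functions of at most quadratic times exponential growth, composed with functions of growth
slope `c < 1`, grow at some exponential rate smaller than one. -/
lemma exists_growth_bound {c : ℝ} (hc1 : c < 1) :
    ∃ A c', 0 ≤ A ∧ c' < 1 ∧ ∀ y t : ℝ, |y| ≤ c * t →
      (1 + |y| + y ^ 2) * exp |y| ≤ A * exp (c' * t) := by
  refine ⟨1 + 1 / ((1 - c) / 2) + 2 / ((1 - c) / 2) ^ 2, (1 + (1 - c) / 2) * c, ?_, ?_, ?_⟩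
  · have : 0 < 1 - c := by linarith
    positivity
  · nlinarith
  · intro y t hy
    have hε : 0 < (1 - c) / 2 := by linarith
    have h := one_add_abs_add_sq_le hε y
    calc _ ≤ (1 + 1 / ((1 - c) / 2) + 2 / ((1 - c) / 2) ^ 2) * exp ((1 - c) / 2 * |y|) *
            exp |y| := by gcongr
      _ = (1 + 1 / ((1 - c) / 2) + 2 / ((1 - c) / 2) ^ 2) * exp ((1 + (1 - c) / 2) * |y|) := by
          rw [mul_assoc, ← Real.exp_add]; ring_nf
      _ ≤ _ := by
          have : (1 + (1 - c) / 2) * |y| ≤ (1 + (1 - c) / 2) * c * t := by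
            rw [mul_assoc]; gcongr
          gcongr

lemma abs_le_of_lipschitz {φ : ℝ → ℝ} {c : NNReal} (hφ : LipschitzWith c φ) (h0 : φ 0 = 0)
    (t : ℝ) : |φ t| ≤ c * |t| := by
  simpa [h0, Real.dist_eq] using hφ.dist_le_mul t 0

lemma abs_deriv_le_of_lipschitz {φ : ℝ → ℝ} {c : NNReal} (hφ : LipschitzWith c φ) (t : ℝ) :
    |deriv φ t| ≤ c := by
  simpa using norm_deriv_le_of_lipschitz (x₀ := t) hφ

/-- The weighted function inequality behind the Bobkov–Ledoux modified logarithmic Sobolev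
inequality, on a half line. -/
lemma integral_Ioi_modified_logSobolev {φ : ℝ → ℝ} {c : NNReal} (hc : c < 1)
    (hφ : LipschitzWith c φ) (h0 : φ 0 = 0) :
    0 ≤ ∫ t in Set.Ioi 0, (2 / (1 - c) * (deriv φ t ^ 2 * exp (φ t)) -
      (φ t * exp (φ t) - exp (φ t) + 1)) * exp (-t) := by
  have hc1 : (c : ℝ) < 1 := by exact_mod_cast hc
  obtain ⟨A, c', hA, hc', hgr⟩ := exists_growth_bound hc1
  have hm : Measurable φ := hφ.continuous.measurable
  have hd : Measurable (deriv φ) := measurable_deriv φ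
  have hdom : IntegrableOn (fun t : ℝ => 4 * A * exp (-(1 - c') * t)) (Set.Ioi 0) :=
    (exp_neg_integrableOn_Ioi 0 (by linarith)).const_mul _
  have hW : ∀ t : ℝ, 0 < t → (1 + |φ t| + φ t ^ 2) * exp |φ t| * exp (-t) ≤
      A * exp (-(1 - c') * t) := by
    intro t ht
    have h1 := hgr (φ t) t (by simpa [abs_of_pos ht] using abs_le_of_lipschitz hφ h0 t)
    calc _ ≤ A * exp (c' * t) * exp (-t) := by gcongr
      _ = _ := by rw [mul_assoc, ← Real.exp_add]; ring_nf
  have hint : ∀ G : ℝ → ℝ, Measurable G →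
      (∀ t, |G t| ≤ 4 * ((1 + |φ t| + φ t ^ 2) * exp |φ t|)) →
      IntegrableOn (fun t => G t * exp (-t)) (Set.Ioi 0) := by
    intro G hG hb
    refine hdom.mono' (hG.mul (by fun_prop)).aestronglyMeasurable ?_
    filter_upwards [ae_restrict_mem measurableSet_Ioi] with t ht
    rw [norm_mul, Real.norm_eq_abs, Real.norm_eq_abs, abs_exp]
    have := hW t ht
    calc _ ≤ 4 * ((1 + |φ t| + φ t ^ 2) * exp |φ t|) * exp (-t) := by gcongr; exact hb t
      _ ≤ _ := by linarith
  have hlim : ∀ G : ℝ → ℝ, (∀ t, |G t| ≤ 4 * ((1 + |φ t| + φ t ^ 2) * exp |φ t|)) →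
      Filter.Tendsto (fun t => G t * exp (-t)) Filter.atTop (nhds 0) := by
    intro G hb
    have h1 : Filter.Tendsto (fun t : ℝ => 4 * A * exp (-(1 - c') * t)) Filter.atTop (nhds 0) := by
      have : Filter.Tendsto (fun t : ℝ => (1 - c') * t) Filter.atTop Filter.atTop :=
        Filter.tendsto_id.const_mul_atTop (by linarith)
      simpa only [neg_mul, mul_zero, Function.comp_def] using
        (Real.tendsto_exp_neg_atTop_nhds_zero.comp this).const_mul (4 * A)
    refine squeeze_zero_norm' ?_ h1
    filter_upwards [Filter.eventually_gt_atTop 0] with t ht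
    rw [norm_mul, Real.norm_eq_abs, Real.norm_eq_abs, abs_exp]
    have := hW t ht
    calc _ ≤ 4 * ((1 + |φ t| + φ t ^ 2) * exp |φ t|) * exp (-t) := by gcongr; exact hb t
      _ ≤ _ := by linarith
  have hE : ∀ y : ℝ, exp y ≤ exp |y| := fun y => exp_le_exp.2 (le_abs_self y)
  have hE1 : ∀ y : ℝ, 1 ≤ exp |y| := fun y => Real.one_le_exp (abs_nonneg y)
  have hdl := abs_deriv_le_of_lipschitz hφ
  have hd1 : ∀ t, |deriv φ t| ≤ 1 := fun t => (hdl t).trans hc1.le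
  have b0 : ∀ t, |φ t * exp (φ t) - exp (φ t) + 1| ≤ 4 * ((1 + |φ t| + φ t ^ 2) * exp |φ t|) := by
    intro t
    have := hE (φ t); have := hE1 (φ t); have := exp_pos (φ t)
    have h3 : |φ t * exp (φ t)| ≤ |φ t| * exp |φ t| := by rw [abs_mul, abs_exp]; gcongr
    have h4 : 0 ≤ |φ t| * exp |φ t| := by positivity
    have h5 : 0 ≤ φ t ^ 2 * exp |φ t| := by positivity
    rw [abs_le] at *
    constructor <;> nlinarith
  have b1 : ∀ t, |φ t * exp (φ t) * deriv φ t| ≤ 4 * ((1 + |φ t| + φ t ^ 2) * exp |φ t|) := by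
    intro t
    have h3 : |φ t * exp (φ t) * deriv φ t| ≤ |φ t| * exp |φ t| * 1 := by
      rw [abs_mul, abs_mul, abs_exp]; gcongr; exacts [le_abs_self _, hd1 t]
    have h4 : 0 ≤ |φ t| * exp |φ t| := by positivity
    have h5 : 0 ≤ φ t ^ 2 * exp |φ t| := by positivity
    nlinarith [hE1 (φ t)]
  have b2 : ∀ t, |φ t ^ 2 * exp (φ t)| ≤ 4 * ((1 + |φ t| + φ t ^ 2) * exp |φ t|) := by
    intro t
    have h3 : |φ t ^ 2 * exp (φ t)| ≤ φ t ^ 2 * exp |φ t| := by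
      rw [abs_mul, abs_exp, abs_of_nonneg (sq_nonneg _)]; gcongr; exact le_abs_self _
    have h4 : 0 ≤ |φ t| * exp |φ t| := by positivity
    have h5 : 0 ≤ φ t ^ 2 * exp |φ t| := by positivity
    nlinarith [hE1 (φ t)]
  have b3 : ∀ t, |(2 * φ t + φ t ^ 2) * exp (φ t) * deriv φ t| ≤
      4 * ((1 + |φ t| + φ t ^ 2) * exp |φ t|) := by
    intro t
    have h2 : |2 * φ t + φ t ^ 2| ≤ 2 * |φ t| + φ t ^ 2 := by
      refine (abs_add_le _ _).trans_eq ?_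
      rw [abs_mul, abs_of_nonneg (sq_nonneg (φ t))]; norm_num
    have h3 : |(2 * φ t + φ t ^ 2) * exp (φ t) * deriv φ t| ≤
        (2 * |φ t| + φ t ^ 2) * exp |φ t| * 1 := by
      rw [abs_mul, abs_mul, abs_exp]; gcongr; exacts [le_abs_self _, hd1 t]
    have h4 : 0 ≤ |φ t| * exp |φ t| := by positivity
    have h5 : 0 ≤ φ t ^ 2 * exp |φ t| := by positivity
    nlinarith [hE1 (φ t)]
  have b4 : ∀ t, |deriv φ t ^ 2 * exp (φ t)| ≤ 4 * ((1 + |φ t| + φ t ^ 2) * exp |φ t|) := by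
    intro t
    have h3 : |deriv φ t ^ 2 * exp (φ t)| ≤ 1 * exp |φ t| := by
      rw [abs_mul, abs_exp, abs_pow]; gcongr
      exacts [pow_le_one₀ (abs_nonneg _) (hd1 t), le_abs_self _]
    have h4 : 0 ≤ |φ t| * exp |φ t| := by positivity
    have h5 : 0 ≤ φ t ^ 2 * exp |φ t| := by positivity
    nlinarith [hE1 (φ t)]
  have i0 := hint _ (by fun_prop) b0
  have i1 := hint _ (by fun_prop) b1
  have i2 := hint _ (by fun_prop) b2
  have i3 := hint _ (by fun_prop) b3
  have i4 := hint _ (by fun_prop) b4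
  have ibp1 := integral_Ioi_comp_mul_exp_neg_eq (ψ := fun y => y * exp y - exp y + 1)
    (ψ' := fun y => y * exp y) (by fun_prop)
    (fun y => by
      have := (((hasDerivAt_id y).mul (hasDerivAt_exp y)).sub (hasDerivAt_exp y)).add_const 1
      convert! this using 1
      simp) hφ (by simp [h0]) (hlim _ b0) i0 i1
  have ibp2 := integral_Ioi_comp_mul_exp_neg_eq (ψ := fun y => y ^ 2 * exp y)
    (ψ' := fun y => (2 * y + y ^ 2) * exp y) (by fun_prop)
    (fun y => by
      have := ((hasDerivAt_pow 2 y).mul (hasDerivAt_exp y))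
      convert! this using 1
      simp; ring) hφ (by simp [h0]) (hlim _ b2) i2 i3
  have hpos : (0 : ℝ) < 1 - c := by linarith
  set I2 := ∫ t in Set.Ioi 0, φ t ^ 2 * exp (φ t) * exp (-t)
  set I4 := ∫ t in Set.Ioi 0, deriv φ t ^ 2 * exp (φ t) * exp (-t) with hI4
  have e1 : ∫ t in Set.Ioi 0, φ t * exp (φ t) * deriv φ t * exp (-t) ≤
      1 / (1 - c) * I4 + (1 - c) / 4 * I2 := by
    rw [← integral_const_mul, ← integral_const_mul,
      ← integral_add (i4.const_mul _) (i2.const_mul _)]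
    refine integral_mono i1 ((i4.const_mul _).add (i2.const_mul _)) fun t => ?_
    have : φ t * deriv φ t ≤ 1 / (1 - c) * deriv φ t ^ 2 + (1 - c) / 4 * φ t ^ 2 := by
      have := mul_nonneg (one_div_pos.2 hpos).le (sq_nonneg (deriv φ t - (1 - c) / 2 * φ t))
      have h6 : 1 / (1 - (c : ℝ)) * (deriv φ t - (1 - c) / 2 * φ t) ^ 2 =
        1 / (1 - c) * deriv φ t ^ 2 + (1 - c) / 4 * φ t ^ 2 - φ t * deriv φ t := by
        field_simp; ring
      linarith
    calc _ = φ t * deriv φ t * (exp (φ t) * exp (-t)) := by ring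
      _ ≤ (1 / (1 - c) * deriv φ t ^ 2 + (1 - c) / 4 * φ t ^ 2) * (exp (φ t) * exp (-t)) := by
        gcongr
      _ = _ := by ring
  have e2 : ∫ t in Set.Ioi 0, (2 * φ t + φ t ^ 2) * exp (φ t) * deriv φ t * exp (-t) ≤
      2 / (1 - c) * I4 + (1 + c) / 2 * I2 := by
    rw [← integral_const_mul, ← integral_const_mul,
      ← integral_add (i4.const_mul _) (i2.const_mul _)]
    refine integral_mono i3 ((i4.const_mul _).add (i2.const_mul _)) fun t => ?_
    have : (2 * φ t + φ t ^ 2) * deriv φ t ≤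
        2 / (1 - c) * deriv φ t ^ 2 + (1 + c) / 2 * φ t ^ 2 := by
      have := mul_nonneg (one_div_pos.2 hpos).le (sq_nonneg (deriv φ t - (1 - c) / 2 * φ t))
      have h6 : 1 / (1 - (c : ℝ)) * (deriv φ t - (1 - c) / 2 * φ t) ^ 2 =
        1 / (1 - c) * deriv φ t ^ 2 + (1 - c) / 4 * φ t ^ 2 - φ t * deriv φ t := by
        field_simp; ring
      have h7 : 2 / (1 - (c : ℝ)) = 2 * (1 / (1 - c)) := by ring
      have h8 : φ t ^ 2 * deriv φ t ≤ φ t ^ 2 * c :=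
        mul_le_mul_of_nonneg_left (le_of_abs_le (hdl t)) (sq_nonneg _)
      rw [h7]
      linarith
    calc _ = (2 * φ t + φ t ^ 2) * deriv φ t * (exp (φ t) * exp (-t)) := by ring
      _ ≤ (2 / (1 - c) * deriv φ t ^ 2 + (1 + c) / 2 * φ t ^ 2) * (exp (φ t) * exp (-t)) := by
        gcongr
      _ = _ := by ring
  have e3 : ∫ t in Set.Ioi 0, (2 / (1 - c) * (deriv φ t ^ 2 * exp (φ t)) -
      (φ t * exp (φ t) - exp (φ t) + 1)) * exp (-t) =
      2 / (1 - c) * I4 - ∫ t in Set.Ioi 0, (φ t * exp (φ t) - exp (φ t) + 1) * exp (-t) := by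
    rw [hI4, ← integral_const_mul, ← integral_sub (i4.const_mul _) i0]
    congr 1; ext t; ring
  rw [e3, ibp1]
  have h7 : 2 / (1 - (c : ℝ)) * I4 = 2 * (1 / (1 - c) * I4) := by ring
  linarith

/-- The symmetric exponential distribution on `ℝ`, with density `(1/2) e^{-|t|}`. -/
noncomputable def laplaceMeasure : Measure ℝ :=
  (volume : Measure ℝ).withDensity fun t => ENNReal.ofReal ((1/2) * Real.exp (-|t|))

lemma integrable_laplaceMeasure_iff {G : ℝ → ℝ} :
    Integrable G laplaceMeasure ↔ Integrable (fun t => 1 / 2 * exp (-|t|) * G t) := by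
  rw [laplaceMeasure, integrable_withDensity_iff_integrable_smul' (by fun_prop)
    (.of_forall fun _ => ENNReal.ofReal_lt_top)]
  refine integrable_congr (.of_forall fun t => ?_)
  simp only [smul_eq_mul]
  rw [ENNReal.toReal_ofReal (by positivity)]

lemma integral_laplaceMeasure (G : ℝ → ℝ) :
    ∫ t, G t ∂laplaceMeasure = ∫ t, 1 / 2 * exp (-|t|) * G t := by
  rw [laplaceMeasure, integral_withDensity_eq_integral_toReal_smul (by fun_prop)
    (.of_forall fun _ => ENNReal.ofReal_lt_top)]
  congr 1; ext t
  rw [ENNReal.toReal_ofReal (by positivity), smul_eq_mul]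

lemma integrable_exp_neg_mul_abs {a : ℝ} (ha : 0 < a) :
    Integrable (fun t : ℝ => exp (-a * |t|)) := by
  rw [← integrableOn_univ, ← Set.Iic_union_Ioi (a := (0 : ℝ))]
  refine IntegrableOn.union ?_ ?_
  · refine (integrableOn_exp_mul_Iic ha 0).congr_fun (fun t ht => ?_) measurableSet_Iic
    simp [abs_of_nonpos (Set.mem_Iic.1 ht)]
  · refine (exp_neg_integrableOn_Ioi 0 ha).congr_fun (fun t ht => ?_) measurableSet_Ioi
    simp [abs_of_pos (Set.mem_Ioi.1 ht)]

instance : IsProbabilityMeasure laplaceMeasure := by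
  constructor
  have hi := (integrable_exp_neg_mul_abs one_pos).const_mul (1 / 2)
  simp only [neg_mul, one_mul] at hi
  rw [laplaceMeasure, withDensity_apply _ MeasurableSet.univ, Measure.restrict_univ,
    ← ofReal_integral_eq_lintegral_ofReal hi (.of_forall fun t => by positivity),
    integral_const_mul, integral_comp_abs (f := fun t => exp (-t)), integral_exp_neg_Ioi_zero]
  norm_num

lemma integrable_exp_mul_abs_laplaceMeasure {c : ℝ} (hc : c < 1) :
    Integrable (fun t => exp (c * |t|)) laplaceMeasure := by
  rw [integrable_laplaceMeasure_iff]
  refine ((integrable_exp_neg_mul_abs (a := 1 - c) (by linarith)).const_mul (1 / 2)).congr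
    (.of_forall fun t => ?_)
  simp only
  rw [mul_assoc, ← Real.exp_add]; ring_nf

lemma integral_laplaceMeasure_nonneg_of_Ioi {G : ℝ → ℝ} (hG : Integrable G laplaceMeasure)
    (h1 : 0 ≤ ∫ t in Set.Ioi 0, G t * exp (-t)) (h2 : 0 ≤ ∫ t in Set.Ioi 0, G (-t) * exp (-t)) :
    0 ≤ ∫ t, G t ∂laplaceMeasure := by
  rw [integrable_laplaceMeasure_iff] at hG
  rw [integral_laplaceMeasure, ← intervalIntegral.integral_Iic_add_Ioi (b := 0) hG.integrableOn
    hG.integrableOn]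
  have e1 : ∫ t in Set.Ioi 0, 1 / 2 * exp (-|t|) * G t =
      1 / 2 * ∫ t in Set.Ioi 0, G t * exp (-t) := by
    rw [← integral_const_mul]
    refine setIntegral_congr_fun measurableSet_Ioi fun t ht => ?_
    simp only [abs_of_pos (Set.mem_Ioi.1 ht)]; ring
  have e2 : ∫ t in Set.Iic 0, 1 / 2 * exp (-|t|) * G t =
      1 / 2 * ∫ t in Set.Ioi 0, G (-t) * exp (-t) := by
    rw [← integral_const_mul]
    have := integral_comp_neg_Ioi 0 (fun t => 1 / 2 * exp (-|t|) * G t)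
    rw [neg_zero] at this
    rw [← this]
    refine setIntegral_congr_fun measurableSet_Ioi fun t ht => ?_
    simp only [abs_neg, abs_of_pos (Set.mem_Ioi.1 ht)]; ring
  rw [e1, e2]
  positivity

/-- Dual form of the Bobkov–Ledoux modified logarithmic Sobolev inequality for the symmetric
exponential distribution. -/
lemma integral_mul_exp_laplaceMeasure_le {φ h : ℝ → ℝ} {c : NNReal} (hc : c < 1)
    (hφ : LipschitzWith c φ) (hh : Integrable (fun t => h t * exp (φ t)) laplaceMeasure)
    (he : Integrable (fun t => exp (h t)) laplaceMeasure)
    (he1 : ∫ t, exp (h t) ∂laplaceMeasure ≤ 1) :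
    ∫ t, h t * exp (φ t) ∂laplaceMeasure ≤
      ∫ t, 2 / (1 - c) * (deriv φ t ^ 2 * exp (φ t)) ∂laplaceMeasure := by
  wlog h0 : φ 0 = 0 generalizing φ
  · have hd : ∀ t, deriv (fun t => φ t - φ 0) t = deriv φ t := fun t => deriv_sub_const _
    have hx : ∀ t, exp (φ t - φ 0) = exp (-φ 0) * exp (φ t) := fun t => by
      rw [← Real.exp_add]; ring_nf
    have := this (φ := fun t => φ t - φ 0)
      (LipschitzWith.of_dist_le_mul fun s t => by simpa using hφ.dist_le_mul s t)
      (by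
        refine (hh.const_mul (exp (-φ 0))).congr (.of_forall fun t => ?_)
        simp only [hx]; ring) (sub_self _)
    simp only [hd, hx] at this
    simp_rw [mul_left_comm _ (exp (-φ 0)), integral_const_mul (exp (-φ 0))] at this
    exact le_of_mul_le_mul_left this (exp_pos _)
  have hc1 : (c : ℝ) < 1 := by exact_mod_cast hc
  obtain ⟨A, c', hA, hc', hgr⟩ := exists_growth_bound hc1
  have hm : Measurable φ := hφ.continuous.measurable
  have hd : Measurable (deriv φ) := measurable_deriv φ
  have hW := fun t : ℝ => hgr (φ t) |t| (abs_le_of_lipschitz hφ h0 t)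
  have hE : ∀ y : ℝ, exp y ≤ exp |y| := fun y => exp_le_exp.2 (le_abs_self y)
  have hE1 : ∀ y : ℝ, 1 ≤ exp |y| := fun y => Real.one_le_exp (abs_nonneg y)
  have hdl := abs_deriv_le_of_lipschitz hφ
  have hd1 : ∀ t, |deriv φ t| ≤ 1 := fun t => (hdl t).trans hc1.le
  have hdom := (integrable_exp_mul_abs_laplaceMeasure hc').const_mul (4 * A)
  have i1 : Integrable (fun t => φ t * exp (φ t) - exp (φ t) + 1) laplaceMeasure := by
    refine hdom.mono' (by fun_prop) (.of_forall fun t => ?_)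
    have := hE (φ t); have := hE1 (φ t); have := exp_pos (φ t); have := hW t
    have h3 : |φ t * exp (φ t)| ≤ |φ t| * exp |φ t| := by rw [abs_mul, abs_exp]; gcongr
    have h4 : 0 ≤ |φ t| * exp |φ t| := by positivity
    have h5 : 0 ≤ φ t ^ 2 * exp |φ t| := by positivity
    rw [norm_eq_abs]
    rw [abs_le] at *
    constructor <;> nlinarith
  have i2 : Integrable (fun t => 2 / (1 - c) * (deriv φ t ^ 2 * exp (φ t))) laplaceMeasure := by
    refine Integrable.const_mul (hdom.mono' (by fun_prop) (.of_forall fun t => ?_)) _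
    have h3 : |deriv φ t ^ 2 * exp (φ t)| ≤ 1 * exp |φ t| := by
      rw [abs_mul, abs_exp, abs_pow]; gcongr
      exacts [pow_le_one₀ (abs_nonneg _) (hd1 t), le_abs_self _]
    have h4 : 0 ≤ |φ t| * exp |φ t| := by positivity
    have h5 : 0 ≤ φ t ^ 2 * exp |φ t| := by positivity
    rw [norm_eq_abs]
    nlinarith [hE1 (φ t), hW t]
  have hdual : ∫ t, h t * exp (φ t) ∂laplaceMeasure ≤
      ∫ t, (φ t * exp (φ t) - exp (φ t) + 1) ∂laplaceMeasure := by
    have hpt : ∀ t, h t * exp (φ t) ≤ (φ t * exp (φ t) - exp (φ t) + 1) + (exp (h t) - 1) := by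
      intro t
      have h3 := mul_le_mul_of_nonneg_right (Real.add_one_le_exp (h t - φ t)) (exp_pos (φ t)).le
      rw [← Real.exp_add, sub_add_cancel] at h3
      linarith
    have i3 : Integrable (fun t => exp (h t) - 1) laplaceMeasure := he.sub (integrable_const 1)
    have := integral_mono hh (i1.add i3) hpt
    rw [integral_add' i1 i3, integral_sub he (integrable_const 1)] at this
    simp only [integral_const, probReal_univ, smul_eq_mul, mul_one] at this
    linarith
  refine hdual.trans ?_
  rw [← sub_nonneg, ← integral_sub i2 i1]
  refine integral_laplaceMeasure_nonneg_of_Ioi (i2.sub i1)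
    (integral_Ioi_modified_logSobolev hc hφ h0) ?_
  have := integral_Ioi_modified_logSobolev (φ := fun t => φ (-t)) hc
    (LipschitzWith.of_dist_le_mul fun s t => by simpa [dist_neg_neg] using hφ.dist_le_mul (-s) (-t))
    (by simpa using h0)
  simpa [deriv_comp_neg] using this

section Tensorization

variable {ι : Type*}

/-- The `k`-th partial derivative, with value `0` where it does not exist. -/
noncomputable def partialDeriv [DecidableEq ι] (f : (ι → ℝ) → ℝ) (k : ι) (x : ι → ℝ) : ℝ :=
  deriv (fun t => f (Function.update x k t)) (x k)

lemma partialDeriv_update [DecidableEq ι] (f : (ι → ℝ) → ℝ) (k : ι) (x : ι → ℝ) (t : ℝ) :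
    partialDeriv f k (Function.update x k t) = deriv (fun u => f (Function.update x k u)) t := by
  simp [partialDeriv]

lemma partialDeriv_const_mul [DecidableEq ι] (a : ℝ) (g : (ι → ℝ) → ℝ) (k : ι) (x : ι → ℝ) :
    partialDeriv (fun x => a * g x) k x = a * partialDeriv g k x :=
  deriv_const_mul_field a

variable [Fintype ι]

/-- `F` is Lipschitz with constant `c` for the `ℓ¹` distance on `ι → ℝ`. -/
def L1LipschitzWith (c : NNReal) (F : (ι → ℝ) → ℝ) : Prop :=
  ∀ x y, |F x - F y| ≤ c * ∑ i, |x i - y i|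

lemma L1LipschitzWith.continuous {c : NNReal} {F : (ι → ℝ) → ℝ} (hF : L1LipschitzWith c F) :
    Continuous F := by
  refine (LipschitzWith.of_dist_le_mul (K := c * Fintype.card ι) fun x y => ?_).continuous
  rw [Real.dist_eq]
  refine (hF x y).trans ?_
  push_cast
  rw [mul_assoc]
  gcongr
  calc ∑ i, |x i - y i| ≤ ∑ _i : ι, dist x y :=
        Finset.sum_le_sum fun i _ => by simpa [Real.dist_eq] using dist_le_pi_dist x y i
    _ = _ := by simp

lemma integrable_exp_mul_sum_abs {c : ℝ} (hc : c < 1) :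
    Integrable (fun x : ι → ℝ => exp (c * ∑ i, |x i|)) (Measure.pi fun _ => laplaceMeasure) := by
  have := Integrable.fintype_prod (ι := ι) (μ := fun _ => laplaceMeasure)
    (f := fun _ t => exp (c * |t|)) fun _ => integrable_exp_mul_abs_laplaceMeasure hc
  simpa [Finset.mul_sum, Real.exp_sum] using this

lemma L1LipschitzWith.integrable_mul_exp {c : NNReal} (hc : c < 1) {f G : (ι → ℝ) → ℝ}
    (hf : L1LipschitzWith c f) (hG : L1LipschitzWith c G) :
    Integrable (fun x => G x * exp (f x)) (Measure.pi fun _ => laplaceMeasure) := by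
  obtain ⟨A, c', hA, hc', hgr⟩ := exists_growth_bound (c := c) (by exact_mod_cast hc)
  refine ((integrable_exp_mul_sum_abs hc').const_mul (exp (f 0) * (1 + |G 0|) * A)).mono'
    (hG.continuous.mul hf.continuous.rexp).aestronglyMeasurable (.of_forall fun x => ?_)
  have hS : 0 ≤ ∑ i, |x i| := by positivity
  set S := ∑ i, |x i| with hSdef
  have h1 := abs_le.1 (by simpa using hf x 0)
  have h2 : |G x| ≤ |G 0| + c * S := by
    have h := (abs_sub_abs_le_abs_sub (G x) (G 0)).trans (hG x 0)
    simp only [Pi.zero_apply, sub_zero] at h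
    linarith
  have hcS : 0 ≤ c * S := by positivity
  have h3 := hgr (c * S) S (abs_of_nonneg hcS).le
  rw [abs_of_nonneg hcS] at h3
  have h4 : |G x| ≤ (1 + |G 0|) * (1 + c * S + (c * S) ^ 2) := by
    have := abs_nonneg (G 0)
    have : 0 ≤ |G 0| * (c * S) := by positivity
    have : 0 ≤ |G 0| * (c * S) ^ 2 := by positivity
    nlinarith
  rw [norm_mul, norm_eq_abs, norm_eq_abs, abs_exp]
  calc |G x| * exp (f x)
      ≤ ((1 + |G 0|) * (1 + c * S + (c * S) ^ 2)) * exp (f 0 + c * S) := by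
        gcongr; linarith [h1.2]
    _ = exp (f 0) * (1 + |G 0|) * ((1 + c * S + (c * S) ^ 2) * exp (c * S)) := by
        rw [Real.exp_add]; ring
    _ ≤ exp (f 0) * (1 + |G 0|) * (A * exp (c' * S)) := by gcongr
    _ = _ := by ring

lemma L1LipschitzWith.integrable_exp {c : NNReal} (hc : c < 1) {f : (ι → ℝ) → ℝ}
    (hf : L1LipschitzWith c f) :
    Integrable (fun x => exp (f x)) (Measure.pi fun _ => laplaceMeasure) := by
  simpa using hf.integrable_mul_exp hc (G := fun _ => 1)
    (fun x y => by simpa using by positivity)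

variable [DecidableEq ι]

lemma sum_abs_update_sub (x : ι → ℝ) (k : ι) (s t : ℝ) :
    ∑ i, |Function.update x k s i - Function.update x k t i| = |s - t| := by
  rw [Finset.sum_eq_single k] <;> simp +contextual [Function.update_of_ne]

lemma L1LipschitzWith.update {c : NNReal} {F : (ι → ℝ) → ℝ} (hF : L1LipschitzWith c F)
    (x : ι → ℝ) (k : ι) : LipschitzWith c fun t => F (Function.update x k t) :=
  LipschitzWith.of_dist_le_mul fun s t => by
    simpa [Real.dist_eq, sum_abs_update_sub] using
      hF (Function.update x k s) (Function.update x k t)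

/-- Resampling one coordinate preserves a product measure. -/
lemma measurePreserving_update {α : Type*} [MeasurableSpace α] (μ : Measure α)
    [IsProbabilityMeasure μ] (k : ι) :
    MeasurePreserving (fun p : (ι → α) × α => Function.update p.1 k p.2)
      ((Measure.pi fun _ => μ).prod μ) (Measure.pi fun _ => μ) := by
  have hm : Measurable fun p : (ι → α) × α => Function.update p.1 k p.2 := by
    refine measurable_pi_iff.2 fun i => ?_
    by_cases h : i = k
    · subst h; simpa using measurable_snd
    · simpa [h, Function.comp_def] using (measurable_pi_apply i).comp measurable_fst
  refine ⟨hm, (Measure.pi_eq fun s hs => ?_).symm⟩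
  rw [Measure.map_apply hm (MeasurableSet.univ_pi hs)]
  have hpre : (fun p : (ι → α) × α => Function.update p.1 k p.2) ⁻¹' Set.univ.pi s =
      (Set.univ.pi (Function.update s k Set.univ)) ×ˢ s k := by
    ext ⟨x, t⟩
    simp only [Set.mem_preimage, Set.mem_univ_pi, Set.mem_prod]
    constructor
    · intro h
      refine ⟨fun i => ?_, by simpa using h k⟩
      by_cases hi : i = k
      · subst hi; simp
      · simpa [hi] using h i
    · rintro ⟨h, ht⟩ i
      by_cases hi : i = k
      · subst hi; simpa using ht
      · simpa [hi] using h i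
  rw [hpre, Measure.prod_prod, Measure.pi_pi, ← Finset.prod_erase_mul _ _ (Finset.mem_univ k),
    ← Finset.prod_erase_mul (Finset.univ) (fun i => μ (s i)) (Finset.mem_univ k)]
  simp only [Function.update_self, measure_univ, mul_one]
  congr 1
  refine Finset.prod_congr rfl fun i hi => ?_
  rw [Function.update_of_ne (Finset.ne_of_mem_erase hi)]

/-- The logarithm of the integral of `e^f` over the coordinates in `s`. -/
noncomputable def logPartialIntegral (f : (ι → ℝ) → ℝ) (s : Finset ι) (x : ι → ℝ) : ℝ :=
  log (∫ y, exp (f (s.piecewise y x)) ∂Measure.pi fun _ => laplaceMeasure)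

variable {c : NNReal} {f : (ι → ℝ) → ℝ}

lemma L1LipschitzWith.piecewise (hf : L1LipschitzWith c f) (s : Finset ι) (x : ι → ℝ) :
    L1LipschitzWith c fun y => f (s.piecewise y x) := fun y z => by
  refine (hf _ _).trans ?_
  refine mul_le_mul_of_nonneg_left (Finset.sum_le_sum fun i _ => ?_) c.2
  by_cases h : i ∈ s <;> simp [h]

lemma exp_logPartialIntegral (hc : c < 1) (hf : L1LipschitzWith c f) (s : Finset ι) (x : ι → ℝ) :
    exp (logPartialIntegral f s x) =
      ∫ y, exp (f (s.piecewise y x)) ∂Measure.pi fun _ => laplaceMeasure :=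
  exp_log (integral_exp_pos ((hf.piecewise s x).integrable_exp hc))

lemma L1LipschitzWith.logPartialIntegral (hc : c < 1) (hf : L1LipschitzWith c f) (s : Finset ι) :
    L1LipschitzWith c (logPartialIntegral f s) := by
  have key : ∀ x z, _root_.logPartialIntegral f s x - _root_.logPartialIntegral f s z ≤
      c * ∑ i, |x i - z i| := by
    intro x z
    rw [sub_le_iff_le_add, ← exp_le_exp, Real.exp_add, exp_logPartialIntegral hc hf,
      exp_logPartialIntegral hc hf, ← integral_const_mul]
    refine integral_mono ((hf.piecewise s x).integrable_exp hc)
      (((hf.piecewise s z).integrable_exp hc).const_mul _) fun y => ?_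
    simp only
    rw [← Real.exp_add, exp_le_exp, ← sub_le_iff_le_add]
    refine (le_abs_self _).trans ((hf _ _).trans ?_)
    refine mul_le_mul_of_nonneg_left (Finset.sum_le_sum fun i _ => ?_) c.2
    by_cases h : i ∈ s <;> simp [h]
  intro x z
  refine abs_sub_le_iff.2 ⟨key x z, ?_⟩
  simpa only [abs_sub_comm] using key z x

lemma integral_exp_logPartialIntegral_update (hc : c < 1) (hf : L1LipschitzWith c f)
    {s : Finset ι} {k : ι} (hk : k ∉ s) (x : ι → ℝ) :
    ∫ t, exp (logPartialIntegral f s (Function.update x k t)) ∂laplaceMeasure =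
      exp (logPartialIntegral f (insert k s) x) := by
  have hmp := measurePreserving_update (ι := ι) laplaceMeasure k
  have hi := (hf.piecewise (insert k s) x).integrable_exp hc
  have hi2 := hmp.integrable_comp_of_integrable hi
  simp only [Function.comp_def] at hi2
  rw [exp_logPartialIntegral hc hf, ← hmp.map_eq,
    integral_map hmp.measurable.aemeasurable (by rw [hmp.map_eq]; exact hi.1),
    integral_prod_symm _ hi2]
  congr 1; ext t
  rw [exp_logPartialIntegral hc hf]
  congr 1; ext y
  congr 2
  ext i
  by_cases hik : i = k
  · subst hik; simp [hk]
  · by_cases his : i ∈ s <;> simp [hik, his]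

lemma logPartialIntegral_insert_update (s : Finset ι) (k : ι) (x : ι → ℝ) (t : ℝ) :
    logPartialIntegral f (insert k s) (Function.update x k t) =
      logPartialIntegral f (insert k s) x := by
  unfold logPartialIntegral
  congr 2; ext y
  congr 2
  ext i
  by_cases hik : i = k
  · subst hik; simp
  · by_cases his : i ∈ s <;> simp [hik, his]

lemma Continuous.measurable_partialDeriv (hf : Continuous f) (k : ι) :
    Measurable (partialDeriv f k) := by
  have h : Continuous (Function.uncurry fun (x : ι → ℝ) t => f (Function.update x k t)) :=
    hf.comp (continuous_fst.update k continuous_snd)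
  exact (measurable_deriv_with_param h).comp (measurable_id.prodMk (measurable_pi_apply k))

lemma L1LipschitzWith.integrable_partialDeriv_sq_mul_exp (hc : c < 1) (hf : L1LipschitzWith c f)
    (k : ι) : Integrable (fun x => partialDeriv f k x ^ 2 * exp (f x))
      (Measure.pi fun _ => laplaceMeasure) := by
  refine (hf.integrable_exp hc).mono'
    (((hf.continuous.measurable_partialDeriv k).pow_const 2).mul
      hf.continuous.measurable.exp).aestronglyMeasurable (.of_forall fun x => ?_)
  have h1 : |partialDeriv f k x| ≤ 1 :=
    (abs_deriv_le_of_lipschitz (hf.update x k) (x k)).trans (by exact_mod_cast hc.le)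
  rw [norm_mul, norm_eq_abs, norm_eq_abs, abs_exp, abs_pow]
  exact mul_le_of_le_one_left (exp_pos _).le (pow_le_one₀ (abs_nonneg _) h1)

lemma integral_logPartialIntegral_sub_insert_le (hc : c < 1) (hf : L1LipschitzWith c f)
    {s : Finset ι} {k : ι} (hk : k ∉ s) :
    ∫ x, (logPartialIntegral f s x - logPartialIntegral f (insert k s) x) * exp (f x)
        ∂(Measure.pi fun _ => laplaceMeasure) ≤
      ∫ x, 2 / (1 - c) * (partialDeriv f k x ^ 2 * exp (f x))
        ∂(Measure.pi fun _ => laplaceMeasure) := by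
  have hmp := measurePreserving_update (ι := ι) laplaceMeasure k
  have i1 : Integrable (fun x => (logPartialIntegral f s x - logPartialIntegral f (insert k s) x) *
      exp (f x)) (Measure.pi fun _ => laplaceMeasure) := by
    simpa only [sub_mul] using! (hf.integrable_mul_exp hc (hf.logPartialIntegral hc s)).sub
      (hf.integrable_mul_exp hc (hf.logPartialIntegral hc (insert k s)))
  have i2 := (hf.integrable_partialDeriv_sq_mul_exp hc k).const_mul (2 / (1 - (c : ℝ)))
  have j1 := hmp.integrable_comp_of_integrable i1
  have j2 := hmp.integrable_comp_of_integrable i2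
  have e : ∀ G : (ι → ℝ) → ℝ, Integrable G (Measure.pi fun _ => laplaceMeasure) →
      ∫ x, G x ∂(Measure.pi fun _ => laplaceMeasure) =
      ∫ x, ∫ t, G (Function.update x k t) ∂laplaceMeasure
        ∂(Measure.pi fun _ => laplaceMeasure) := by
    intro G hG
    have hG2 := hmp.integrable_comp_of_integrable hG
    simp only [Function.comp_def] at hG2
    conv_lhs => rw [← hmp.map_eq]
    rw [integral_map hmp.measurable.aemeasurable (by rw [hmp.map_eq]; exact hG.1),
      integral_prod _ hG2]
  rw [e _ i1, e _ i2]
  refine integral_mono_ae j1.integral_prod_left j2.integral_prod_left ?_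
  filter_upwards [j1.prod_right_ae] with x hx
  simp only [Function.comp_def, partialDeriv_update, logPartialIntegral_insert_update] at hx ⊢
  have hone : ∫ t, exp (logPartialIntegral f s (Function.update x k t) -
      logPartialIntegral f (insert k s) x) ∂laplaceMeasure = 1 := by
    simp_rw [Real.exp_sub]
    rw [integral_div, integral_exp_logPartialIntegral_update hc hf hk, div_self (exp_pos _).ne']
  exact integral_mul_exp_laplaceMeasure_le hc (hf.update x k) hx
    (not_imp_comm.1 integral_undef (by rw [hone]; exact one_ne_zero)) hone.le

lemma integral_sub_logPartialIntegral_le (hc : c < 1) (hf : L1LipschitzWith c f) (s : Finset ι) :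
    ∫ x, (f x - logPartialIntegral f s x) * exp (f x) ∂(Measure.pi fun _ => laplaceMeasure) ≤
      ∑ k ∈ s, ∫ x, 2 / (1 - c) * (partialDeriv f k x ^ 2 * exp (f x))
        ∂(Measure.pi fun _ => laplaceMeasure) := by
  induction s using Finset.induction_on with
  | empty => simp [logPartialIntegral]
  | insert k s hk ih =>
    have hi : ∀ G H : (ι → ℝ) → ℝ, L1LipschitzWith c G → L1LipschitzWith c H →
        Integrable (fun x => (G x - H x) * exp (f x)) (Measure.pi fun _ => laplaceMeasure) :=
      fun G H hG hH => by
        simpa only [sub_mul] using! (hf.integrable_mul_exp hc hG).sub (hf.integrable_mul_exp hc hH)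
    have hs := hf.logPartialIntegral hc s
    have hks := hf.logPartialIntegral hc (insert k s)
    rw [Finset.sum_insert hk]
    calc _ = ∫ x, ((logPartialIntegral f s x - logPartialIntegral f (insert k s) x) * exp (f x) +
            (f x - logPartialIntegral f s x) * exp (f x))
            ∂(Measure.pi fun _ => laplaceMeasure) := by congr 1; ext x; ring
      _ = _ := integral_add (hi _ _ hs hks) (hi _ _ hf hs)
      _ ≤ _ := add_le_add (integral_logPartialIntegral_sub_insert_le hc hf hk) ih

/-- Modified logarithmic Sobolev inequality of Bobkov and Ledoux for products of symmetric
exponential distributions. -/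
lemma modified_logSobolev_pi_laplaceMeasure (hc : c < 1) (hf : L1LipschitzWith c f) {D : ℝ}
    (hD : ∀ x, ∑ k, partialDeriv f k x ^ 2 ≤ D) :
    ∫ x, f x * exp (f x) ∂(Measure.pi fun _ => laplaceMeasure) -
        log (∫ x, exp (f x) ∂(Measure.pi fun _ => laplaceMeasure)) *
          ∫ x, exp (f x) ∂(Measure.pi fun _ => laplaceMeasure) ≤
      2 * D / (1 - c) * ∫ x, exp (f x) ∂(Measure.pi fun _ => laplaceMeasure) := by
  have hpos : (0 : ℝ) < 1 - c := sub_pos.2 (by exact_mod_cast hc)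
  have h := integral_sub_logPartialIntegral_le hc hf Finset.univ
  simp only [logPartialIntegral, Finset.piecewise_univ, sub_mul] at h
  rw [integral_sub (hf.integrable_mul_exp hc hf) ((hf.integrable_exp hc).const_mul _),
    integral_const_mul] at h
  refine h.trans ?_
  have hi := fun k => (hf.integrable_partialDeriv_sq_mul_exp hc k).const_mul (2 / (1 - (c : ℝ)))
  rw [← integral_finsetSum _ fun k _ => hi k, ← integral_const_mul]
  refine integral_mono (integrable_finsetSum _ fun k _ => hi k)
    ((hf.integrable_exp hc).const_mul _) fun x => ?_
  simp only
  rw [← Finset.mul_sum, ← Finset.sum_mul, ← mul_assoc, mul_comm 2 D, mul_div_assoc, mul_comm D]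
  gcongr
  exact hD x

end Tensorization

section Herbst

variable {ι : Type*} [Fintype ι] {c : NNReal} {g : (ι → ℝ) → ℝ}

lemma L1LipschitzWith.const_mul (hg : L1LipschitzWith c g) (a : ℝ) :
    L1LipschitzWith (‖a‖₊ * c) fun x => a * g x := fun x y => by
  rw [← mul_sub, abs_mul, NNReal.coe_mul, coe_nnnorm, norm_eq_abs, mul_assoc]
  gcongr
  exact hg x y

lemma L1LipschitzWith.of_update [DecidableEq ι]
    (h : ∀ x k t, |g (Function.update x k t) - g x| ≤ c * |t - x k|) : L1LipschitzWith c g := by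
  intro x y
  have key : ∀ s : Finset ι, |g (s.piecewise x y) - g y| ≤ c * ∑ i ∈ s, |x i - y i| := by
    intro s
    induction s using Finset.induction_on with
    | empty => simp
    | insert k s hk ih =>
      rw [Finset.piecewise_insert, Finset.sum_insert hk, mul_add]
      refine (abs_sub_le _ (g (s.piecewise x y)) _).trans (add_le_add ((h _ _ _).trans_eq ?_) ih)
      simp [hk]
  simpa using key Finset.univ

lemma sum_partialDeriv_sq_le [DecidableEq ι] {D : ℝ} (x : ι → ℝ)
    (hD : ∀ u ≠ 0, ∑ k, (g (Function.update x k (x k + u)) - g x) ^ 2 / u ^ 2 ≤ D) :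
    ∑ k, partialDeriv g k x ^ 2 ≤ D := by
  classical
  set S := Finset.univ.filter fun k => DifferentiableAt ℝ (fun t => g (Function.update x k t)) (x k)
  have hS : ∑ k, partialDeriv g k x ^ 2 = ∑ k ∈ S, partialDeriv g k x ^ 2 := by
    refine (Finset.sum_subset (Finset.subset_univ S) fun k _ hk => ?_).symm
    rw [partialDeriv, deriv_zero_of_not_differentiableAt (by simpa [S] using hk),
      zero_pow two_ne_zero]
  have hlim : Filter.Tendsto
      (fun u : ℝ => ∑ k ∈ S, (u⁻¹ * (g (Function.update x k (x k + u)) - g x)) ^ 2)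
      (nhdsWithin 0 {0}ᶜ) (nhds (∑ k ∈ S, partialDeriv g k x ^ 2)) := by
    refine tendsto_finsetSum _ fun k hk => Filter.Tendsto.pow ?_ 2
    have hk : DifferentiableAt ℝ (fun t => g (Function.update x k t)) (x k) := by simpa [S] using hk
    simpa using! hasDerivAt_iff_tendsto_slope_zero.1 hk.hasDerivAt
  rw [hS]
  refine le_of_tendsto hlim (eventually_nhdsWithin_of_forall fun u hu => ?_)
  refine le_trans ?_ (hD u hu)
  calc _ ≤ ∑ k, (u⁻¹ * (g (Function.update x k (x k + u)) - g x)) ^ 2 :=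
        Finset.sum_le_sum_of_subset_of_nonneg (Finset.subset_univ S) fun _ _ _ => sq_nonneg _
    _ = _ := Finset.sum_congr rfl fun k _ => by rw [mul_pow, inv_pow, inv_mul_eq_div]

/-- Herbst's argument for the differential inequality `t K' - K ≤ a t² / (1 - b t)`. -/
lemma le_of_mul_deriv_sub_le {K : ℝ → ℝ} {a b : ℝ} (ha : 0 ≤ a) (hb : 0 < b) (hK : K 0 = 0)
    (hd : ∀ t ∈ Set.Ico 0 (1 / b), DifferentiableAt ℝ K t)
    (h : ∀ t ∈ Set.Ioo 0 (1 / b), t * deriv K t - K t ≤ a * t ^ 2 / (1 - b * t))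
    {t : ℝ} (ht : t ∈ Set.Ioo 0 (1 / b)) :
    K t ≤ t * deriv K 0 + a * t ^ 2 / (1 - b * t) := by
  have hpos : ∀ s ∈ Set.Ioo 0 (1 / b), 0 < 1 - b * s := fun s hs => by
    have := (lt_div_iff₀ hb).1 hs.2
    linarith
  set D : ℝ → ℝ := fun s => K s / s - a * s / (1 - b * s)
  have hD : ∀ s ∈ Set.Ioo 0 (1 / b), HasDerivAt D
      ((deriv K s * s - K s * 1) / s ^ 2 -
        (a * 1 * (1 - b * s) - a * s * (-(b * 1))) / (1 - b * s) ^ 2) s := fun s hs =>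
    ((hd s ⟨hs.1.le, hs.2⟩).hasDerivAt.div (hasDerivAt_id s) hs.1.ne').sub
      (((hasDerivAt_id s).const_mul a).div (((hasDerivAt_id s).const_mul b).const_sub 1)
        (hpos s hs).ne')
  have hanti : AntitoneOn D (Set.Ioo 0 (1 / b)) := by
    refine antitoneOn_of_deriv_nonpos (convex_Ioo _ _)
      (fun s hs => (hD s hs).continuousAt.continuousWithinAt)
      (fun s hs => (hD s (interior_subset hs)).differentiableAt.differentiableWithinAt)
      fun s hs => ?_
    rw [interior_Ioo] at hs
    rw [(hD s hs).deriv]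
    have hp := hpos s hs
    have h1 : (deriv K s * s - K s * 1) / s ^ 2 ≤ a / (1 - b * s) := by
      rw [div_le_iff₀ (pow_pos hs.1 2)]
      calc _ = s * deriv K s - K s := by ring
        _ ≤ _ := h s hs
        _ = _ := by ring
    have h2 : a / (1 - b * s) ≤
        (a * 1 * (1 - b * s) - a * s * (-(b * 1))) / (1 - b * s) ^ 2 := by
      rw [div_le_div_iff₀ hp (pow_pos hp 2)]
      have : 0 ≤ a * (1 - b * s) * (b * s) :=
        mul_nonneg (mul_nonneg ha hp.le) (mul_nonneg hb.le hs.1.le)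
      nlinarith
    linarith
  have hlim : Filter.Tendsto D (nhdsWithin 0 (Set.Ioi 0)) (nhds (deriv K 0)) := by
    have h1 : Filter.Tendsto (fun s => K s / s) (nhdsWithin 0 (Set.Ioi 0)) (nhds (deriv K 0)) := by
      have h := (hd 0 ⟨le_rfl, by positivity⟩).hasDerivAt.tendsto_slope_zero_right
      simpa [hK, div_eq_inv_mul] using h
    have h2 : Filter.Tendsto (fun s => a * s / (1 - b * s))
        (nhdsWithin 0 (Set.Ioi 0)) (nhds 0) := by
      have : ContinuousAt (fun s => a * s / (1 - b * s)) 0 :=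
        ContinuousAt.div (by fun_prop) (by fun_prop) (by simp)
      simpa using this.tendsto.mono_left nhdsWithin_le_nhds
    simpa using h1.sub h2
  have hle : D t ≤ deriv K 0 := by
    refine ge_of_tendsto hlim ?_
    filter_upwards [Ioo_mem_nhdsGT ht.1] with s hs
    exact hanti ⟨hs.1, hs.2.trans ht.2⟩ ht hs.2.le
  have := mul_le_mul_of_nonneg_left hle ht.1.le
  have e : t * D t = K t - a * t ^ 2 / (1 - b * t) := by
    simp only [D, mul_sub]
    rw [mul_div_cancel₀ _ ht.1.ne']
    ring
  linarith

lemma L1LipschitzWith.integrable_exp_mul (hg : L1LipschitzWith c g) {t : ℝ} (ht : |t| * c < 1) :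
    Integrable (fun x => exp (t * g x)) (Measure.pi fun _ => laplaceMeasure) :=
  (hg.const_mul t).integrable_exp (by rw [← NNReal.coe_lt_coe]; simpa using ht)

lemma L1LipschitzWith.mem_interior_integrableExpSet (hc : 0 < c) (hg : L1LipschitzWith c g) {t : ℝ}
    (ht : |t| < 1 / c) :
    t ∈ interior (integrableExpSet g (Measure.pi fun _ => laplaceMeasure)) := by
  have hc' : (0 : ℝ) < c := hc
  refine mem_interior_iff_mem_nhds.2 ?_
  filter_upwards [(isOpen_lt continuous_abs continuous_const).mem_nhds ht] with s hs
  exact hg.integrable_exp_mul ((lt_div_iff₀ hc').1 hs)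

/-- Bernstein-type bound on the cumulant generating function. -/
lemma L1LipschitzWith.cgf_le [DecidableEq ι] (hc : 0 < c) (hg : L1LipschitzWith c g) {D : ℝ}
    (hD0 : 0 ≤ D) (hD : ∀ x, ∑ k, partialDeriv g k x ^ 2 ≤ D) {t : ℝ}
    (ht : t ∈ Set.Ioo 0 (1 / (c : ℝ))) :
    cgf g (Measure.pi fun _ => laplaceMeasure) t ≤
      t * ∫ x, g x ∂(Measure.pi fun _ => laplaceMeasure) + 2 * D * t ^ 2 / (1 - c * t) := by
  have hc' : (0 : ℝ) < c := hc
  have hmem : ∀ s ∈ Set.Ico 0 (1 / (c : ℝ)),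
      s ∈ interior (integrableExpSet g (Measure.pi fun _ => laplaceMeasure)) := fun s hs =>
    hg.mem_interior_integrableExpSet hc (by rw [abs_of_nonneg hs.1]; exact hs.2)
  have h0 := deriv_cgf_zero (hmem 0 ⟨le_rfl, by positivity⟩)
  rw [probReal_univ, div_one] at h0
  rw [← h0]
  refine le_of_mul_deriv_sub_le (by positivity) hc' cgf_zero
    (fun s hs => (analyticAt_cgf (hmem s hs)).differentiableAt) (fun s hs => ?_) ht
  have hsc : ‖s‖₊ * c < 1 := by
    rw [← NNReal.coe_lt_coe]
    simpa [abs_of_pos hs.1] using (lt_div_iff₀ hc').1 hs.2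
  have hlsi := modified_logSobolev_pi_laplaceMeasure hsc (hg.const_mul s) (D := s ^ 2 * D)
    fun x => by
      simp only [partialDeriv_const_mul, mul_pow, ← Finset.mul_sum]
      exact mul_le_mul_of_nonneg_left (hD x) (sq_nonneg s)
  rw [deriv_cgf (hmem s ⟨hs.1.le, hs.2⟩)]
  have hm : 0 < mgf g (Measure.pi fun _ => laplaceMeasure) s :=
    mgf_pos (interior_subset (s := integrableExpSet g _) (hmem s ⟨hs.1.le, hs.2⟩))
  simp only [mul_assoc s, integral_const_mul] at hlsi
  change s * _ - log (mgf g _ s) * mgf g _ s ≤ _ * mgf g _ s at hlsi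
  rw [cgf, mul_div_assoc', div_sub' hm.ne', div_le_iff₀ hm]
  have e : ((‖s‖₊ * c : NNReal) : ℝ) = c * s := by simp [abs_of_pos hs.1, mul_comm]
  rw [e] at hlsi
  calc _ = _ := by rw [mul_comm (mgf g _ s)]
    _ ≤ _ := hlsi
    _ = _ := by ring

lemma exists_bernstein_exponent_eq {b D x : ℝ} (hb : 0 < b) (hD : 0 < D) (hx : 0 < x) :
    ∃ t ∈ Set.Ioo 0 (1 / b), -(t * x) + 2 * D * t ^ 2 / (1 - b * t) =
      -(4 * D / b ^ 2) * (1 + b * x / (4 * D) - √(1 + b * x / (2 * D))) := by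
  have h1 : 1 < 1 + b * x / (2 * D) := by linarith [show 0 < b * x / (2 * D) by positivity]
  set r := √(1 + b * x / (2 * D)) with hr
  have hr1 : 1 < r := Real.lt_sqrt_of_sq_lt (by simpa using h1)
  have hr0 : 0 < r := by linarith
  have hr2 : r ^ 2 = 1 + b * x / (2 * D) := Real.sq_sqrt (by linarith)
  have hxr : x = 2 * D * (r ^ 2 - 1) / b := by rw [hr2]; field_simp; ring
  have hinv : r⁻¹ < 1 := inv_lt_one_of_one_lt₀ hr1
  refine ⟨(1 - r⁻¹) / b, ⟨div_pos (by linarith) hb, ?_⟩, ?_⟩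
  · gcongr
    linarith [inv_pos.2 hr0]
  · have e : 1 - b * ((1 - r⁻¹) / b) = r⁻¹ := by field_simp; ring
    rw [e, hxr]
    field_simp
    ring

/-- Bernstein-type deviation inequality for products of symmetric exponential distributions. -/
lemma L1LipschitzWith.measureReal_ge_le [DecidableEq ι] (hc : 0 < c) (hg : L1LipschitzWith c g)
    {D : ℝ} (hD0 : 0 < D) (hD : ∀ x, ∑ k, partialDeriv g k x ^ 2 ≤ D) {r : ℝ} (hr : 0 < r) :
    (Measure.pi fun _ => laplaceMeasure).real
        {x | ∫ y, g y ∂(Measure.pi fun _ => laplaceMeasure) + r ≤ g x} ≤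
      exp (-(4 * D / c ^ 2) * (1 + c * r / (4 * D) - √(1 + c * r / (2 * D)))) := by
  have hc' : (0 : ℝ) < c := hc
  obtain ⟨t, ht, he⟩ := exists_bernstein_exponent_eq hc' hD0 hr
  have hint := hg.integrable_exp_mul (t := t)
    (by rw [abs_of_pos ht.1]; exact (lt_div_iff₀ hc').1 ht.2)
  refine (measure_ge_le_exp_cgf _ ht.1.le hint).trans ?_
  rw [← he, exp_le_exp]
  linarith [hg.cgf_le hc hD0.le hD ht]

end Herbst

/-- Bernstein-type concentration (eq. (7) of Corollary 2 of the paper) for a vector of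
i.i.d. two-sided (symmetric) exponential components, with density `(1/2)e^{−|x|}`:
if `|f(x + u eₖ) − f(x)| ≤ bₖ|u|` for all `u, x, k`, `b = maxₖ bₖ > 0` and
`ã² = sup_{x, u ≠ 0} Σₖ |f(x + u eₖ) − f(x)|²/u²` with `0 < ã² < ∞`, then
`P(f(X) − E f(X) ≥ x) ≤ exp(−(4ã²/b²)(1 + bx/(4ã²) − √(1 + bx/(2ã²))))`. -/
theorem stmt5
    {Ω : Type*} [MeasureSpace Ω] [IsProbabilityMeasure (ℙ : Measure Ω)]
    {d : ℕ}
    (X : Ω → EuclideanSpace ℝ (Fin d)) (hX : Measurable X)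
    (hlaw : Measure.map (fun ω k => X ω k) ℙ =
      Measure.pi fun _ : Fin d =>
        (volume : Measure ℝ).withDensity fun t => ENNReal.ofReal ((1/2) * Real.exp (-|t|)))
    (f : EuclideanSpace ℝ (Fin d) → ℝ) (bk : Fin d → ℝ) (b : ℝ)
    (hf : ∀ (u : ℝ) (x : EuclideanSpace ℝ (Fin d)) (k : Fin d),
      |f (x + u • EuclideanSpace.single k 1) - f x| ≤ bk k * |u|)
    (hb : IsGreatest (Set.range bk) b) (hb0 : 0 < b)
    (atil2 : ℝ) (hatil0 : 0 < atil2)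
    (hatil : IsLUB {y : ℝ | ∃ (x : EuclideanSpace ℝ (Fin d)) (u : ℝ), u ≠ 0 ∧
      y = ∑ k, |f (x + u • EuclideanSpace.single k 1) - f x| ^ 2 / u ^ 2} atil2)
    (x : ℝ) (hx : 0 < x) :
    ℙ {ω | f (X ω) - (∫ ω', f (X ω')) ≥ x} ≤
      ENNReal.ofReal (Real.exp (-(4 * atil2 / b ^ 2) *
        (1 + b * x / (4 * atil2) - Real.sqrt (1 + b * x / (2 * atil2))))) := by
  set g : (Fin d → ℝ) → ℝ := fun y => f (WithLp.toLp 2 y) with hg_def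
  have hupd : ∀ (y : Fin d → ℝ) k t, WithLp.toLp 2 (Function.update y k t) =
      WithLp.toLp 2 y + (t - y k) • EuclideanSpace.single k (1 : ℝ) := by
    intro y k t
    ext i
    by_cases hi : i = k
    · subst hi; simp
    · simp [hi]
  have hg : L1LipschitzWith ⟨b, hb0.le⟩ g := .of_update fun y k t => by
    simp only [hg_def, hupd]
    exact (hf _ _ k).trans (mul_le_mul_of_nonneg_right (hb.2 ⟨k, rfl⟩) (abs_nonneg _))
  have hD : ∀ y, ∑ k, partialDeriv g k y ^ 2 ≤ atil2 := fun y =>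
    sum_partialDeriv_sq_le y fun u hu => hatil.1
      ⟨WithLp.toLp 2 y, u, hu, by simp [hg_def, hupd]⟩
  have hm : Measurable fun ω k => X ω k :=
    (EuclideanSpace.volume_preserving_symm_measurableEquiv_toLp _).measurable.comp hX
  have hE : ∫ ω, f (X ω) = ∫ y, g y ∂(Measure.pi fun _ : Fin d => laplaceMeasure) := by
    rw [laplaceMeasure, ← hlaw,
      integral_map hm.aemeasurable hg.continuous.measurable.aestronglyMeasurable]
  have h := hg.measureReal_ge_le hb0 hatil0 hD hx
  rw [← hE] at h
  rw [← laplaceMeasure] at hlaw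
  rw [← hlaw, map_measureReal_apply hm
    (measurableSet_le measurable_const hg.continuous.measurable)] at h
  rw [← ofReal_measureReal]
  refine ENNReal.ofReal_le_ofReal (le_trans (le_of_eq ?_) h)
  congr 1
  ext ω
  simp [hg_def, le_sub_iff_add_le']
end

section
/- Let λ > 0 and let X = (X₁,…,X_d) be a random vector whose components are i.i.d., each Poisson distributed with parameter λ. Then for all x > 0, P( min_{1≤k≤d} X_k − E[ min_{1≤k≤d} X_k ] ≥ x ) ≤ exp( −λ·( (1 + x/λ)·log(1 + x/λ) − x/λ ) ). In particular this bound does not depend on the dimension d. -/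
open MeasureTheory ProbabilityTheory Real
open scoped ENNReal NNReal

lemma hasSum_sub_mul_indicator_Ici (f u : ℕ → ℝ) (j : ℕ) :
    HasSum (fun n => (f (n + 1) - f n) * (Set.Ici (n + 1)).indicator u j)
      (u j * (f j - f 0)) := by
  have h : ∑ n ∈ Finset.range j, (f (n + 1) - f n) * (Set.Ici (n + 1)).indicator u j
      = u j * (f j - f 0) := by
    rw [← Finset.sum_range_sub, Finset.mul_sum]
    refine Finset.sum_congr rfl fun n hn => ?_
    rw [Set.indicator_of_mem (Set.mem_Ici.2 (Finset.mem_range.1 hn)), mul_comm]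
  rw [← h]
  refine hasSum_sum_of_ne_finset_zero fun n hn => ?_
  have hj : j ∉ Set.Ici (n + 1) := fun h => hn (Finset.mem_range.2 h)
  rw [Set.indicator_of_notMem hj, mul_zero]

lemma hasSum_sub_mul_setIntegral_Ici (ν : Measure ℕ) {w f : ℕ → ℝ}
    (hf : Monotone f) (hw : Integrable w ν) (hwf : Integrable (fun j => w j * f j) ν) :
    HasSum (fun n => (f (n + 1) - f n) * ∫ j in Set.Ici (n + 1), w j ∂ν)
      (∫ j, w j * (f j - f 0) ∂ν) := by
  have hint : Integrable (fun j => w j * (f j - f 0)) ν := by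
    simp only [mul_sub]
    exact hwf.sub (hw.mul_const (f 0))
  set F : ℕ → ℕ → ℝ := fun n j => (f (n + 1) - f n) * (Set.Ici (n + 1)).indicator w j with hF
  have hFi : ∀ n, Integrable (F n) ν := fun n =>
    (hw.indicator (MeasurableSet.of_discrete)).const_mul _
  have hS : Summable fun n => ∫ j, ‖F n j‖ ∂ν := by
    refine summable_of_sum_range_le (c := ∫ j, ‖w j * (f j - f 0)‖ ∂ν)
      (fun n => integral_nonneg fun j => norm_nonneg _) fun N => ?_
    rw [← integral_finsetSum _ fun n _ => (hFi n).norm]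
    refine integral_mono (integrable_finsetSum _ fun n _ => (hFi n).norm) hint.norm fun j => ?_
    suffices HasSum (fun n => ‖F n j‖) ‖w j * (f j - f 0)‖ from
      sum_le_hasSum _ (fun n _ => norm_nonneg _) this
    have hn := hasSum_sub_mul_indicator_Ici f (fun j => ‖w j‖) j
    have h0 : 0 ≤ f j - f 0 := sub_nonneg.2 (hf (Nat.zero_le j))
    rw [norm_mul, Real.norm_of_nonneg h0]
    convert! hn using 2 with n
    rw [hF, norm_mul, Real.norm_of_nonneg (sub_nonneg.2 (hf n.le_succ)),
      norm_indicator_eq_indicator_norm]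
  have h := hasSum_integral_of_summable_integral_norm hFi hS
  simp only [hF, (hasSum_sub_mul_indicator_Ici f w _).tsum_eq, integral_const_mul,
    integral_indicator MeasurableSet.of_discrete] at h
  exact h

lemma integral_natCast_mul_poissonMeasure (r : ℝ≥0) (g : ℕ → ℝ)
    (hg : Integrable (fun j : ℕ => (j : ℝ) * g j) (poissonMeasure r)) :
    ∫ j : ℕ, (j : ℝ) * g j ∂poissonMeasure r = r * ∫ j, g (j + 1) ∂poissonMeasure r := by
  have h := hasSum_integral_poissonMeasure hg
  rw [← h.tsum_eq, integral_poissonMeasure, h.summable.tsum_eq_zero_add, ← tsum_mul_left]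
  simp only [smul_eq_mul, Nat.cast_zero, zero_mul, mul_zero, zero_add]
  congr with j
  rw [Nat.factorial_succ, pow_succ]
  push_cast
  have : ((j : ℝ) + 1) ≠ 0 := by positivity
  field_simp

lemma integrable_exp_mul_poissonMeasure (r : ℝ≥0) (t : ℝ) :
    Integrable (fun j : ℕ => rexp (t * j)) (poissonMeasure r) := by
  rw [integrable_poissonMeasure_iff]
  convert! (Real.summable_pow_div_factorial (r * rexp t)).mul_left (rexp (-r)) using 2 with j
  rw [Real.norm_of_nonneg (exp_pos _).le, mul_pow, ← Real.exp_nat_mul]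
  ring_nf

lemma pow_sub_pow_le_mul {Q a b : ℝ} (hb : 0 ≤ b) (hba : b ≤ a) (haQ : a ≤ Q) (d : ℕ) :
    a ^ d - b ^ d ≤ d * Q ^ (d - 1) * (a - b) := by
  have ha := hb.trans hba
  rw [← geom_sum₂_mul]
  refine mul_le_mul_of_nonneg_right ?_ (sub_nonneg.2 hba)
  calc _ ≤ ∑ i ∈ Finset.range d, Q ^ (d - 1) := Finset.sum_le_sum fun i hi => by
        have : i + (d - 1 - i) = d - 1 := by have := Finset.mem_range.1 hi; omega
        calc a ^ i * b ^ (d - 1 - i) ≤ Q ^ i * Q ^ (d - 1 - i) := by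
              have := ha.trans haQ
              gcongr; exact hba.trans haQ
          _ = _ := by rw [← pow_add, this]
    _ = _ := by simp

lemma mul_le_pow_sub_pow {Q a : ℝ} (hQ : 0 ≤ Q) (hQa : Q ≤ a) (d : ℕ) :
    d * Q ^ (d - 1) * (a - Q) ≤ a ^ d - Q ^ d := by
  rw [← geom_sum₂_mul]
  refine mul_le_mul_of_nonneg_right ?_ (sub_nonneg.2 hQa)
  calc _ = ∑ i ∈ Finset.range d, Q ^ (d - 1) := by simp
    _ ≤ _ := Finset.sum_le_sum fun i hi => by
        have : i + (d - 1 - i) = d - 1 := by have := Finset.mem_range.1 hi; omega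
        calc Q ^ (d - 1) = Q ^ i * Q ^ (d - 1 - i) := by rw [← pow_add, this]
          _ ≤ a ^ i * Q ^ (d - 1 - i) := by gcongr

lemma hasSum_measureReal_Ici_max (ν : Measure ℕ) [IsFiniteMeasure ν]
    (h : Integrable (fun j : ℕ => (j : ℝ)) ν) (n : ℕ) :
    HasSum (fun i => ν.real (Set.Ici (max (i + 1) n))) (∫ j in Set.Ici n, (j : ℝ) ∂ν) := by
  have := hasSum_sub_mul_setIntegral_Ici (ν.restrict (Set.Ici n)) (w := fun _ => 1)
    (f := fun j : ℕ => (j : ℝ)) Nat.mono_cast (integrable_const _) (by simpa using h.restrict)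
  simpa [Measure.restrict_restrict, Set.Ici_inter_Ici, measureReal_restrict_apply] using this

lemma measureReal_Ici_eq_add (ν : Measure ℕ) [IsFiniteMeasure ν] (n : ℕ) :
    ν.real (Set.Ici n) = ν.real (Set.Ici (n + 1)) + ν.real {n} := by
  rw [← measureReal_union (by simp) MeasurableSet.of_discrete]
  congr 1
  ext j
  simp
  omega

lemma setIntegral_Ici_poissonMeasure (r : ℝ≥0)
    (h : Integrable (fun j : ℕ => (j : ℝ)) (poissonMeasure r)) (n : ℕ) :
    ∫ j in Set.Ici (n + 1), (j : ℝ) ∂poissonMeasure r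
      = r * (poissonMeasure r).real (Set.Ici n) := by
  have hi : (fun j : ℕ => (j : ℝ) * (Set.Ici (n + 1)).indicator (fun _ => (1 : ℝ)) j)
      = (Set.Ici (n + 1)).indicator (fun j : ℕ => (j : ℝ)) := by
    ext j
    by_cases hj : j ∈ Set.Ici (n + 1) <;> simp [hj]
  have := integral_natCast_mul_poissonMeasure r ((Set.Ici (n + 1)).indicator fun _ => (1 : ℝ))
    (by rw [hi]; exact h.indicator MeasurableSet.of_discrete)
  rw [hi, integral_indicator MeasurableSet.of_discrete] at this
  rw [this]
  have h2 : (fun j : ℕ => (Set.Ici (n + 1)).indicator (fun _ => (1 : ℝ)) (j + 1))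
      = (Set.Ici n).indicator 1 := by
    ext j
    simp [Set.indicator]
  rw [h2, integral_indicator_one MeasurableSet.of_discrete]

lemma integral_natCast_poissonMeasure (r : ℝ≥0)
    (h : Integrable (fun j : ℕ => (j : ℝ)) (poissonMeasure r)) :
    ∫ j : ℕ, (j : ℝ) ∂poissonMeasure r = r := by
  simpa using integral_natCast_mul_poissonMeasure r (fun _ => 1) (by simpa using h)

lemma setIntegral_sub_mean_le (r : ℝ≥0) (d : ℕ) (ν : Measure ℕ) [IsProbabilityMeasure ν]
    (hν : ∀ n, ν.real (Set.Ici n) = (poissonMeasure r).real (Set.Ici n) ^ d)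
    (hi : Integrable (fun j : ℕ => (j : ℝ)) ν)
    (hp : Integrable (fun j : ℕ => (j : ℝ)) (poissonMeasure r)) (n : ℕ) :
    ∫ j in Set.Ici (n + 1), ((j : ℝ) - ∫ i : ℕ, (i : ℝ) ∂ν) ∂ν ≤ r * ν.real {n} := by
  set S : ℕ → ℝ := fun n => (poissonMeasure r).real (Set.Ici n) with hS
  have hS0 : ∀ n, 0 ≤ S n := fun n => measureReal_nonneg
  have hS1 : ∀ n, S n ≤ 1 := fun n => measureReal_le_one
  have hanti : Antitone S := fun i j hij => measureReal_mono (Set.Ici_subset_Ici.2 hij)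
  set Q := S (n + 1) with hQ
  have key : ∫ j in Set.Ici (n + 1), (j : ℝ) ∂ν - Q ^ d * ∫ j : ℕ, (j : ℝ) ∂ν
      ≤ d * Q ^ (d - 1) *
        (∫ j in Set.Ici (n + 1), (j : ℝ) ∂poissonMeasure r
          - Q * ∫ j : ℕ, (j : ℝ) ∂poissonMeasure r) := by
    have mean (μ : Measure ℕ) [IsFiniteMeasure μ] (h : Integrable (fun j : ℕ => (j : ℝ)) μ) :
        HasSum (fun i => μ.real (Set.Ici (i + 1))) (∫ j : ℕ, (j : ℝ) ∂μ) := by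
      have h0 : Set.Ici 0 = (Set.univ : Set ℕ) := by ext; simp
      simpa [h0] using hasSum_measureReal_Ici_max μ h 0
    refine hasSum_le (fun i => ?_)
      ((hasSum_measureReal_Ici_max ν hi (n + 1)).sub ((mean ν hi).mul_left (Q ^ d)))
      (((hasSum_measureReal_Ici_max _ hp (n + 1)).sub ((mean _ hp).mul_left Q)).mul_left
        (d * Q ^ (d - 1)))
    rw [hν, hν, ← mul_pow]
    refine pow_sub_pow_le_mul (mul_nonneg (hS0 _) (hS0 _)) ?_ (hanti (le_max_right _ _)) d
    rcases max_choice (i + 1) (n + 1) with h | h <;> rw [h]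
    · exact mul_le_of_le_one_left (hS0 _) (hS1 _)
    · exact mul_le_of_le_one_right (hS0 _) (hS1 _)
  rw [setIntegral_Ici_poissonMeasure r hp, integral_natCast_poissonMeasure r hp] at key
  have hconv := mul_le_pow_sub_pow (hS0 (n + 1)) (hanti n.le_succ) d
  have hatom := measureReal_Ici_eq_add ν n
  rw [hν, hν] at hatom
  rw [integral_sub hi.integrableOn (integrable_const _).integrableOn, setIntegral_const, hν,
    smul_eq_mul]
  calc _ ≤ _ := key
    _ = r * (d * Q ^ (d - 1) * (S n - Q)) := by ring
    _ ≤ r * (S n ^ d - Q ^ d) := by gcongr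
    _ = _ := by rw [hatom]; ring

lemma integral_sub_mean_mul_exp_le {r : ℝ} (ν : Measure ℕ) [IsProbabilityMeasure ν]
    (hexp : ∀ t : ℝ, Integrable (fun j : ℕ => rexp (t * j)) ν)
    (hτ : ∀ n, ∫ j in Set.Ici (n + 1), ((j : ℝ) - ∫ i : ℕ, (i : ℝ) ∂ν) ∂ν ≤ r * ν.real {n})
    (hi : Integrable (fun j : ℕ => (j : ℝ)) ν) {s : ℝ} (hs : 0 ≤ s)
    (hie : Integrable (fun j : ℕ => (j : ℝ) * rexp (s * j)) ν) :
    ∫ j : ℕ, (j : ℝ) * rexp (s * j) ∂ν - (∫ j : ℕ, (j : ℝ) ∂ν) * ∫ j : ℕ, rexp (s * j) ∂ν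
      ≤ r * (rexp s - 1) * ∫ j : ℕ, rexp (s * j) ∂ν := by
  set m := ∫ j : ℕ, (j : ℝ) ∂ν with hm
  have hmono : Monotone fun j : ℕ => rexp (s * j) := fun i j hij => by dsimp only; gcongr
  have hw : Integrable (fun j : ℕ => (j : ℝ) - m) ν := hi.sub (integrable_const _)
  have hwf : Integrable (fun j : ℕ => ((j : ℝ) - m) * rexp (s * j)) ν := by
    simp only [sub_mul]
    exact hie.sub ((hexp s).const_mul m)
  have h1 := hasSum_sub_mul_setIntegral_Ici ν hmono hw hwf
  have h2 : HasSum (fun n : ℕ => r * (rexp s - 1) * (rexp (s * n) * ν.real {n}))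
      (r * (rexp s - 1) * ∫ j : ℕ, rexp (s * j) ∂ν) := by
    refine HasSum.mul_left _ ?_
    have := hasSum_integral_iUnion (μ := ν) (f := fun j : ℕ => rexp (s * j))
      (s := fun n : ℕ => {n}) (fun _ => MeasurableSet.of_discrete)
      (fun i j hij => by simpa using hij) (hexp s).integrableOn
    rw [Set.iUnion_of_singleton, setIntegral_univ] at this
    simpa [mul_comm, measureReal_def] using this
  have hval : ∫ j : ℕ, ((j : ℝ) - m) * (rexp (s * j) - rexp (s * (0 : ℕ))) ∂ν
      = ∫ j : ℕ, (j : ℝ) * rexp (s * j) ∂ν - m * ∫ j : ℕ, rexp (s * j) ∂ν := by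
    have h0 : ∫ j : ℕ, ((j : ℝ) - m) ∂ν = 0 := by
      rw [integral_sub hi (integrable_const _)]
      simp [hm]
    simp only [Nat.cast_zero, mul_zero, exp_zero, mul_sub, mul_one]
    rw [integral_sub hwf hw, h0, sub_zero]
    simp only [sub_mul]
    rw [integral_sub hie ((hexp s).const_mul m), integral_const_mul]
  rw [← hval]
  refine hasSum_le (fun n => ?_) h1 h2
  have h3 : rexp (s * (n + 1 : ℕ)) - rexp (s * n) = (rexp s - 1) * rexp (s * n) := by
    push_cast
    rw [mul_add, exp_add]
    ring_nf
  have h4 : 0 ≤ rexp s - 1 := sub_nonneg.2 (one_le_exp hs)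
  rw [h3]
  calc _ ≤ (rexp s - 1) * rexp (s * n) * (r * ν.real {n}) := by gcongr; exact hτ n
    _ = _ := by ring

lemma mgf_le_of_integral_mul_exp_le {r m : ℝ} (ν : Measure ℕ) [IsProbabilityMeasure ν]
    (hexp : ∀ t : ℝ, Integrable (fun j : ℕ => rexp (t * j)) ν)
    (h : ∀ s : ℝ, 0 ≤ s → ∫ j : ℕ, (j : ℝ) * rexp (s * j) ∂ν - m * ∫ j : ℕ, rexp (s * j) ∂ν
      ≤ r * (rexp s - 1) * ∫ j : ℕ, rexp (s * j) ∂ν) {s : ℝ} (hs : 0 ≤ s) :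
    mgf (fun j : ℕ => (j : ℝ)) ν s ≤ rexp (m * s + r * (rexp s - 1 - s)) := by
  set φ := mgf (fun j : ℕ => (j : ℝ)) ν with hφ
  set K : ℝ → ℝ := fun s => m * s + r * (rexp s - 1 - s) with hK
  have huniv : integrableExpSet (fun j : ℕ => (j : ℝ)) ν = Set.univ :=
    Set.eq_univ_of_forall hexp
  have hdφ (t : ℝ) : HasDerivAt φ (∫ j : ℕ, (j : ℝ) * rexp (t * j) ∂ν) t :=
    hasDerivAt_mgf (by simp [huniv])
  have hdK (t : ℝ) : HasDerivAt K (m + r * (rexp t - 1)) t := by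
    have h1 := ((hasDerivAt_id t).const_mul m).add
      ((((hasDerivAt_exp t).sub_const 1).sub (hasDerivAt_id t)).const_mul r)
    simpa using! h1
  have hd (t : ℝ) : HasDerivAt (φ * fun t => rexp (-K t)) _ t := (hdφ t).mul (hdK t).neg.exp
  have hanti : AntitoneOn (φ * fun t => rexp (-K t)) (Set.Ici 0) := by
    refine antitoneOn_of_deriv_nonpos (convex_Ici 0)
      (fun t _ => (hd t).continuousAt.continuousWithinAt)
      (fun t _ => (hd t).differentiableAt.differentiableWithinAt) fun t ht => ?_
    rw [interior_Ici] at ht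
    rw [(hd t).deriv]
    have := mul_nonneg (sub_nonneg.2 (h t (le_of_lt ht))) (exp_pos (-K t)).le
    have hφt : φ t = ∫ j : ℕ, rexp (t * j) ∂ν := rfl
    rw [← hφt] at this
    simp only [Pi.neg_apply]
    linarith
  have := hanti (Set.mem_Ici.2 le_rfl) (Set.mem_Ici.2 hs) hs
  have hK0 : K 0 = 0 := by simp [hK]
  have hφ0 : φ 0 = 1 := by simp [hφ]
  simp only [Pi.mul_apply, hK0, hφ0, neg_zero, exp_zero, mul_one] at this
  rwa [exp_neg, ← div_eq_mul_inv, div_le_one (exp_pos _)] at this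

lemma measureReal_add_le_of_mgf_le {r m : ℝ} (hr : 0 < r) (ν : Measure ℕ)
    [IsProbabilityMeasure ν]
    (hexp : ∀ t : ℝ, Integrable (fun j : ℕ => rexp (t * j)) ν)
    (h : ∀ s : ℝ, 0 ≤ s →
      mgf (fun j : ℕ => (j : ℝ)) ν s ≤ rexp (m * s + r * (rexp s - 1 - s))) {x : ℝ} (hx : 0 ≤ x) :
    ν.real {j : ℕ | m + x ≤ j} ≤ rexp (-r * ((1 + x / r) * log (1 + x / r) - x / r)) := by
  have hpos : 0 < 1 + x / r := by positivity
  have hs : 0 ≤ log (1 + x / r) := log_nonneg (by linarith [div_nonneg hx hr.le])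
  refine (measure_ge_le_exp_mul_mgf (m + x) hs (hexp _)).trans ?_
  refine (mul_le_mul_of_nonneg_left (h _ hs) (exp_pos _).le).trans_eq ?_
  rw [← exp_add, exp_log hpos]
  congr 1
  field_simp
  ring

/-- The law of the minimum of `d` independent Poisson variables, as a measure on `ℕ`. -/
noncomputable def poissonMinMeasure (r : ℝ≥0) (d : ℕ) : Measure ℕ :=
  (Measure.pi fun _ : Fin d => poissonMeasure r).map fun y => ⨅ k, y k

instance (r : ℝ≥0) (d : ℕ) : IsProbabilityMeasure (poissonMinMeasure r d) :=
  Measure.isProbabilityMeasure_map .of_discrete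

lemma poissonMinMeasure_real_Ici (r : ℝ≥0) (d : ℕ) [NeZero d] (n : ℕ) :
    (poissonMinMeasure r d).real (Set.Ici n) = (poissonMeasure r).real (Set.Ici n) ^ d := by
  have h : (fun y : Fin d → ℕ => ⨅ k, y k) ⁻¹' Set.Ici n
      = Set.univ.pi fun _ : Fin d => Set.Ici n := by
    ext y
    simp only [Set.mem_preimage, Set.mem_Ici, Set.mem_univ_pi]
    exact le_ciInf_iff (OrderBot.bddBelow _)
  rw [poissonMinMeasure, map_measureReal_apply .of_discrete .of_discrete, h, measureReal_def,
    Measure.pi_pi]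
  simp [measureReal_def]

lemma integrable_exp_mul_poissonMinMeasure (r : ℝ≥0) (d : ℕ) [NeZero d] (t : ℝ) :
    Integrable (fun j : ℕ => rexp (t * j)) (poissonMinMeasure r d) := by
  rw [poissonMinMeasure, integrable_map_measure .of_discrete .of_discrete]
  have h0 : Integrable (fun y : Fin d → ℕ => rexp (|t| * y 0))
      (Measure.pi fun _ : Fin d => poissonMeasure r) :=
    (measurePreserving_eval (fun _ : Fin d => poissonMeasure r) 0).integrable_comp_of_integrable
      (integrable_exp_mul_poissonMeasure r |t|)
  refine h0.mono' .of_discrete (.of_forall fun y => ?_)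
  have h1 : ((⨅ k, y k : ℕ) : ℝ) ≤ y 0 := by exact_mod_cast ciInf_le (OrderBot.bddBelow _) 0
  simp only [Function.comp_apply, norm_eq_abs, abs_exp]
  gcongr
  exact le_abs_self t

lemma map_iInf_pi_map_poissonMeasure (r : ℝ≥0) (d : ℕ) [NeZero d] :
    (Measure.pi fun _ : Fin d => (poissonMeasure r).map (fun n : ℕ => (n : ℝ))).map
      (fun y => ⨅ k, y k) = (poissonMinMeasure r d).map (fun n : ℕ => (n : ℝ)) := by
  rw [poissonMinMeasure, ← Measure.pi_map_pi fun _ => .of_discrete,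
    Measure.map_map (.iInf fun k => measurable_pi_apply k) .of_discrete,
    Measure.map_map .of_discrete .of_discrete]
  congr 1
  ext y
  exact (Nat.mono_cast.map_ciInf_of_continuousAt (f := (Nat.cast : ℕ → ℝ))
    continuous_of_discreteTopology.continuousAt (OrderBot.bddBelow (Set.range y))).symm

/-- Dimension-free inequality for the minimum of i.i.d. Poisson(λ) random variables
(Remark (ii) after Corollary 2 of the paper): for all `x > 0`,
`P(minₖ Xₖ − E[minₖ Xₖ] ≥ x) ≤ exp(−λ ℓ(x/λ))` where `ℓ(u) = (1+u)log(1+u) − u`. -/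
theorem stmt6
    {Ω : Type*} [MeasureSpace Ω] [IsProbabilityMeasure (ℙ : Measure Ω)]
    {d : ℕ} [NeZero d] (lam : ℝ≥0) (hlam : 0 < lam)
    (X : Ω → EuclideanSpace ℝ (Fin d)) (hX : Measurable X)
    (hlaw : Measure.map (fun ω k => X ω k) ℙ =
      Measure.pi fun _ : Fin d => (poissonMeasure lam).map (fun n : ℕ => (n : ℝ)))
    (x : ℝ) (hx : 0 < x) :
    ℙ {ω | (⨅ k, X ω k) - (∫ ω', ⨅ k, X ω' k) ≥ x} ≤
      ENNReal.ofReal (Real.exp (-(lam : ℝ) *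
        ((1 + x / lam) * Real.log (1 + x / lam) - x / lam))) := by
  set ν := poissonMinMeasure lam d with hν
  have hXk : Measurable fun ω k => X ω k := by fun_prop
  have hmin : Measurable fun y : Fin d → ℝ => ⨅ k, y k := .iInf fun k => measurable_pi_apply k
  have hM : Measurable fun ω => ⨅ k, X ω k := hmin.comp hXk
  have hmap : Measure.map (fun ω => ⨅ k, X ω k) ℙ = ν.map (fun n : ℕ => (n : ℝ)) := by
    rw [hν, ← map_iInf_pi_map_poissonMeasure, ← hlaw, Measure.map_map hmin hXk]
    rfl
  have hmean : ∫ ω, ⨅ k, X ω k = ∫ j : ℕ, (j : ℝ) ∂ν := by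
    rw [← integral_map (f := fun y : ℝ => y) hM.aemeasurable (by fun_prop), hmap,
      integral_map .of_discrete (by fun_prop)]
  have hexp := integrable_exp_mul_poissonMinMeasure lam d
  have hint (μ : Measure ℕ) (h : ∀ t : ℝ, Integrable (fun j : ℕ => rexp (t * j)) μ) (t : ℝ) :
      Integrable (fun j : ℕ => (j : ℝ) * rexp (t * j)) μ := by
    have huniv : integrableExpSet (fun j : ℕ => (j : ℝ)) μ = Set.univ :=
      Set.eq_univ_of_forall h
    simpa using integrable_pow_mul_exp_of_mem_interior_integrableExpSet
      (X := fun j : ℕ => (j : ℝ)) (μ := μ) (v := t) (by simp [huniv]) 1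
  have hi : Integrable (fun j : ℕ => (j : ℝ)) ν := by simpa using hint ν hexp 0
  have hp : Integrable (fun j : ℕ => (j : ℝ)) (poissonMeasure lam) := by
    simpa using hint _ (integrable_exp_mul_poissonMeasure lam) 0
  have hτ := setIntegral_sub_mean_le lam d ν (poissonMinMeasure_real_Ici lam d) hi hp
  have htail := measureReal_add_le_of_mgf_le (NNReal.coe_pos.2 hlam) ν hexp
    (fun s hs => mgf_le_of_integral_mul_exp_le ν hexp
      (fun t ht => integral_sub_mean_mul_exp_le ν hexp hτ hi ht (hint ν hexp t)) hs) hx.le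
  rw [hmean]
  set m := ∫ j : ℕ, (j : ℝ) ∂ν
  have hset : {ω | (⨅ k, X ω k) - m ≥ x} = (fun ω => ⨅ k, X ω k) ⁻¹' Set.Ici (m + x) := by
    ext ω
    simp [le_sub_iff_add_le']
  rw [hset, ← Measure.map_apply hM measurableSet_Ici, hmap,
    Measure.map_apply .of_discrete measurableSet_Ici]
  exact (ENNReal.le_ofReal_iff_toReal_le (measure_ne_top _ _) (exp_pos _).le).2 htail
end

section
/- Let X = (X₁,…,X_d) be a random vector whose components are i.i.d., each with the two-sided (symmetric) exponential distribution on ℝ with density x ↦ (1/2)e^{−|x|} with respect to Lebesgue measure, and let ‖·‖ denote the Euclidean norm on ℝ^d. Then for every ε > 0 and every x > 0, P( ‖X‖ ≥ (1+ε)·E‖X‖ + x ) ≤ exp( − x² / ( 6(16 + 8/ε²) + 4x ) ). -/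
open MeasureTheory ProbabilityTheory Real
open scoped ENNReal

/-- The symmetric exponential distribution on `ℝ`. -/
noncomputable def symmExp : Measure ℝ :=
  (volume : Measure ℝ).withDensity fun t => ENNReal.ofReal ((1/2) * Real.exp (-|t|))

theorem integrableOn_Ioi_mul_exp_neg {F : ℝ → ℝ} {C : ℝ} (hF : Measurable F)
    (hb : ∀ t, |F t| ≤ C * exp (|t| / 2)) :
    IntegrableOn (fun t => F t * exp (-t)) (Set.Ioi 0) := by
  have h := (exp_neg_integrableOn_Ioi 0 (show (0 : ℝ) < 1 / 2 by norm_num)).const_mul C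
  refine Integrable.mono' h (by fun_prop) ?_
  filter_upwards [ae_restrict_mem measurableSet_Ioi] with t ht
  have ht : 0 < t := ht
  have := hb t
  rw [abs_of_pos ht] at this
  rw [norm_mul, norm_eq_abs, norm_eq_abs, abs_of_pos (exp_pos _)]
  calc |F t| * exp (-t) ≤ C * exp (t / 2) * exp (-t) := by gcongr
    _ = C * exp (-(1 / 2) * t) := by rw [mul_assoc, ← exp_add]; ring_nf

theorem integrableOn_Iic_mul_exp {F : ℝ → ℝ} {C : ℝ} (hF : Measurable F)
    (hb : ∀ t, |F t| ≤ C * exp (|t| / 2)) :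
    IntegrableOn (fun t => F t * exp t) (Set.Iic 0) := by
  have h := integrableOn_Ioi_mul_exp_neg (hF.comp measurable_neg) (C := C)
    (fun t => by simpa using hb (-t))
  have h' : IntegrableOn (fun t => F (-t) * exp (-t)) (Set.Ici (-0)) := by
    rw [neg_zero]
    rwa [integrableOn_Ici_iff_integrableOn_Ioi]
  simpa using h'.comp_neg_Iic

theorem measurable_symmExp_density :
    Measurable fun t : ℝ => ENNReal.ofReal ((1/2) * Real.exp (-|t|)) := by fun_prop

theorem symmExp_density_lt_top :
    ∀ᵐ t : ℝ, ENNReal.ofReal ((1/2) * Real.exp (-|t|)) < ∞ :=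
  ae_of_all _ fun _ => ENNReal.ofReal_lt_top

theorem integrable_symmExp {F : ℝ → ℝ} {C : ℝ} (hF : Measurable F)
    (hb : ∀ t, |F t| ≤ C * exp (|t| / 2)) : Integrable F symmExp := by
  rw [symmExp, integrable_withDensity_iff measurable_symmExp_density symmExp_density_lt_top,
    ← integrableOn_univ, ← Set.Iic_union_Ioi (a := (0 : ℝ)), integrableOn_union]
  constructor
  · refine Integrable.congr ((integrableOn_Iic_mul_exp hF hb).const_mul (1 / 2)) ?_
    filter_upwards [ae_restrict_mem measurableSet_Iic] with t ht
    rw [ENNReal.toReal_ofReal (by positivity), abs_of_nonpos ht]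
    ring_nf
  · refine Integrable.congr ((integrableOn_Ioi_mul_exp_neg hF hb).const_mul (1 / 2)) ?_
    filter_upwards [ae_restrict_mem measurableSet_Ioi] with t ht
    rw [ENNReal.toReal_ofReal (by positivity), abs_of_pos ht]
    ring_nf

theorem integral_symmExp {F : ℝ → ℝ} {C : ℝ} (hF : Measurable F)
    (hb : ∀ t, |F t| ≤ C * exp (|t| / 2)) :
    ∫ t, F t ∂symmExp = (∫ t in Set.Ioi 0, F t * exp (-t)) / 2 +
      (∫ t in Set.Ioi 0, F (-t) * exp (-t)) / 2 := by
  have hi := integrable_symmExp hF hb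
  rw [symmExp, integrable_withDensity_iff measurable_symmExp_density symmExp_density_lt_top] at hi
  rw [symmExp, integral_withDensity_eq_integral_toReal_smul measurable_symmExp_density
    symmExp_density_lt_top]
  have h1 : ∫ t in Set.Ioi 0, F (-t) * exp (-t) = ∫ t in Set.Iic 0, F t * exp t := by
    simpa using integral_comp_neg_Ioi 0 (fun t => F t * exp t)
  have hi' : Integrable (fun t => (ENNReal.ofReal ((1/2) * Real.exp (-|t|))).toReal • F t) := by
    simpa [mul_comm] using hi
  rw [h1, ← setIntegral_univ, ← Set.Iic_union_Ioi (a := (0 : ℝ)),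
    setIntegral_union (by simp) measurableSet_Ioi hi'.integrableOn hi'.integrableOn, add_comm,
    ← integral_div, ← integral_div]
  congr 1
  · refine setIntegral_congr_fun measurableSet_Ioi fun t ht => ?_
    simp only [smul_eq_mul]
    rw [ENNReal.toReal_ofReal (by positivity), abs_of_pos ht]
    ring
  · refine setIntegral_congr_fun measurableSet_Iic fun t ht => ?_
    simp only [smul_eq_mul]
    rw [ENNReal.toReal_ofReal (by positivity), abs_of_nonpos ht]
    ring_nf

instance : IsProbabilityMeasure symmExp := by
  have hb : ∀ t : ℝ, |(1 : ℝ)| ≤ 1 * exp (|t| / 2) := fun t => by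
    rw [abs_one, one_mul]; exact one_le_exp (by positivity)
  have hi := integrable_symmExp measurable_const hb
  have h := integral_symmExp measurable_const hb
  simp only [one_mul, integral_exp_neg_Ioi_zero, integral_const, smul_eq_mul, mul_one] at h
  constructor
  have hfin : symmExp Set.univ ≠ ⊤ := by
    have := (integrable_const_iff_isFiniteMeasure (one_ne_zero (α := ℝ))).1 hi
    exact measure_ne_top _ _
  rw [← ENNReal.toReal_eq_one_iff]
  rw [Measure.real] at h
  linarith

/-- A weighted Hardy inequality on the half-line. -/
theorem sq_mul_exp_neg_integral_le {h h' : ℝ → ℝ} {C : ℝ} (hd : ∀ t, HasDerivAt h (h' t) t)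
    (h0 : h 0 = 0) (hm : Measurable h') (hb : ∀ t, |h t| ≤ C * exp (|t| / 4))
    (hb' : ∀ t, |h' t| ≤ C * exp (|t| / 4)) :
    ∫ t in Set.Ioi 0, h t ^ 2 * exp (-t) ≤ 4 * ∫ t in Set.Ioi 0, h' t ^ 2 * exp (-t) := by
  have hC (u v : ℝ) (t : ℝ) (hu : |u| ≤ C * exp (|t| / 4)) (hv : |v| ≤ C * exp (|t| / 4)) :
      |u * v| ≤ C ^ 2 * exp (|t| / 2) := by
    rw [abs_mul]
    calc |u| * |v| ≤ (C * exp (|t| / 4)) * (C * exp (|t| / 4)) := by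
          gcongr; exact (abs_nonneg _).trans hu
      _ = C ^ 2 * (exp (|t| / 4) * exp (|t| / 4)) := by ring
      _ = _ := by rw [← exp_add]; ring_nf
  have hmh : Measurable h := (continuous_iff_continuousAt.2 fun t => (hd t).continuousAt).measurable
  have i1 := integrableOn_Ioi_mul_exp_neg (F := fun t => h t * h t) (by fun_prop)
    fun t => hC _ _ t (hb t) (hb t)
  have i2 := integrableOn_Ioi_mul_exp_neg (F := fun t => h t * h' t) (by fun_prop)
    fun t => hC _ _ t (hb t) (hb' t)
  have i3 := integrableOn_Ioi_mul_exp_neg (F := fun t => h' t * h' t) (by fun_prop)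
    fun t => hC _ _ t (hb' t) (hb' t)
  have key : ∫ t in Set.Ioi 0, (2 * (h t * h' t * exp (-t)) - h t * h t * exp (-t)) = 0 := by
    have := integral_Ioi_of_hasDerivAt_of_tendsto' (f := fun t => h t * h t * exp (-t)) (a := 0)
      (f' := fun t => 2 * (h t * h' t * exp (-t)) - h t * h t * exp (-t)) (m := 0) ?_
      ((i2.const_mul 2).sub i1) ?_
    · simpa [h0] using this
    · intro t _
      convert! ((hd t).mul (hd t)).mul (hasDerivAt_neg t).exp using 1
      simp only [Pi.mul_apply]
      ring
    · have hlim : Filter.Tendsto (fun t : ℝ => C ^ 2 * exp (-(t / 2))) Filter.atTop (nhds 0) := by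
        rw [← mul_zero (C ^ 2)]
        refine Filter.Tendsto.const_mul _ (tendsto_exp_neg_atTop_nhds_zero.comp ?_)
        exact Filter.tendsto_id.atTop_div_const (by norm_num)
      refine squeeze_zero_norm' ?_ hlim
      filter_upwards [Filter.eventually_ge_atTop 0] with t ht
      rw [norm_mul, norm_eq_abs, norm_eq_abs, abs_of_pos (exp_pos _)]
      have := hC _ _ t (hb t) (hb t)
      rw [abs_of_nonneg ht] at this
      calc _ ≤ C ^ 2 * exp (t / 2) * exp (-t) := by gcongr
        _ = _ := by rw [mul_assoc, ← exp_add]; ring_nf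
  have hle : ∫ t in Set.Ioi 0, (2 * (h t * h' t * exp (-t)) - h t * h t * exp (-t)) ≤
      ∫ t in Set.Ioi 0, (2 * (h' t * h' t * exp (-t)) - 1 / 2 * (h t * h t * exp (-t))) := by
    refine integral_mono ((i2.const_mul 2).sub i1) ((i3.const_mul 2).sub (i1.const_mul _)) ?_
    intro t
    have : 0 ≤ (2 * h' t - h t) ^ 2 * exp (-t) := by positivity
    simp only
    nlinarith
  rw [key, integral_sub (i3.const_mul 2) (i1.const_mul _), integral_const_mul,
    integral_const_mul] at hle
  simp only [sq]
  linarith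

theorem abs_sq_le_of_abs_le {C s u : ℝ} (hu : |u| ≤ C * exp (s / 4)) :
    |u ^ 2| ≤ C ^ 2 * exp (s / 2) := by
  rw [abs_pow]
  calc |u| ^ 2 ≤ (C * exp (s / 4)) ^ 2 := by gcongr
    _ = C ^ 2 * (exp (s / 4) * exp (s / 4)) := by ring
    _ = _ := by rw [← exp_add]; ring_nf

/-- The Poincaré inequality for the symmetric exponential distribution. -/
theorem symmExp_poincare {g g' : ℝ → ℝ} {C : ℝ} (hd : ∀ t, HasDerivAt g (g' t) t)
    (hm : Measurable g') (hb : ∀ t, |g t| ≤ C * exp (|t| / 4))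
    (hb' : ∀ t, |g' t| ≤ C * exp (|t| / 4)) :
    Var[g; symmExp] ≤ 4 * ∫ t, g' t ^ 2 ∂symmExp := by
  have hC0 : 0 ≤ C := by simpa using (abs_nonneg _).trans (hb 0)
  have hmg : Measurable g := (continuous_iff_continuousAt.2 fun t => (hd t).continuousAt).measurable
  have hbh (t : ℝ) : |g t - g 0| ≤ (2 * C) * exp (|t| / 4) := by
    have h0 := hb 0
    have h1 : (1 : ℝ) ≤ exp (|t| / 4) := one_le_exp (by positivity)
    simp only [abs_zero, zero_div, exp_zero, mul_one] at h0
    calc |g t - g 0| ≤ |g t| + |g 0| := abs_sub _ _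
      _ ≤ C * exp (|t| / 4) + C * exp (|t| / 4) := by
        gcongr
        · exact hb t
        · exact h0.trans (le_mul_of_one_le_right hC0 h1)
      _ = _ := by ring
  have hbh' (t : ℝ) : |g' t| ≤ (2 * C) * exp (|t| / 4) := by
    refine (hb' t).trans ?_
    gcongr
    linarith
  have hpos := sq_mul_exp_neg_integral_le (h := fun t => g t - g 0) (h' := g') (C := 2 * C)
    (fun t => (hd t).sub_const _) (by simp) hm hbh hbh'
  have hneg := sq_mul_exp_neg_integral_le (h := fun t => g (-t) - g 0) (h' := fun t => -g' (-t))
    (C := 2 * C) (fun t => by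
      simpa using ((hd (-t)).comp t (hasDerivAt_neg t)).sub_const (g 0)) (by simp)
    (by fun_prop) (fun t => by simpa using hbh (-t)) (fun t => by simpa using hbh' (-t))
  have hvar : Var[g; symmExp] ≤ ∫ t, (g t - g 0) ^ 2 ∂symmExp := by
    rw [← variance_sub_const hmg.aestronglyMeasurable (g 0)]
    exact variance_le_expectation_sq (by fun_prop)
  refine hvar.trans ?_
  rw [integral_symmExp (by fun_prop) fun t => abs_sq_le_of_abs_le (hbh t),
    integral_symmExp (by fun_prop) fun t => abs_sq_le_of_abs_le (hbh' t)]
  simp only [neg_sq] at hneg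
  linarith

theorem sq_integral_le_integral_sq {α : Type*} [MeasurableSpace α] {μ : Measure α}
    [IsProbabilityMeasure μ] {f : α → ℝ} (hf : MemLp f 2 μ) :
    (∫ x, f x ∂μ) ^ 2 ≤ ∫ x, f x ^ 2 ∂μ := by
  have h := variance_nonneg f μ
  rw [variance_eq_sub hf] at h
  simpa using h

/-- The Efron–Stein inequality for two independent variables. -/
theorem variance_prod_le {α β : Type*} [MeasurableSpace α] [MeasurableSpace β] {μ : Measure α}
    {ν : Measure β} [IsProbabilityMeasure μ] [IsProbabilityMeasure ν] {f : α × β → ℝ}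
    (hm : Measurable f) (hf : MemLp f 2 (μ.prod ν)) :
    Var[f; μ.prod ν] ≤ ∫ y, Var[fun x => f (x, y); μ] ∂ν + ∫ x, Var[fun y => f (x, y); ν] ∂μ := by
  have hf1 : Integrable f (μ.prod ν) := hf.integrable (by norm_num)
  have hf2 : Integrable (fun p => f p ^ 2) (μ.prod ν) := hf.integrable_sq
  have hsl : ∀ᵐ y ∂ν, MemLp (fun x => f (x, y)) 2 μ := by
    filter_upwards [hf2.prod_left_ae] with y hy
    exact (memLp_two_iff_integrable_sq
      (hm.comp measurable_prodMk_right).aestronglyMeasurable).2 hy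
  have hsr : ∀ᵐ x ∂μ, MemLp (fun y => f (x, y)) 2 ν := by
    filter_upwards [hf2.prod_right_ae] with x hx
    exact (memLp_two_iff_integrable_sq
      (hm.comp measurable_prodMk_left).aestronglyMeasurable).2 hx
  set m : β → ℝ := fun y => ∫ x, f (x, y) ∂μ with hm_def
  set M : α → ℝ := fun x => ∫ y, f (x, y) ∂ν with hM_def
  have hmm : StronglyMeasurable m :=
    StronglyMeasurable.integral_prod_left (f := fun x y => f (x, y)) hm.stronglyMeasurable
  have hMm : StronglyMeasurable M :=
    StronglyMeasurable.integral_prod_right (f := fun x y => f (x, y)) hm.stronglyMeasurable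
  have hmL : MemLp m 2 ν := by
    refine (memLp_two_iff_integrable_sq hmm.aestronglyMeasurable).2 ?_
    refine hf2.integral_prod_right.mono' (by fun_prop) ?_
    filter_upwards [hsl] with y hy
    rw [norm_eq_abs, abs_of_nonneg (sq_nonneg _)]
    exact sq_integral_le_integral_sq hy
  have hML : MemLp M 2 μ := by
    refine (memLp_two_iff_integrable_sq hMm.aestronglyMeasurable).2 ?_
    refine hf2.integral_prod_left.mono' (by fun_prop) ?_
    filter_upwards [hsr] with x hx
    rw [norm_eq_abs, abs_of_nonneg (sq_nonneg _)]
    exact sq_integral_le_integral_sq hx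
  have hMfst : MemLp (fun p : α × β => M p.1) 2 (μ.prod ν) :=
    hML.comp_measurePreserving measurePreserving_fst
  have hd2 : Integrable (fun p : α × β => (f p - M p.1) ^ 2) (μ.prod ν) :=
    (hf.sub hMfst).integrable_sq
  have hsplit : Var[f; μ.prod ν] = ∫ y, Var[fun x => f (x, y); μ] ∂ν + Var[m; ν] := by
    rw [variance_eq_sub hf, variance_eq_sub hmL]
    have h1 : ∫ y, Var[fun x => f (x, y); μ] ∂ν =
        ∫ y, ((∫ x, f (x, y) ^ 2 ∂μ) - m y ^ 2) ∂ν := by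
      refine integral_congr_ae ?_
      filter_upwards [hsl] with y hy
      rw [variance_eq_sub hy]
      rfl
    rw [h1, integral_sub hf2.integral_prod_right hmL.integrable_sq]
    simp only [Pi.pow_apply]
    rw [integral_prod_symm _ hf2, integral_prod_symm _ hf1]
    ring
  have hconv : Var[m; ν] ≤ ∫ x, Var[fun y => f (x, y); ν] ∂μ := by
    have h2 : ∫ x, Var[fun y => f (x, y); ν] ∂μ = ∫ x, ∫ y, (f (x, y) - M x) ^ 2 ∂ν ∂μ := by
      congr with x
      rw [variance_eq_integral (by fun_prop)]
    rw [h2, integral_integral_swap hd2, variance_eq_integral hmm.aemeasurable]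
    refine integral_mono_of_nonneg (ae_of_all _ fun _ => sq_nonneg _) hd2.integral_prod_right ?_
    filter_upwards [hsl] with y hy
    have h3 : m y - ∫ y', m y' ∂ν = ∫ x, (f (x, y) - M x) ∂μ := by
      rw [integral_sub (hy.integrable (by norm_num)) (hML.integrable (by norm_num)),
        integral_integral_swap (f := fun x y => f (x, y)) hf1]
    rw [h3]
    exact sq_integral_le_integral_sq (hy.sub hML)
  rw [hsplit]
  gcongr

theorem integrable_pi_symmExp {n : ℕ} {F : (Fin n → ℝ) → ℝ} {C : ℝ} (hF : Measurable F)
    (hb : ∀ x, |F x| ≤ C * exp ((∑ i, |x i|) / 2)) :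
    Integrable F (Measure.pi fun _ : Fin n => symmExp) := by
  have h1 : Integrable (fun t : ℝ => exp (|t| / 2)) symmExp :=
    integrable_symmExp (C := 1) (by fun_prop) fun t => by simp
  have h := (Integrable.fintype_prod (μ := fun _ : Fin n => symmExp)
    (f := fun _ : Fin n => fun t : ℝ => exp (|t| / 2)) fun _ => h1).const_mul C
  refine h.mono' hF.aestronglyMeasurable (ae_of_all _ fun x => ?_)
  rw [norm_eq_abs, ← exp_sum, ← Finset.sum_div]
  exact hb x

theorem measurePreserving_cons_symmExp (n : ℕ) :
    MeasurePreserving (fun p : ℝ × (Fin n → ℝ) => (Fin.cons p.1 p.2 : Fin (n + 1) → ℝ))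
      (symmExp.prod (Measure.pi fun _ : Fin n => symmExp))
      (Measure.pi fun _ : Fin (n + 1) => symmExp) := by
  have h := (measurePreserving_piFinSuccAbove (fun _ : Fin (n + 1) => symmExp) 0).symm
  convert! h using 1
  funext p
  simp only [MeasurableEquiv.piFinSuccAbove, MeasurableEquiv.coe_mk, MeasurableEquiv.symm_mk,
    Fin.insertNthEquiv_zero]
  rfl

/-- The Poincaré inequality for a product of symmetric exponential distributions. -/
theorem pi_symmExp_poincare (n : ℕ) : ∀ {g : (Fin n → ℝ) → ℝ} {D : Fin n → (Fin n → ℝ) → ℝ}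
    {C : ℝ}, Measurable g → (∀ i, Measurable (D i)) →
    (∀ i x, HasDerivAt (fun t => g (Function.update x i t)) (D i x) (x i)) →
    (∀ x, |g x| ≤ C * exp ((∑ i, |x i|) / 4)) →
    (∀ i x, |D i x| ≤ C * exp ((∑ i, |x i|) / 4)) →
    Var[g; Measure.pi fun _ : Fin n => symmExp] ≤
      4 * ∫ x, ∑ i, D i x ^ 2 ∂Measure.pi fun _ : Fin n => symmExp := by
  induction n with
  | zero =>
    intro g D C _ _ _ _ _
    have hg : g = fun _ => g 0 := funext fun x => by rw [Subsingleton.elim x 0]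
    rw [hg, variance_eq_integral measurable_const.aemeasurable]
    simp
  | succ n ih =>
    intro g D C hg hD hd hb hb'
    have mp := measurePreserving_cons_symmExp n
    have hφ := mp.measurable
    have hint {F : (Fin (n + 1) → ℝ) → ℝ} (hF : Measurable F)
        (hF' : ∀ x, |F x| ≤ C * exp ((∑ i, |x i|) / 4)) :
        Integrable (fun p : ℝ × (Fin n → ℝ) => F (Fin.cons p.1 p.2) ^ 2)
          (symmExp.prod (Measure.pi fun _ : Fin n => symmExp)) :=
      mp.integrable_comp_of_integrable
        (integrable_pi_symmExp (hF.pow_const 2) fun x => abs_sq_le_of_abs_le (hF' x))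
    have hmg : Measurable fun p : ℝ × (Fin n → ℝ) => g (Fin.cons p.1 p.2) := hg.comp hφ
    have hmD (i : Fin (n + 1)) :
      Measurable fun p : ℝ × (Fin n → ℝ) => D i (Fin.cons p.1 p.2) := (hD i).comp hφ
    have hL2 : MemLp (fun p : ℝ × (Fin n → ℝ) => g (Fin.cons p.1 p.2)) 2
        (symmExp.prod (Measure.pi fun _ : Fin n => symmExp)) :=
      (memLp_two_iff_integrable_sq hmg.aestronglyMeasurable).2 (hint hg hb)
    have hvar := variance_prod_le hmg hL2
    have hD0 := hint (hD 0) (hb' 0)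
    have hDs : Integrable (fun p : ℝ × (Fin n → ℝ) => ∑ i : Fin n, D i.succ (Fin.cons p.1 p.2) ^ 2)
        (symmExp.prod (Measure.pi fun _ : Fin n => symmExp)) :=
      integrable_finsetSum _ fun i _ => hint (hD i.succ) (hb' i.succ)
    have hexp (t : ℝ) (y : Fin n → ℝ) :
        exp ((∑ i, |(Fin.cons t y : Fin (n + 1) → ℝ) i|) / 4) =
          exp (|t| / 4) * exp ((∑ i, |y i|) / 4) := by
      rw [Fin.sum_univ_succ, ← exp_add]
      simp [add_div]
    have h1 : ∫ y, Var[fun t => g (Fin.cons t y); symmExp] ∂(Measure.pi fun _ : Fin n => symmExp) ≤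
        ∫ y, 4 * ∫ t, D 0 (Fin.cons t y) ^ 2 ∂symmExp ∂(Measure.pi fun _ : Fin n => symmExp) := by
      refine integral_mono_of_nonneg (ae_of_all _ fun _ => variance_nonneg _ _)
        (hD0.integral_prod_right.const_mul 4) (ae_of_all _ fun y => ?_)
      refine symmExp_poincare (C := C * exp ((∑ i, |y i|) / 4)) (fun t => ?_)
        ((hmD 0).comp (by fun_prop : Measurable fun t : ℝ => (t, y))) (fun t => ?_) (fun t => ?_)
      · simpa using hd 0 (Fin.cons t y)
      · refine (hb _).trans_eq ?_
        rw [hexp]; ring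
      · refine (hb' 0 _).trans_eq ?_
        rw [hexp]; ring
    have h2 : ∫ t, Var[fun y => g (Fin.cons t y); Measure.pi fun _ : Fin n => symmExp] ∂symmExp ≤
        ∫ t, 4 * ∫ y, ∑ i : Fin n, D i.succ (Fin.cons t y) ^ 2
          ∂(Measure.pi fun _ : Fin n => symmExp) ∂symmExp := by
      refine integral_mono_of_nonneg (ae_of_all _ fun _ => variance_nonneg _ _)
        (hDs.integral_prod_left.const_mul 4) (ae_of_all _ fun t => ?_)
      refine ih (g := fun y => g (Fin.cons t y)) (D := fun i y => D i.succ (Fin.cons t y))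
        (C := C * exp (|t| / 4))
        (hmg.comp (by fun_prop : Measurable fun y : Fin n → ℝ => (t, y)))
        (fun i => (hmD i.succ).comp (by fun_prop : Measurable fun y : Fin n → ℝ => (t, y)))
        (fun i y => ?_) (fun y => ?_) (fun i y => ?_)
      · simpa [Fin.cons_update] using hd i.succ (Fin.cons t y)
      · refine (hb _).trans_eq ?_
        rw [hexp]; ring
      · refine (hb' i.succ _).trans_eq ?_
        rw [hexp]; ring
    rw [integral_const_mul] at h1 h2
    have hlhs : Var[g; Measure.pi fun _ : Fin (n + 1) => symmExp] =
        Var[fun p : ℝ × (Fin n → ℝ) => g (Fin.cons p.1 p.2);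
          symmExp.prod (Measure.pi fun _ : Fin n => symmExp)] := by
      rw [← mp.map_eq, variance_map (by fun_prop) hφ.aemeasurable]
      rfl
    have hrhs : ∫ x, ∑ i, D i x ^ 2 ∂(Measure.pi fun _ : Fin (n + 1) => symmExp) =
        ∫ p : ℝ × (Fin n → ℝ), (D 0 (Fin.cons p.1 p.2) ^ 2 +
          ∑ i : Fin n, D i.succ (Fin.cons p.1 p.2) ^ 2)
          ∂symmExp.prod (Measure.pi fun _ : Fin n => symmExp) := by
      rw [← mp.map_eq, integral_map hφ.aemeasurable (by fun_prop)]
      simp only [Fin.sum_univ_succ]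
    rw [hlhs, hrhs, integral_add hD0 hDs, integral_prod_symm _ hD0, integral_prod _ hDs]
    linarith

/-- A smooth approximation from above of the Euclidean norm. -/
noncomputable def smoothNorm {n : ℕ} (δ : ℝ) (x : Fin n → ℝ) : ℝ := √(δ ^ 2 + ∑ i, x i ^ 2)

section smoothNorm

variable {n : ℕ} {δ : ℝ}

theorem continuous_smoothNorm : Continuous (smoothNorm δ : (Fin n → ℝ) → ℝ) := by
  unfold smoothNorm
  fun_prop

theorem smoothNorm_pos (hδ : 0 < δ) (x : Fin n → ℝ) : 0 < smoothNorm δ x := by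
  unfold smoothNorm
  positivity

theorem sq_smoothNorm (x : Fin n → ℝ) : smoothNorm δ x ^ 2 = δ ^ 2 + ∑ i, x i ^ 2 :=
  sq_sqrt (by positivity)

theorem smoothNorm_le_add_sqrt (hδ : 0 < δ) (x : Fin n → ℝ) :
    smoothNorm δ x ≤ δ + √(∑ i, x i ^ 2) := by
  refine sqrt_le_iff.2 ⟨by positivity, ?_⟩
  have h := sq_sqrt (show 0 ≤ ∑ i, x i ^ 2 by positivity)
  nlinarith [sqrt_nonneg (∑ i, x i ^ 2)]

theorem sqrt_le_smoothNorm (x : Fin n → ℝ) : √(∑ i, x i ^ 2) ≤ smoothNorm δ x :=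
  sqrt_le_sqrt (by nlinarith [sq_nonneg δ])

theorem smoothNorm_le_add_sum (hδ : 0 < δ) (x : Fin n → ℝ) :
    smoothNorm δ x ≤ δ + ∑ i, |x i| := by
  refine (smoothNorm_le_add_sqrt hδ x).trans ?_
  gcongr
  refine sqrt_le_iff.2 ⟨by positivity, ?_⟩
  simpa using Finset.sum_sq_le_sq_sum_of_nonneg (s := Finset.univ) (f := fun i => |x i|)
    fun i _ => abs_nonneg _

theorem abs_le_smoothNorm (x : Fin n → ℝ) (i : Fin n) : |x i| ≤ smoothNorm δ x := by
  refine abs_le_sqrt ?_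
  have := Finset.single_le_sum (f := fun i => x i ^ 2) (fun i _ => sq_nonneg _) (Finset.mem_univ i)
  nlinarith [sq_nonneg δ]

theorem hasDerivAt_smoothNorm_update (hδ : 0 < δ) (x : Fin n → ℝ) (i : Fin n) :
    HasDerivAt (fun t => smoothNorm δ (Function.update x i t)) (x i / smoothNorm δ x) (x i) := by
  have h (t : ℝ) : ∑ j, Function.update x i t j ^ 2 = t ^ 2 + ∑ j ∈ Finset.univ.erase i, x j ^ 2 := by
    rw [← Finset.add_sum_erase _ _ (Finset.mem_univ i), Function.update_self]
    congr 1
    exact Finset.sum_congr rfl fun j hj => by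
      rw [Function.update_of_ne (Finset.ne_of_mem_erase hj)]
  have hx : x i ^ 2 + ∑ j ∈ Finset.univ.erase i, x j ^ 2 = ∑ j, x j ^ 2 :=
    Finset.add_sum_erase _ (fun j => x j ^ 2) (Finset.mem_univ i)
  unfold smoothNorm
  simp only [h]
  have hd := (((hasDerivAt_pow 2 (x i)).add_const
    (∑ j ∈ Finset.univ.erase i, x j ^ 2)).const_add (δ ^ 2)).sqrt (by positivity)
  rw [hx] at hd
  convert! hd using 1
  field_simp
  norm_num
  ring

theorem integrable_exp_mul_smoothNorm (hδ : 0 < δ) {s : ℝ} (hs : s ≤ 1 / 2) :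
    Integrable (fun x : Fin n → ℝ => exp (s * smoothNorm δ x))
      (Measure.pi fun _ : Fin n => symmExp) := by
  have := (continuous_smoothNorm (n := n) (δ := δ)).measurable
  refine integrable_pi_symmExp (C := exp (δ / 2)) (by fun_prop) fun x => ?_
  rw [abs_of_pos (exp_pos _), ← exp_add]
  refine exp_le_exp.2 ?_
  nlinarith [smoothNorm_pos hδ x, smoothNorm_le_add_sum hδ x]

theorem mgf_smoothNorm_sub_le (hδ : 0 < δ) {s : ℝ} (hs0 : 0 ≤ s) (hs : s ≤ 1 / 2) :
    mgf (smoothNorm δ) (Measure.pi fun _ : Fin n => symmExp) s -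
      mgf (smoothNorm δ) (Measure.pi fun _ : Fin n => symmExp) (s / 2) ^ 2 ≤
      s ^ 2 * mgf (smoothNorm δ) (Measure.pi fun _ : Fin n => symmExp) s := by
  have hm := (continuous_smoothNorm (n := n) (δ := δ)).measurable
  have hsq (x : Fin n → ℝ) : exp (s / 2 * smoothNorm δ x) ^ 2 = exp (s * smoothNorm δ x) := by
    rw [sq, ← exp_add]; ring_nf
  have hg (x : Fin n → ℝ) :
      |exp (s / 2 * smoothNorm δ x)| ≤ exp (δ / 4) * exp ((∑ i, |x i|) / 4) := by
    rw [abs_of_pos (exp_pos _), ← exp_add]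
    refine exp_le_exp.2 ?_
    nlinarith [smoothNorm_pos hδ x, smoothNorm_le_add_sum hδ x]
  have hratio (i : Fin n) (x : Fin n → ℝ) : |s / 2 * (x i / smoothNorm δ x)| ≤ 1 := by
    rw [abs_mul, abs_div (x i), abs_of_pos (smoothNorm_pos hδ x),
      abs_of_nonneg (show 0 ≤ s / 2 by positivity)]
    have := (div_le_one (smoothNorm_pos hδ x)).2 (abs_le_smoothNorm (δ := δ) x i)
    have h0 : 0 ≤ |x i| / smoothNorm δ x := div_nonneg (abs_nonneg _) (smoothNorm_pos hδ x).le
    nlinarith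
  have hP := pi_symmExp_poincare n (g := fun x => exp (s / 2 * smoothNorm δ x))
    (D := fun i x => exp (s / 2 * smoothNorm δ x) * (s / 2 * (x i / smoothNorm δ x)))
    (C := exp (δ / 4)) (by fun_prop) (fun i => by fun_prop)
    (fun i x => by
      simpa using ((hasDerivAt_smoothNorm_update hδ x i).const_mul (s / 2)).exp) hg
    (fun i x => by
      rw [abs_mul]
      exact (mul_le_of_le_one_right (abs_nonneg _) (hratio i x)).trans (hg x))
  have hL2 : MemLp (fun x : Fin n → ℝ => exp (s / 2 * smoothNorm δ x)) 2
      (Measure.pi fun _ : Fin n => symmExp) := by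
    refine (memLp_two_iff_integrable_sq (by fun_prop)).2 ?_
    simp only [hsq]
    exact integrable_exp_mul_smoothNorm hδ hs
  rw [variance_eq_sub hL2] at hP
  simp only [Pi.pow_apply, hsq] at hP
  have hR : ∫ x, ∑ i, (exp (s / 2 * smoothNorm δ x) * (s / 2 * (x i / smoothNorm δ x))) ^ 2
      ∂(Measure.pi fun _ : Fin n => symmExp) ≤
      ∫ x, s ^ 2 / 4 * exp (s * smoothNorm δ x) ∂(Measure.pi fun _ : Fin n => symmExp) := by
    refine integral_mono_of_nonneg (ae_of_all _ fun x => Finset.sum_nonneg fun i _ => sq_nonneg _)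
      ((integrable_exp_mul_smoothNorm hδ hs).const_mul _) (ae_of_all _ fun x => ?_)
    have h1 : ∑ i, (exp (s / 2 * smoothNorm δ x) * (s / 2 * (x i / smoothNorm δ x))) ^ 2 =
        s ^ 2 / 4 * exp (s * smoothNorm δ x) * ((∑ i, x i ^ 2) / smoothNorm δ x ^ 2) := by
      rw [Finset.sum_div, Finset.mul_sum]
      refine Finset.sum_congr rfl fun i _ => ?_
      rw [mul_pow, hsq]
      ring
    simp only [h1]
    refine mul_le_of_le_one_right (by positivity) ?_
    rw [div_le_one (pow_pos (smoothNorm_pos hδ x) 2), sq_smoothNorm]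
    nlinarith [sq_nonneg δ]
  rw [integral_const_mul] at hR
  simp only [mgf]
  linarith

theorem cgf_smoothNorm_le_two_mul (hδ : 0 < δ) {s : ℝ} (hs0 : 0 ≤ s) (hs : s ≤ 1 / 2) :
    cgf (smoothNorm δ) (Measure.pi fun _ : Fin n => symmExp) s ≤
      2 * cgf (smoothNorm δ) (Measure.pi fun _ : Fin n => symmExp) (s / 2) + 4 / 3 * s ^ 2 := by
  have h := mgf_smoothNorm_sub_le (n := n) hδ hs0 hs
  have hp := mgf_pos (integrable_exp_mul_smoothNorm (n := n) hδ hs)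
  have hs2 : s ^ 2 ≤ 1 / 4 := by nlinarith
  have hq : 0 < 1 - s ^ 2 := by linarith
  have hlog : log (mgf (smoothNorm δ) (Measure.pi fun _ : Fin n => symmExp) s * (1 - s ^ 2)) ≤
      log (mgf (smoothNorm δ) (Measure.pi fun _ : Fin n => symmExp) (s / 2) ^ 2) :=
    log_le_log (by positivity) (by linarith)
  rw [log_mul hp.ne' hq.ne', log_pow] at hlog
  have h1 := one_sub_inv_le_log_of_pos hq
  have h2 : (1 - s ^ 2)⁻¹ ≤ 1 + 4 / 3 * s ^ 2 := by
    rw [inv_le_iff_one_le_mul₀ hq]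
    nlinarith [sq_nonneg s]
  simp only [cgf]
  push_cast at hlog
  linarith

theorem cgf_smoothNorm_le_two_pow_mul (hδ : 0 < δ) {s : ℝ} (hs0 : 0 ≤ s) (hs : s ≤ 1 / 2) (k : ℕ) :
    cgf (smoothNorm δ) (Measure.pi fun _ : Fin n => symmExp) s ≤
      2 ^ k * cgf (smoothNorm δ) (Measure.pi fun _ : Fin n => symmExp) (s / 2 ^ k) +
        8 / 3 * (1 - 1 / 2 ^ k) * s ^ 2 := by
  induction k with
  | zero => simp
  | succ k ih =>
    have hk : s / 2 ^ k ≤ 1 / 2 := (div_le_self hs0 (one_le_pow₀ one_le_two)).trans hs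
    have h := cgf_smoothNorm_le_two_mul (n := n) hδ (div_nonneg hs0 (by positivity)) hk
    refine ih.trans ?_
    rw [div_div, ← pow_succ] at h
    have h' := mul_le_mul_of_nonneg_left h (show (0 : ℝ) ≤ 2 ^ k by positivity)
    refine (add_le_add_left h' _).trans_eq ?_
    rw [pow_succ]
    field_simp
    ring

theorem cgf_smoothNorm_le (hδ : 0 < δ) {s : ℝ} (hs0 : 0 < s) (hs : s ≤ 1 / 2) :
    cgf (smoothNorm δ) (Measure.pi fun _ : Fin n => symmExp) s ≤
      s * ∫ x, smoothNorm δ x ∂(Measure.pi fun _ : Fin n => symmExp) + 8 / 3 * s ^ 2 := by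
  set μ := Measure.pi fun _ : Fin n => symmExp
  have h0 : (0 : ℝ) ∈ interior (integrableExpSet (smoothNorm δ) μ) :=
    mem_interior_iff_mem_nhds.2 <| Filter.mem_of_superset
      (Iic_mem_nhds (show (0 : ℝ) < 1 / 2 by norm_num))
      fun t ht => integrable_exp_mul_smoothNorm hδ ht
  have hd : HasDerivAt (cgf (smoothNorm δ) μ) (∫ x, smoothNorm δ x ∂μ) 0 := by
    have h := (analyticAt_cgf h0).differentiableAt.hasDerivAt
    rw [deriv_cgf_zero h0] at h
    simpa using h
  have hlim : Filter.Tendsto (fun k : ℕ => s / 2 ^ k) Filter.atTop (nhdsWithin 0 {0}ᶜ) := by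
    refine tendsto_nhdsWithin_iff.2 ⟨?_, Filter.Eventually.of_forall fun k => ?_⟩
    · exact (tendsto_pow_atTop_atTop_of_one_lt one_lt_two).const_div_atTop s
    · exact (div_pos hs0 (by positivity)).ne'
  have hlim' := ((hd.tendsto_slope_zero.comp hlim).const_mul s).add_const (8 / 3 * s ^ 2)
  refine ge_of_tendsto' hlim' fun k => ?_
  refine (cgf_smoothNorm_le_two_pow_mul hδ hs0.le hs k).trans ?_
  simp only [Function.comp_apply, zero_add, cgf_zero, sub_zero, smul_eq_mul]
  have h1 : s * ((s / 2 ^ k)⁻¹ * cgf (smoothNorm δ) μ (s / 2 ^ k)) =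
      2 ^ k * cgf (smoothNorm δ) μ (s / 2 ^ k) := by
    field_simp
  rw [h1]
  gcongr
  have : (0 : ℝ) < 1 / 2 ^ k := by positivity
  linarith

end smoothNorm

/-- Concentration of the Euclidean norm under a product of symmetric exponential distributions. -/
theorem pi_symmExp_measureReal_norm_ge_le (n : ℕ) {r : ℝ} (hr : 0 < r) :
    (Measure.pi fun _ : Fin n => symmExp).real
      {x | (∫ y, √(∑ i, y i ^ 2) ∂Measure.pi fun _ : Fin n => symmExp) + r ≤ √(∑ i, x i ^ 2)} ≤
      exp (-(r ^ 2 / (96 + 4 * r))) := by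
  set μ := Measure.pi fun _ : Fin n => symmExp
  have hδ : 0 < r / 4 := by positivity
  have hm := (continuous_smoothNorm (n := n) (δ := r / 4)).measurable
  have hf : Integrable (smoothNorm (r / 4)) μ := by
    have h := (integrable_exp_mul_smoothNorm (n := n) hδ le_rfl).const_mul 2
    refine h.mono' hm.aestronglyMeasurable (ae_of_all _ fun x => ?_)
    rw [norm_eq_abs, abs_of_pos (smoothNorm_pos hδ x)]
    linarith [add_one_le_exp (1 / 2 * smoothNorm (r / 4) x)]
  have hN : Integrable (fun x : Fin n → ℝ => √(∑ i, x i ^ 2)) μ := by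
    refine hf.mono' (show Continuous _ by fun_prop).aestronglyMeasurable (ae_of_all _ fun x => ?_)
    rw [norm_eq_abs, abs_of_nonneg (sqrt_nonneg _)]
    exact sqrt_le_smoothNorm x
  have hE : ∫ x, smoothNorm (r / 4) x ∂μ ≤ r / 4 + ∫ x, √(∑ i, x i ^ 2) ∂μ := by
    refine (integral_mono hf ((integrable_const (r / 4)).add hN)
      fun x => smoothNorm_le_add_sqrt hδ x).trans_eq ?_
    simp [integral_add (integrable_const (r / 4)) hN]
  set s : ℝ := 2 * r / (96 + 4 * r) with hs
  have hs0 : 0 < s := by positivity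
  have hs1 : s ≤ 1 / 2 := by
    rw [hs, div_le_iff₀ (by positivity)]
    linarith
  have hcgf := cgf_smoothNorm_le (n := n) hδ hs0 hs1
  have hch := measure_ge_le_exp_cgf (μ := μ) (X := smoothNorm (r / 4))
    ((∫ y, √(∑ i, y i ^ 2) ∂μ) + r) hs0.le (integrable_exp_mul_smoothNorm hδ hs1)
  refine (measureReal_mono fun x hx => le_trans hx (sqrt_le_smoothNorm x)).trans (hch.trans ?_)
  refine exp_le_exp.2 ?_
  have h1 : s * ∫ x, smoothNorm (r / 4) x ∂μ ≤ s * (r / 4 + ∫ x, √(∑ i, x i ^ 2) ∂μ) := by gcongr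
  have h2 : r ^ 2 / (96 + 4 * r) = s * r / 2 := by
    rw [hs]; ring
  have h3 : s ≤ r / 48 := by
    rw [hs, div_le_div_iff₀ (by positivity) (by norm_num)]
    nlinarith
  rw [h2]
  nlinarith

/-- Talagrand-type deviation inequality for the Euclidean norm of a vector of i.i.d.
two-sided (symmetric) exponential random variables (Remark 1 (iii) of the paper):
for every `ε > 0` and `x > 0`,
`P(‖X‖ ≥ (1+ε) E‖X‖ + x) ≤ exp(−x²/(6(16 + 8/ε²) + 4x))`. -/
theorem stmt8
    {Ω : Type*} [MeasureSpace Ω] [IsProbabilityMeasure (ℙ : Measure Ω)]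
    {d : ℕ}
    (X : Ω → EuclideanSpace ℝ (Fin d)) (hX : Measurable X)
    (hlaw : Measure.map (fun ω k => X ω k) ℙ =
      Measure.pi fun _ : Fin d =>
        (volume : Measure ℝ).withDensity fun t => ENNReal.ofReal ((1/2) * Real.exp (-|t|)))
    (ε x : ℝ) (hε : 0 < ε) (hx : 0 < x) :
    ℙ {ω | ‖X ω‖ ≥ (1 + ε) * (∫ ω', ‖X ω'‖) + x} ≤
      ENNReal.ofReal (Real.exp (-(x ^ 2 / (6 * (16 + 8 / ε ^ 2) + 4 * x)))) := by
  have hY : Measurable fun ω k => X ω k := by fun_prop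
  have hlaw' : Measure.map (fun ω k => X ω k) ℙ = Measure.pi fun _ : Fin d => symmExp := hlaw
  have hnorm (v : EuclideanSpace ℝ (Fin d)) : ‖v‖ = √(∑ i, v i ^ 2) := by
    simp [EuclideanSpace.norm_eq]
  have hE : ∫ ω, ‖X ω‖ = ∫ y, √(∑ i, y i ^ 2) ∂Measure.pi fun _ : Fin d => symmExp := by
    rw [← hlaw', integral_map hY.aemeasurable
      (show Continuous fun y : Fin d → ℝ => √(∑ i, y i ^ 2) by fun_prop).aestronglyMeasurable]
    simp only [hnorm]
  have hE0 : 0 ≤ ∫ ω, ‖X ω‖ := integral_nonneg fun _ => norm_nonneg _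
  have hmeas : MeasurableSet {y : Fin d → ℝ | (∫ ω, ‖X ω‖) + x ≤ √(∑ i, y i ^ 2)} :=
    measurableSet_le (by fun_prop) (by fun_prop)
  have hmain := pi_symmExp_measureReal_norm_ge_le d hx
  rw [← hE, ← hlaw', map_measureReal_apply hY hmeas] at hmain
  have hexp : exp (-(x ^ 2 / (96 + 4 * x))) ≤
      exp (-(x ^ 2 / (6 * (16 + 8 / ε ^ 2) + 4 * x))) := by
    have : 0 < 8 / ε ^ 2 := by positivity
    gcongr
    linarith
  rw [← ENNReal.ofReal_toReal (measure_ne_top ℙ _)]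
  refine ENNReal.ofReal_le_ofReal (le_trans ?_ (hmain.trans hexp))
  refine measureReal_mono fun ω hω => ?_
  simp only [Set.mem_ofPred_eq, Set.mem_preimage, ge_iff_le] at hω ⊢
  rw [← hnorm]
  nlinarith
end

section
/- Let λ > 0, let X = (X₁,…,X_d) be a random vector whose components are i.i.d., each Poisson distributed with parameter λ, and let ‖·‖ denote the Euclidean norm on ℝ^d. Let ε > 0 and set v² = 8λ + 2λd/(ε·E‖X‖)². Then for all x > 0, P( ‖X‖ ≥ (1+ε)·E‖X‖ + x ) ≤ exp( −v²·ℓ(x/v²) ) and P( ‖X‖ ≤ (1−ε)·E‖X‖ − x ) ≤ exp( −v²·ℓ(x/v²) ), where ℓ(u) = (1+u)log(1+u) − u. -/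
open MeasureTheory ProbabilityTheory Real
open scoped ENNReal NNReal

section PoissonConcentration

open Filter Topology

/-- The remainder `exp u - 1 - u`, summed over a family of increments. -/
noncomputable def expRemainder {ι : Type*} [Fintype ι] (v : ι → ℝ) : ℝ := ∑ k, (exp (v k) - 1 - v k)

lemma convexOn_expRemainder {ι : Type*} [Fintype ι] : ConvexOn ℝ Set.univ (expRemainder (ι := ι)) := by
  have h (k : ι) : ConvexOn ℝ Set.univ fun v : ι → ℝ ↦ exp (v k) - 1 - v k := by
    let L : (ι → ℝ) →ₗ[ℝ] ℝ := LinearMap.proj k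
    exact ((convexOn_exp.comp_linearMap L).sub (concaveOn_const 1 convex_univ)).sub
      (L.concaveOn convex_univ)
  refine ⟨convex_univ, fun x _ y _ a b ha hb hab ↦ ?_⟩
  simp only [expRemainder, Finset.smul_sum, ← Finset.sum_add_distrib]
  exact Finset.sum_le_sum fun k _ ↦ (h k).2 trivial trivial ha hb hab

variable {ι : Type*} [Fintype ι] [DecidableEq ι]

/-- The average of a function on `ℕ^ι` over all unit coordinate shifts, as a linear operator. -/
noncomputable def avgShift (ι : Type*) [Fintype ι] [DecidableEq ι] :
    Module.End ℝ ((ι → ℕ) → ℝ) where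
  toFun g x := (Fintype.card ι : ℝ)⁻¹ * ∑ k, g (x + Pi.single k 1)
  map_add' g h := by
    ext x
    simp [Finset.sum_add_distrib, mul_add]
  map_smul' c g := by
    ext x
    simp only [Pi.smul_apply, smul_eq_mul, RingHom.id_apply, ← Finset.mul_sum]
    ring

lemma avgShift_apply (g : (ι → ℕ) → ℝ) (x : ι → ℕ) :
    avgShift ι g x = (Fintype.card ι : ℝ)⁻¹ * ∑ k, g (x + Pi.single k 1) := rfl

/-- The transition operator of the walk on `ℕ^ι` that jumps with probability `p`, by a uniformly
chosen coordinate vector. -/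
noncomputable def lazyShift (ι : Type*) [Fintype ι] [DecidableEq ι] (p : ℝ) :
    Module.End ℝ ((ι → ℕ) → ℝ) :=
  p • avgShift ι + (1 - p) • 1

lemma lazyShift_apply (p : ℝ) (g : (ι → ℕ) → ℝ) (x : ι → ℕ) :
    lazyShift ι p g x =
      p * ((Fintype.card ι : ℝ)⁻¹ * ∑ k, g (x + Pi.single k 1)) + (1 - p) * g x := by
  simp [lazyShift, avgShift_apply]

lemma lazyShift_mono {p : ℝ} (hp0 : 0 ≤ p) (hp1 : p ≤ 1) {g h : (ι → ℕ) → ℝ}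
    (hgh : ∀ x, g x ≤ h x) (x : ι → ℕ) : lazyShift ι p g x ≤ lazyShift ι p h x := by
  have := sub_nonneg.2 hp1
  simp only [lazyShift_apply]
  gcongr <;> apply hgh

lemma lazyShift_pow_mono {p : ℝ} (hp0 : 0 ≤ p) (hp1 : p ≤ 1) (n : ℕ) {g h : (ι → ℕ) → ℝ}
    (hgh : ∀ x, g x ≤ h x) (x : ι → ℕ) :
    (lazyShift ι p ^ n) g x ≤ (lazyShift ι p ^ n) h x := by
  induction n generalizing g h with
  | zero => exact hgh x
  | succ n ih =>
    simp only [pow_succ, Module.End.mul_apply]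
    exact ih (lazyShift_mono hp0 hp1 hgh)

lemma lazyShift_pow_apply (p : ℝ) (n : ℕ) (g : (ι → ℕ) → ℝ) (x : ι → ℕ) :
    (lazyShift ι p ^ n) g x = ∑ m ∈ Finset.range (n + 1),
      n.choose m * p ^ m * (1 - p) ^ (n - m) * (avgShift ι ^ m) g x := by
  have hc : Commute (p • avgShift ι) ((1 - p) • (1 : Module.End ℝ ((ι → ℕ) → ℝ))) :=
    ((Commute.one_right _).smul_right _)
  rw [lazyShift, hc.add_pow]
  simp only [LinearMap.sum_apply, Finset.sum_apply]
  refine Finset.sum_congr rfl fun m _ ↦ ?_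
  rw [smul_pow, smul_pow, one_pow, ← Nat.cast_comm, ← nsmul_eq_mul]
  simp
  ring

/-- The family of coordinate increments of a function on `ℕ^ι`. -/
def increments (g : (ι → ℕ) → ℝ) (x : ι → ℕ) (k : ι) : ℝ := g (x + Pi.single k 1) - g x

lemma expRemainder_increments_lazyShift_le [Nonempty ι] {p : ℝ} (hp0 : 0 ≤ p) (hp1 : p ≤ 1)
    {g : (ι → ℕ) → ℝ} {B : ℝ} (hg : ∀ x, expRemainder (increments g x) ≤ B) (x : ι → ℕ) :
    expRemainder (increments (lazyShift ι p g) x) ≤ B := by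
  have hK : Convex ℝ {v : ι → ℝ | expRemainder v ≤ B} := by
    simpa using (convexOn_expRemainder (ι := ι)).convex_le B
  have hmem : p • (∑ j, (Fintype.card ι : ℝ)⁻¹ • increments g (x + Pi.single j 1)) +
      (1 - p) • increments g x ∈ {v : ι → ℝ | expRemainder v ≤ B} := by
    refine hK (hK.sum_mem (fun _ _ ↦ by positivity) (by simp) fun j _ ↦ hg _) (hg x) hp0
      (sub_nonneg.2 hp1) (by ring)
  suffices h : increments (lazyShift ι p g) x = p • (∑ j, (Fintype.card ι : ℝ)⁻¹ •
      increments g (x + Pi.single j 1)) + (1 - p) • increments g x by rwa [h]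
  ext k
  simp only [increments, lazyShift_apply, Pi.add_apply, Pi.smul_apply, Finset.sum_apply,
    smul_eq_mul, ← Finset.mul_sum, Finset.sum_sub_distrib, add_right_comm x (Pi.single k 1)]
  ring

lemma lazyShift_exp_le {p : ℝ} (hp0 : 0 ≤ p) {g : (ι → ℕ) → ℝ} {B : ℝ} [Nonempty ι]
    (hg : ∀ x, expRemainder (increments g x) ≤ B) (x : ι → ℕ) :
    lazyShift ι p (fun y ↦ exp (g y)) x ≤
      exp (p * (Fintype.card ι : ℝ)⁻¹ * B) * exp (lazyShift ι p g x) := by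
  set c := (Fintype.card ι : ℝ)⁻¹ with hc
  have hc0 : 0 ≤ c := by positivity
  have hcs : c * ∑ _k : ι, (1 : ℝ) = 1 := by simp [hc]
  have h1 : lazyShift ι p (fun y ↦ exp (g y)) x =
      exp (g x) * (1 + p * c * ∑ k, (exp (increments g x k) - 1)) := by
    have : ∑ k, exp (g (x + Pi.single k 1)) = exp (g x) * ∑ k, exp (increments g x k) := by
      rw [Finset.mul_sum]
      exact Finset.sum_congr rfl fun k _ ↦ by rw [← exp_add, increments]; ring_nf
    rw [lazyShift_apply, this, Finset.sum_sub_distrib]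
    linear_combination (p * exp (g x)) * hcs
  have h2 : lazyShift ι p g x = g x + p * c * ∑ k, increments g x k := by
    simp only [lazyShift_apply, increments, Finset.sum_sub_distrib, Finset.sum_const, nsmul_eq_mul,
      Finset.card_univ] at hcs ⊢
    linear_combination (g x * p) * hcs
  have h3 : ∑ k, (exp (increments g x k) - 1) ≤ B + ∑ k, increments g x k := by
    have := hg x
    simp only [expRemainder, Finset.sum_sub_distrib] at this ⊢
    linarith
  rw [h1, h2, ← exp_add, add_left_comm, exp_add]
  gcongr
  calc 1 + p * c * ∑ k, (exp (increments g x k) - 1)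
      ≤ 1 + p * c * (B + ∑ k, increments g x k) := by gcongr
    _ ≤ _ := by
      rw [← mul_add, add_comm]
      exact add_one_le_exp _

lemma lazyShift_pow_exp_le [Nonempty ι] {p : ℝ} (hp0 : 0 ≤ p) (hp1 : p ≤ 1) (n : ℕ)
    {g : (ι → ℕ) → ℝ} {B : ℝ} (hg : ∀ x, expRemainder (increments g x) ≤ B) (x : ι → ℕ) :
    (lazyShift ι p ^ n) (fun y ↦ exp (g y)) x ≤
      exp (n * (p * (Fintype.card ι : ℝ)⁻¹ * B)) * exp ((lazyShift ι p ^ n) g x) := by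
  induction n generalizing g with
  | zero => simp
  | succ n ih =>
    simp only [pow_succ, Module.End.mul_apply]
    set b := p * (Fintype.card ι : ℝ)⁻¹ * B
    calc (lazyShift ι p ^ n) (lazyShift ι p fun y ↦ exp (g y)) x
        ≤ (lazyShift ι p ^ n) (exp b • fun y ↦ exp (lazyShift ι p g y)) x :=
          lazyShift_pow_mono hp0 hp1 n (lazyShift_exp_le hp0 hg) x
      _ ≤ exp b * (exp (n * b) * exp ((lazyShift ι p ^ n) (lazyShift ι p g) x)) := by
          rw [map_smul, Pi.smul_apply, smul_eq_mul]
          gcongr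
          exact ih (expRemainder_increments_lazyShift_le hp0 hp1 hg)
      _ = _ := by
          simp only [← exp_add]
          push_cast
          ring_nf

/-- At most exponential growth in the sum of the coordinates. -/
def ExpGrowth (g : (ι → ℕ) → ℝ) : Prop :=
  ∃ C K : ℝ, 0 ≤ C ∧ 0 ≤ K ∧ ∀ x, |g x| ≤ C * K ^ ∑ k, x k

lemma abs_avgShift_pow_le [Nonempty ι] {g : (ι → ℕ) → ℝ} {C K : ℝ}
    (hg : ∀ x, |g x| ≤ C * K ^ ∑ k, x k) (m : ℕ) (x : ι → ℕ) :
    |(avgShift ι ^ m) g x| ≤ C * K ^ (m + ∑ k, x k) := by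
  induction m generalizing x with
  | zero => simpa using hg x
  | succ m ih =>
    rw [pow_succ', Module.End.mul_apply, avgShift_apply, abs_mul, abs_of_nonneg (by positivity),
      inv_mul_le_iff₀ (by simp [Fintype.card_pos])]
    refine (Finset.abs_sum_le_sum_abs _ _).trans ?_
    refine (Finset.sum_le_card_nsmul _ _ (C * K ^ (m + 1 + ∑ k, x k)) fun k _ ↦ ?_).trans ?_
    · refine (ih _).trans (le_of_eq ?_)
      have : ∑ i, (x + Pi.single k 1 : ι → ℕ) i = ∑ i, x i + 1 := by simp [Finset.sum_add_distrib]
      rw [this]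
      ring_nf
    · simp

/-- The operator `lazyShift` iterated `n` times with jump probability `r / n` converges to the
Poissonized average shift. -/
lemma tendsto_lazyShift_pow [Nonempty ι] {g : (ι → ℕ) → ℝ} (hg : ExpGrowth g) {r : ℝ}
    (hr : 0 ≤ r) :
    Tendsto (fun n : ℕ ↦ (lazyShift ι (r / n) ^ n) g 0) atTop
      (𝓝 (∑' m : ℕ, exp (-r) * r ^ m / m.factorial * (avgShift ι ^ m) g 0)) := by
  obtain ⟨C, K, hC, hK, hg⟩ := hg
  have hrn : Tendsto (fun n : ℕ ↦ (n : ℝ) * (r / n)) atTop (𝓝 r) := by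
    refine tendsto_const_nhds.congr' ?_
    filter_upwards [eventually_ge_atTop 1] with n hn
    field_simp
  have heq (n : ℕ) : (lazyShift ι (r / n) ^ n) g 0 = ∑' m : ℕ,
      n.choose m * (r / n) ^ m * (1 - r / n) ^ (n - m) * (avgShift ι ^ m) g 0 := by
    rw [lazyShift_pow_apply, tsum_eq_sum]
    intro m hm
    rw [Nat.choose_eq_zero_of_lt (by simpa using hm)]
    simp
  simp only [heq]
  refine tendsto_tsum_of_dominated_convergence
    (bound := fun m : ℕ ↦ C * ((r * K) ^ m / m.factorial))
    ((summable_pow_div_factorial _).mul_left _)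
    (fun m ↦ (tendsto_choose_mul_pow_of_tendsto_mul_atTop m hrn).mul_const _) ?_
  filter_upwards [eventually_ge_atTop 1, eventually_ge_atTop ⌈r⌉₊] with n hn1 hn m
  have hn1' : (0 : ℝ) < n := by exact_mod_cast hn1
  have hp1 : r / n ≤ 1 := (div_le_one hn1').2 (Nat.ceil_le.1 hn)
  have hq0 : 0 ≤ 1 - r / n := sub_nonneg.2 hp1
  have hq1 : 1 - r / n ≤ 1 := sub_le_self _ (by positivity)
  have hb : |(avgShift ι ^ m) g 0| ≤ C * K ^ m := by simpa using abs_avgShift_pow_le hg m 0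
  rw [norm_mul, Real.norm_eq_abs, Real.norm_eq_abs, abs_of_nonneg (by positivity)]
  calc _ ≤ ((n : ℝ) ^ m / m.factorial * (r / n) ^ m * 1) * (C * K ^ m) := by
        gcongr
        · exact Nat.choose_le_pow_div m n
        · exact pow_le_one₀ hq0 hq1
    _ = _ := by
        rw [div_pow, mul_pow]
        field_simp

/-- A function on `ℕ^ι`, seen as a linear functional on polynomials through its values at
exponents of monomials. -/
noncomputable def monomialFunctional (g : (ι → ℕ) → ℝ) : MvPolynomial ι ℝ →ₗ[ℝ] ℝ :=
  (MvPolynomial.basisMonomials ι ℝ).constr ℝ fun s ↦ g s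

lemma monomialFunctional_monomial {ι : Type*} (g : (ι → ℕ) → ℝ) (s : ι →₀ ℕ) :
    monomialFunctional g (MvPolynomial.monomial s 1) = g s := by
  have := (MvPolynomial.basisMonomials ι ℝ).constr_basis ℝ (fun s ↦ g s) s
  rwa [MvPolynomial.coe_basisMonomials] at this

lemma monomialFunctional_avgShift [Nonempty ι] (g : (ι → ℕ) → ℝ) (q : MvPolynomial ι ℝ) :
    monomialFunctional g ((∑ k, MvPolynomial.X k) * q) =
      Fintype.card ι * monomialFunctional (avgShift ι g) q := by
  have h : monomialFunctional g ∘ₗ LinearMap.mulLeft ℝ (∑ k, MvPolynomial.X k) =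
      (Fintype.card ι : ℝ) • monomialFunctional (avgShift ι g) := by
    refine (MvPolynomial.basisMonomials ι ℝ).ext fun s ↦ ?_
    simp only [MvPolynomial.coe_basisMonomials, LinearMap.comp_apply, LinearMap.mulLeft_apply,
      LinearMap.smul_apply, smul_eq_mul, monomialFunctional_monomial, avgShift_apply,
      Finset.sum_mul, map_sum, MvPolynomial.X, MvPolynomial.monomial_mul, one_mul]
    rw [mul_inv_cancel_left₀ (by simp)]
    refine Finset.sum_congr rfl fun k _ ↦ congrArg g ?_
    rw [add_comm, Finsupp.coe_add, Finsupp.single_eq_pi_single]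
  exact LinearMap.congr_fun h q

lemma card_pow_mul_avgShift_pow [Nonempty ι] (g : (ι → ℕ) → ℝ) (m : ℕ) :
    (Fintype.card ι : ℝ) ^ m * (avgShift ι ^ m) g 0 =
      ∑ x ∈ Finset.piAntidiag Finset.univ m, Nat.multinomial Finset.univ x * g x := by
  have h1 (g : (ι → ℕ) → ℝ) (q : MvPolynomial ι ℝ) :
      monomialFunctional g ((∑ k, MvPolynomial.X k) ^ m * q) =
        (Fintype.card ι : ℝ) ^ m * monomialFunctional ((avgShift ι ^ m) g) q := by
    induction m generalizing g with
    | zero => simp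
    | succ m ih =>
      rw [pow_succ' (∑ k, MvPolynomial.X k), mul_assoc, monomialFunctional_avgShift, ih,
        pow_succ (avgShift ι), Module.End.mul_apply]
      ring
  have h2 := h1 g (MvPolynomial.monomial 0 1)
  rw [monomialFunctional_monomial, Finsupp.coe_zero] at h2
  rw [← h2, Finset.sum_pow_eq_sum_piAntidiag, Finset.sum_mul, map_sum]
  refine Finset.sum_congr rfl fun x _ ↦ ?_
  have h3 : ((Nat.multinomial Finset.univ x : MvPolynomial ι ℝ) * ∏ i, MvPolynomial.X i ^ x i) *
      MvPolynomial.monomial (0 : ι →₀ ℕ) (1 : ℝ) = (Nat.multinomial Finset.univ x : ℝ) •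
        MvPolynomial.monomial (Finsupp.equivFunOnFinite.symm x) 1 := by
    rw [MvPolynomial.monomial_eq, MvPolynomial.monomial_eq, MvPolynomial.smul_eq_C_mul,
      Finsupp.prod_fintype _ _ (by simp)]
    simp
  rw [h3, map_smul, monomialFunctional_monomial]
  simp

/-- The law on `ℕ^ι` of independent Poisson variables with a common parameter. -/
noncomputable abbrev poissonPi (ι : Type*) [Fintype ι] (lam : ℝ≥0) : Measure (ι → ℕ) :=
  Measure.pi fun _ ↦ poissonMeasure lam

lemma integrable_poissonPi {ι : Type*} [Fintype ι] (lam : ℝ≥0) {g : (ι → ℕ) → ℝ} (hg : ExpGrowth g) :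
    Integrable g (poissonPi ι lam) := by
  obtain ⟨C, K, hC, hK, hg⟩ := hg
  have h1 : Integrable (fun n : ℕ ↦ K ^ n) (poissonMeasure lam) := by
    rw [integrable_poissonMeasure_iff]
    refine ((summable_pow_div_factorial (lam * K)).mul_left (exp (-lam))).congr fun n ↦ ?_
    rw [norm_pow, Real.norm_of_nonneg hK, mul_pow]
    ring
  have h2 : Integrable (fun x : ι → ℕ ↦ C * ∏ k, K ^ x k) (poissonPi ι lam) :=
    (Integrable.fintype_prod fun _ ↦ h1).const_mul C
  refine h2.mono' .of_discrete (.of_forall fun x ↦ ?_)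
  rw [Finset.prod_pow_eq_pow_sum]
  exact hg x

lemma integral_poissonPi [Nonempty ι] (lam : ℝ≥0) {g : (ι → ℕ) → ℝ} (hg : ExpGrowth g) :
    ∫ x, g x ∂poissonPi ι lam = ∑' m : ℕ, exp (-(Fintype.card ι * lam)) *
      (Fintype.card ι * lam) ^ m / m.factorial * (avgShift ι ^ m) g 0 := by
  have hint := integrable_poissonPi lam hg
  have hU : (⋃ m : ℕ, ((Finset.piAntidiag Finset.univ m : Finset (ι → ℕ)) : Set (ι → ℕ))) =
      Set.univ := Set.eq_univ_of_forall fun x ↦ Set.mem_iUnion.2 ⟨∑ k, x k, by simp⟩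
  have hsum := hasSum_integral_iUnion
    (s := fun m : ℕ ↦ ((Finset.piAntidiag Finset.univ m : Finset (ι → ℕ)) : Set (ι → ℕ)))
    (f := g) (μ := poissonPi ι lam) (fun _ ↦ .of_discrete)
    (fun m n hmn ↦ Set.disjoint_left.2 fun x hm hn ↦ hmn (by simp_all)) hint.integrableOn
  rw [hU, setIntegral_univ] at hsum
  rw [← hsum.tsum_eq]
  refine tsum_congr fun m ↦ ?_
  have hcard : exp (-(Fintype.card ι * lam)) * (Fintype.card ι * lam : ℝ) ^ m / m.factorial *
      (avgShift ι ^ m) g 0 = exp (-(Fintype.card ι * lam)) * lam ^ m / m.factorial *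
        ((Fintype.card ι : ℝ) ^ m * (avgShift ι ^ m) g 0) := by
    rw [mul_pow]
    ring
  rw [setIntegral_finset _ hint.integrableOn, hcard, card_pow_mul_avgShift_pow, Finset.mul_sum]
  refine Finset.sum_congr rfl fun x hx ↦ ?_
  have hxm : ∑ k, x k = m := (Finset.mem_piAntidiag.1 hx).1
  have hreal : (poissonPi ι lam).real {x} =
      exp (-(Fintype.card ι * lam)) * lam ^ m / ∏ k, ((x k).factorial : ℝ) := by
    rw [measureReal_def, Measure.pi_singleton, ENNReal.toReal_prod]
    simp only [← measureReal_def, poissonMeasure_real_singleton, Finset.prod_div_distrib,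
      Finset.prod_mul_distrib, Finset.prod_pow_eq_pow_sum, hxm, Finset.prod_const,
      Finset.card_univ, ← exp_nat_mul, mul_neg]
  have hfac : (m.factorial : ℝ) =
      (∏ k, ((x k).factorial : ℝ)) * Nat.multinomial Finset.univ x := by
    have := Nat.multinomial_spec Finset.univ x
    rw [hxm] at this
    exact_mod_cast this.symm
  have h1 : ∏ k, ((x k).factorial : ℝ) ≠ 0 :=
    Finset.prod_ne_zero_iff.2 fun k _ ↦ by exact_mod_cast (x k).factorial_ne_zero
  have h2 : (Nat.multinomial Finset.univ x : ℝ) ≠ 0 := by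
    exact_mod_cast (Nat.multinomial_pos Finset.univ x).ne'
  rw [hreal, hfac, smul_eq_mul]
  field_simp

lemma integral_exp_poissonPi_le [Nonempty ι] (lam : ℝ≥0) {g : (ι → ℕ) → ℝ} {B : ℝ}
    (hg : ExpGrowth g) (hg' : ExpGrowth fun x ↦ exp (g x))
    (hB : ∀ x, expRemainder (increments g x) ≤ B) :
    ∫ x, exp (g x) ∂poissonPi ι lam ≤ exp (∫ x, g x ∂poissonPi ι lam + lam * B) := by
  have hr : 0 ≤ (Fintype.card ι : ℝ) * lam := by positivity
  have h1 := tendsto_lazyShift_pow hg hr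
  have h2 := tendsto_lazyShift_pow hg' hr
  rw [← integral_poissonPi lam hg] at h1
  rw [← integral_poissonPi lam hg'] at h2
  refine le_of_tendsto_of_tendsto h2 (h1.add_const (lam * B)).rexp ?_
  filter_upwards [eventually_ge_atTop 1, eventually_ge_atTop ⌈(Fintype.card ι : ℝ) * lam⌉₊]
    with n hn1 hn
  have hn1' : (0 : ℝ) < n := by exact_mod_cast hn1
  have hp1 : (Fintype.card ι : ℝ) * lam / n ≤ 1 := (div_le_one hn1').2 (Nat.ceil_le.1 hn)
  refine (lazyShift_pow_exp_le (by positivity) hp1 n hB 0).trans (le_of_eq ?_)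
  rw [← exp_add, add_comm]
  congr 2
  have : (Fintype.card ι : ℝ) ≠ 0 := by simp
  field_simp

lemma exp_sub_one_sub_le {u s D : ℝ} (hs : 0 ≤ s) (hD0 : 0 ≤ D) (hD1 : D ≤ 1)
    (hu : |u| ≤ D * s) : exp u - 1 - u ≤ D ^ 2 * (exp s - 1 - s) := by
  have h (t : ℝ) : HasSum (fun n : ℕ ↦ t ^ (n + 2) / (n + 2).factorial) (exp t - 1 - t) := by
    have := (hasSum_nat_add_iff' 2).2 (NormedSpace.expSeries_div_hasSum_exp t)
    rw [← Real.exp_eq_exp_ℝ] at this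
    simpa [Finset.sum_range_succ, sub_sub] using this
  refine hasSum_le (fun n ↦ ?_) (h u) ((h s).mul_left (D ^ 2))
  rw [← mul_div_assoc]
  gcongr
  calc u ^ (n + 2) ≤ |u| ^ (n + 2) := (le_abs_self _).trans_eq (abs_pow _ _)
    _ ≤ (D * s) ^ (n + 2) := by gcongr
    _ = D ^ n * (D ^ 2 * s ^ (n + 2)) := by ring
    _ ≤ D ^ 2 * s ^ (n + 2) := mul_le_of_le_one_left (by positivity) (pow_le_one₀ hD0 hD1)

/-- Chernoff's bound for a variable whose moment generating function is at most that of a centered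
Poisson variable of variance `v`. -/
lemma measure_ge_le_of_poisson_mgf {α : Type*} [MeasurableSpace α] {μ : Measure α}
    [IsProbabilityMeasure μ] {Y : α → ℝ} {v x : ℝ} (hv : 0 < v) (hx : 0 < x)
    (hint : ∀ s, 0 ≤ s → Integrable (fun a ↦ exp (s * Y a)) μ)
    (hmgf : ∀ s, 0 ≤ s → ∫ a, exp (s * Y a) ∂μ ≤ exp (v * (exp s - 1 - s))) :
    μ {a | x ≤ Y a} ≤
      ENNReal.ofReal (exp (-v * ((1 + x / v) * log (1 + x / v) - x / v))) := by
  have hu : 0 < x / v := by positivity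
  have hs : 0 ≤ log (1 + x / v) := log_nonneg (by linarith)
  rw [← ofReal_measureReal]
  refine ENNReal.ofReal_le_ofReal
    ((measure_ge_le_exp_mul_mgf x hs (hint _ hs)).trans ?_)
  refine (mul_le_mul_of_nonneg_left (hmgf _ hs) (exp_nonneg _)).trans (le_of_eq ?_)
  rw [← exp_add, exp_log (by linarith)]
  congr 1
  field_simp
  ring

/-- The Euclidean norm of a vector with natural number coordinates. -/
noncomputable def natNorm {ι : Type*} [Fintype ι] (x : ι → ℕ) : ℝ := √(∑ k, (x k : ℝ) ^ 2)

lemma natNorm_nonneg {ι : Type*} [Fintype ι] (x : ι → ℕ) : 0 ≤ natNorm x := sqrt_nonneg _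

lemma sq_natNorm {ι : Type*} [Fintype ι] (x : ι → ℕ) : natNorm x ^ 2 = ∑ k, (x k : ℝ) ^ 2 := sq_sqrt (by positivity)

lemma le_natNorm {ι : Type*} [Fintype ι] (x : ι → ℕ) (k : ι) : (x k : ℝ) ≤ natNorm x :=
  le_sqrt_of_sq_le
    (Finset.single_le_sum (f := fun k ↦ (x k : ℝ) ^ 2) (fun _ _ ↦ by positivity)
      (Finset.mem_univ k))

lemma natNorm_le_sum {ι : Type*} [Fintype ι] (x : ι → ℕ) : natNorm x ≤ ∑ k, (x k : ℝ) :=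
  sqrt_le_iff.2 ⟨by positivity, Finset.sum_sq_le_sq_sum_of_nonneg fun _ _ ↦ by positivity⟩

lemma sq_natNorm_add_single (x : ι → ℕ) (k : ι) :
    natNorm (x + Pi.single k 1) ^ 2 = natNorm x ^ 2 + (2 * x k + 1) := by
  have h : ∀ j, ((x + Pi.single k 1 : ι → ℕ) j : ℝ) ^ 2 =
      (x j : ℝ) ^ 2 + Pi.single (M := fun _ ↦ ℝ) k (2 * (x k : ℝ) + 1) j := by
    intro j
    rcases eq_or_ne j k with rfl | hj
    · simp; ring
    · simp [hj]
  simp only [sq_natNorm, h, Finset.sum_add_distrib, Finset.sum_pi_single', Finset.mem_univ,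
    if_true]

/-- The increments of the truncated norm lie in `[0, 1]` and are small where the norm is large. -/
lemma increments_max_natNorm (c : ℝ) (x : ι → ℕ) (k : ι) :
    0 ≤ increments (fun y ↦ max (natNorm y) c) x k ∧
    increments (fun y ↦ max (natNorm y) c) x k ≤ 1 ∧
    increments (fun y ↦ max (natNorm y) c) x k * (2 * max (natNorm x) c) ≤ 2 * x k + 1 := by
  have h := sq_natNorm_add_single x k
  have h0 := natNorm_nonneg x
  have h1 := natNorm_nonneg (x + Pi.single k 1)
  have h2 := le_natNorm x k
  have hx : (0 : ℝ) ≤ x k := by positivity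
  simp only [increments]
  generalize natNorm (x + Pi.single k 1) = b at *
  generalize natNorm x = a at *
  have hab : a ≤ b := by nlinarith
  have hba : b ≤ a + 1 := by nlinarith
  rcases le_total b c with hb | hb
  · rw [max_eq_right hb, max_eq_right (hab.trans hb)]
    refine ⟨by simp, by simp, by simp; positivity⟩
  · rw [max_eq_left hb]
    have h3 : max a c ≤ b := max_le hab hb
    have h4 : a ≤ max a c := le_max_left _ _
    have h5 : c ≤ max a c := le_max_right _ _
    refine ⟨by linarith, by linarith, by nlinarith⟩

lemma sum_sq_increments_max_natNorm_le {c : ℝ} (hc : 0 < c) (x : ι → ℕ) :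
    ∑ k, increments (fun y ↦ max (natNorm y) c) x k ^ 2 ≤ 2 + Fintype.card ι / (2 * c ^ 2) := by
  set a := max (natNorm x) c
  have ha : c ≤ a := le_max_right _ _
  have hxa : natNorm x ^ 2 ≤ a ^ 2 := by
    have := natNorm_nonneg x
    gcongr
    exact le_max_left _ _
  have ha0 : 0 < a := hc.trans_le ha
  calc ∑ k, increments (fun y ↦ max (natNorm y) c) x k ^ 2
      ≤ ∑ k, (8 * (x k : ℝ) ^ 2 + 2) / (4 * a ^ 2) := by
        refine Finset.sum_le_sum fun k _ ↦ ?_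
        obtain ⟨h0, -, h2⟩ := increments_max_natNorm c x k
        rw [le_div_iff₀ (by positivity)]
        have h3 := pow_le_pow_left₀ (by positivity) h2 2
        nlinarith [sq_nonneg (2 * (x k : ℝ) - 1)]
    _ = 2 * natNorm x ^ 2 / a ^ 2 + Fintype.card ι / (2 * a ^ 2) := by
        rw [← Finset.sum_div, Finset.sum_add_distrib, ← Finset.mul_sum, ← sq_natNorm]
        simp
        field_simp
        ring
    _ ≤ 2 + Fintype.card ι / (2 * c ^ 2) := by
        gcongr
        rw [div_le_iff₀ (by positivity)]
        gcongr

lemma sum_le_two_pow {ι : Type*} [Fintype ι] (x : ι → ℕ) : ∑ k, (x k : ℝ) ≤ 2 ^ ∑ k, x k := by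
  exact_mod_cast (Nat.lt_two_pow_self).le

lemma abs_max_natNorm_le {ι : Type*} [Fintype ι] {c : ℝ} (hc : 0 ≤ c) (x : ι → ℕ) :
    |max (natNorm x) c| ≤ c + ∑ k, (x k : ℝ) := by
  rw [abs_of_nonneg (hc.trans (le_max_right _ _))]
  have h : (0 : ℝ) ≤ ∑ k, (x k : ℝ) := by positivity
  exact max_le (by linarith [natNorm_le_sum x]) (by linarith)

lemma expGrowth_smul_max_natNorm {ι : Type*} [Fintype ι] {c : ℝ} (hc : 0 ≤ c) (s : ℝ) :
    ExpGrowth fun x : ι → ℕ ↦ s * max (natNorm x) c := by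
  refine ⟨|s| * (c + 1), 2, by positivity, by norm_num, fun x ↦ ?_⟩
  have h1 : (1 : ℝ) ≤ 2 ^ ∑ k, x k := one_le_pow₀ (by norm_num)
  rw [abs_mul, mul_assoc]
  gcongr
  refine (abs_max_natNorm_le hc x).trans ?_
  rw [add_mul, one_mul]
  exact add_le_add (le_mul_of_one_le_right hc h1) (sum_le_two_pow x)

lemma expGrowth_exp_smul_max_natNorm {ι : Type*} [Fintype ι] {c : ℝ} (hc : 0 ≤ c) (s : ℝ) :
    ExpGrowth fun x : ι → ℕ ↦ exp (s * max (natNorm x) c) := by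
  refine ⟨exp (|s| * c), exp |s|, by positivity, by positivity, fun x ↦ ?_⟩
  rw [abs_of_nonneg (exp_nonneg _), ← exp_nat_mul, ← exp_add, exp_le_exp]
  calc s * max (natNorm x) c ≤ |s| * |max (natNorm x) c| := (le_abs_self _).trans_eq (abs_mul _ _)
    _ ≤ |s| * (c + ∑ k, (x k : ℝ)) := by gcongr; exact abs_max_natNorm_le hc x
    _ = _ := by push_cast; ring

lemma integrable_max_natNorm {ι : Type*} [Fintype ι] (lam : ℝ≥0) {c : ℝ} (hc : 0 ≤ c) :
    Integrable (fun x ↦ max (natNorm x) c) (poissonPi ι lam) := by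
  simpa using integrable_poissonPi lam (expGrowth_smul_max_natNorm (ι := ι) hc 1)

/-- The moment generating function of the truncated norm, with `σ = 1` or `σ = -1`. -/
lemma integral_exp_max_natNorm_le [Nonempty ι] (lam : ℝ≥0) {c v : ℝ} (hc : 0 < c)
    (hv : lam * (2 + Fintype.card ι / (2 * c ^ 2)) ≤ v) {s σ : ℝ} (hs : 0 ≤ s) (hσ : |σ| = 1) :
    ∫ x, exp (s * (σ * (max (natNorm x) c - ∫ y, max (natNorm y) c ∂poissonPi ι lam)))
      ∂poissonPi ι lam ≤ exp (v * (exp s - 1 - s)) := by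
  have hψ : 0 ≤ exp s - 1 - s := by linarith [add_one_le_exp s]
  have hB (x : ι → ℕ) : expRemainder (increments (fun y ↦ s * σ * max (natNorm y) c) x) ≤
      (2 + Fintype.card ι / (2 * c ^ 2)) * (exp s - 1 - s) := by
    refine le_trans ?_ (mul_le_mul_of_nonneg_right (sum_sq_increments_max_natNorm_le hc x) hψ)
    rw [Finset.sum_mul]
    refine Finset.sum_le_sum fun k _ ↦ ?_
    obtain ⟨h0, h1, -⟩ := increments_max_natNorm c x k
    refine exp_sub_one_sub_le hs h0 h1 (le_of_eq ?_)
    simp only [increments] at h0 ⊢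
    rw [← mul_sub, abs_mul, abs_mul, hσ, abs_of_nonneg hs, abs_of_nonneg h0]
    ring
  have h := integral_exp_poissonPi_le lam (expGrowth_smul_max_natNorm hc.le (s * σ))
    (expGrowth_exp_smul_max_natNorm hc.le (s * σ)) hB
  rw [integral_const_mul] at h
  set m := ∫ y, max (natNorm y) c ∂poissonPi ι lam
  have hshift (x : ι → ℕ) : exp (s * (σ * (max (natNorm x) c - m))) =
      exp (-(s * σ * m)) * exp (s * σ * max (natNorm x) c) := by
    rw [← exp_add]
    ring_nf
  simp only [hshift]
  rw [integral_const_mul]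
  refine (mul_le_mul_of_nonneg_left h (exp_nonneg _)).trans ?_
  rw [← exp_add, neg_add_cancel_left, exp_le_exp, ← mul_assoc]
  gcongr

lemma integrable_exp_max_natNorm {ι : Type*} [Fintype ι] (lam : ℝ≥0) {c : ℝ} (hc : 0 ≤ c) (s σ m : ℝ) :
    Integrable (fun x ↦ exp (s * (σ * (max (natNorm x) c - m)))) (poissonPi ι lam) := by
  refine ((integrable_poissonPi lam
    (expGrowth_exp_smul_max_natNorm hc (s * σ))).const_mul (exp (-(s * σ * m)))).congr
    (.of_forall fun x ↦ ?_)
  simp only [← exp_add]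
  ring_nf

/-- Deviation inequality for the truncated norm, with `σ = 1` or `σ = -1`. -/
lemma poissonPi_deviation_max_natNorm [Nonempty ι] (lam : ℝ≥0) {c v x : ℝ} (hc : 0 < c)
    (hv0 : 0 < v) (hv : lam * (2 + Fintype.card ι / (2 * c ^ 2)) ≤ v) (hx : 0 < x) {σ : ℝ}
    (hσ : |σ| = 1) :
    poissonPi ι lam
      {n | x ≤ σ * (max (natNorm n) c - ∫ y, max (natNorm y) c ∂poissonPi ι lam)} ≤
      ENNReal.ofReal (exp (-v * ((1 + x / v) * log (1 + x / v) - x / v))) :=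
  measure_ge_le_of_poisson_mgf hv0 hx (fun s _ ↦ integrable_exp_max_natNorm lam hc.le s σ _)
    fun _ hs ↦ integral_exp_max_natNorm_le lam hc hv hs hσ

lemma integrable_natNorm {ι : Type*} [Fintype ι] (lam : ℝ≥0) : Integrable natNorm (poissonPi ι lam) :=
  (integrable_max_natNorm lam le_rfl).congr
    (.of_forall fun x ↦ max_eq_left (natNorm_nonneg x))

/-- Upper and lower deviations of the Euclidean norm of independent Poisson variables. -/
lemma poissonPi_natNorm_deviation (lam : ℝ≥0) {ε v x : ℝ} (hlam : 0 < lam) (hε : 0 < ε)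
    (hv : v = 8 * lam + 2 * lam * Fintype.card ι /
      (ε * ∫ n, natNorm n ∂poissonPi ι lam) ^ 2) (hx : 0 < x) :
    poissonPi ι lam {n | (1 + ε) * (∫ y, natNorm y ∂poissonPi ι lam) + x ≤ natNorm n} ≤
      ENNReal.ofReal (exp (-v * ((1 + x / v) * log (1 + x / v) - x / v))) ∧
    poissonPi ι lam {n | natNorm n ≤ (1 - ε) * (∫ y, natNorm y ∂poissonPi ι lam) - x} ≤
      ENNReal.ofReal (exp (-v * ((1 + x / v) * log (1 + x / v) - x / v))) := by
  have hint := integrable_natNorm (ι := ι) lam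
  have hlam' : (0 : ℝ) < lam := hlam
  set E := ∫ n, natNorm n ∂poissonPi ι lam with hE
  have hE0 : 0 ≤ E := integral_nonneg natNorm_nonneg
  rcases hE0.eq_or_lt with h0 | hpos
  · rw [← h0]
    have hae : natNorm =ᵐ[poissonPi ι lam] 0 :=
      (integral_eq_zero_iff_of_nonneg natNorm_nonneg hint).1 h0.symm
    constructor
    · refine le_of_eq_of_le ?_ zero_le
      refine measure_eq_zero_iff_ae_notMem.2 (hae.mono fun n hn hn' ↦ ?_)
      simp only [Set.mem_ofPred_eq, mul_zero, zero_add, hn, Pi.zero_apply] at hn'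
      exact hx.not_ge hn'
    · refine le_of_eq_of_le ?_ zero_le
      convert measure_empty (μ := poissonPi ι lam)
      refine Set.eq_empty_of_forall_notMem fun n hn ↦ ?_
      simp only [Set.mem_ofPred_eq, mul_zero, zero_sub] at hn
      linarith [natNorm_nonneg n]
  have hne : Nonempty ι := by
    by_contra hι
    rw [not_nonempty_iff] at hι
    simp [natNorm, hE] at hpos
  set c := ε * E with hcdef
  have hc : 0 < c := by positivity
  have hv0 : 0 < v := by rw [hv]; positivity
  have hv' : lam * (2 + Fintype.card ι / (2 * c ^ 2)) ≤ v := by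
    have h1 : (0 : ℝ) ≤ lam * Fintype.card ι / c ^ 2 := by positivity
    have h2 : (lam : ℝ) * (2 + Fintype.card ι / (2 * c ^ 2)) =
        2 * lam + lam * Fintype.card ι / c ^ 2 / 2 := by field_simp
    have h3 : v = 8 * lam + 2 * (lam * Fintype.card ι / c ^ 2) := by rw [hv]; ring
    linarith
  have hint' := integrable_max_natNorm (ι := ι) lam hc.le
  have hlow : E ≤ ∫ n, max (natNorm n) c ∂poissonPi ι lam :=
    integral_mono hint hint' fun n ↦ le_max_left _ _
  have hupp : ∫ n, max (natNorm n) c ∂poissonPi ι lam ≤ E + c := by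
    have := integral_mono hint' (hint.add (integrable_const c)) fun n ↦
      max_le (le_add_of_nonneg_right hc.le) (le_add_of_nonneg_left (natNorm_nonneg n))
    rwa [integral_add' hint (integrable_const c), integral_const, probReal_univ, one_smul] at this
  constructor
  · refine (measure_mono fun n hn ↦ ?_).trans
      (poissonPi_deviation_max_natNorm lam hc hv0 hv' hx (σ := 1) (by simp))
    simp only [Set.mem_ofPred_eq] at hn ⊢
    have := le_max_left (natNorm n) c
    linarith
  · refine (measure_mono fun n hn ↦ ?_).trans
      (poissonPi_deviation_max_natNorm lam hc hv0 hv' hx (σ := -1) (by simp))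
    simp only [Set.mem_ofPred_eq] at hn ⊢
    have := natNorm_nonneg n
    have : max (natNorm n) c ≤ E - x := max_le (by linarith) (by linarith)
    linarith

end PoissonConcentration

/-- Corollary 3 of the paper (upper and lower deviations of the Euclidean norm)
specialized to i.i.d. Poisson(λ) components: with
`v² = 8λ + 2λd/(ε E‖X‖)²`, for all `x > 0`,
`P(‖X‖ ≥ (1+ε) E‖X‖ + x) ≤ exp(−v² ℓ(x/v²))` and
`P(‖X‖ ≤ (1−ε) E‖X‖ − x) ≤ exp(−v² ℓ(x/v²))`, where `ℓ(u) = (1+u)log(1+u) − u`. -/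
theorem stmt9
    {Ω : Type*} [MeasureSpace Ω] [IsProbabilityMeasure (ℙ : Measure Ω)]
    {d : ℕ} (lam : ℝ≥0) (hlam : 0 < lam)
    (X : Ω → EuclideanSpace ℝ (Fin d)) (hX : Measurable X)
    (hlaw : Measure.map (fun ω k => X ω k) ℙ =
      Measure.pi fun _ : Fin d => (poissonMeasure lam).map (fun n : ℕ => (n : ℝ)))
    (ε : ℝ) (hε : 0 < ε)
    (v2 : ℝ) (hv2 : v2 = 8 * (lam : ℝ) +
      2 * (lam : ℝ) * d / (ε * ∫ ω, ‖X ω‖) ^ 2)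
    (x : ℝ) (hx : 0 < x) :
    ℙ {ω | ‖X ω‖ ≥ (1 + ε) * (∫ ω', ‖X ω'‖) + x} ≤
      ENNReal.ofReal (Real.exp (-v2 *
        ((1 + x / v2) * Real.log (1 + x / v2) - x / v2))) ∧
    ℙ {ω | ‖X ω‖ ≤ (1 - ε) * (∫ ω', ‖X ω'‖) - x} ≤
      ENNReal.ofReal (Real.exp (-v2 *
        ((1 + x / v2) * Real.log (1 + x / v2) - x / v2))) := by
  let N : (Fin d → ℝ) → ℝ := fun y ↦ √(∑ k, y k ^ 2)
  have hN : Measurable N := by fun_prop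
  have hnorm (ω : Ω) : ‖X ω‖ = N fun k ↦ X ω k := by
    simp [EuclideanSpace.norm_eq, N]
  have hXm : Measurable fun ω k ↦ X ω k := by fun_prop
  have hmap : Measure.map (fun ω ↦ ‖X ω‖) ℙ = (poissonPi (Fin d) lam).map natNorm := by
    have h1 : (fun ω ↦ ‖X ω‖) = N ∘ fun ω k ↦ X ω k := funext hnorm
    have h2 : natNorm = N ∘ fun (n : Fin d → ℕ) k ↦ (n k : ℝ) := rfl
    have : ∀ _ : Fin d, SigmaFinite ((poissonMeasure lam).map (fun n : ℕ ↦ (n : ℝ))) :=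
      fun _ ↦ inferInstance
    rw [h1, ← Measure.map_map hN hXm, hlaw,
      ← Measure.pi_map_pi fun _ ↦ Measurable.aemeasurable (by fun_prop),
      Measure.map_map hN .of_discrete, ← h2]
  have hE : ∫ ω, ‖X ω‖ = ∫ n, natNorm n ∂poissonPi (Fin d) lam := by
    have h1 := integral_map (μ := (ℙ : Measure Ω)) (φ := fun ω ↦ ‖X ω‖) (f := id)
      (by fun_prop) (by fun_prop)
    have h2 := integral_map (μ := poissonPi (Fin d) lam) (φ := natNorm) (f := id)
      Measurable.of_discrete.aemeasurable (by fun_prop)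
    rw [← hmap, h1] at h2
    exact h2
  have hP {s : Set ℝ} (hs : MeasurableSet s) :
      ℙ {ω | ‖X ω‖ ∈ s} = poissonPi (Fin d) lam {n | natNorm n ∈ s} := by
    have h1 := Measure.map_apply (μ := (ℙ : Measure Ω)) (f := fun ω ↦ ‖X ω‖) (by fun_prop) hs
    rw [hmap, Measure.map_apply .of_discrete hs] at h1
    exact h1.symm
  have h := poissonPi_natNorm_deviation (ι := Fin d) lam hlam hε (v := v2)
    (by rw [hv2, hE, Fintype.card_fin]) hx
  rw [hE]
  exact ⟨(hP measurableSet_Ici).trans_le h.1, (hP measurableSet_Iic).trans_le h.2⟩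
end

section
/- Let c > 0, let x ∈ ℝ^d with x ≠ 0, let u ∈ ℝ and let k ∈ {1,…,d}, and let e_k be the k-th canonical basis vector of ℝ^d and ‖·‖ the Euclidean norm. Define f(y) = max(‖y‖ − c, 0) for y ∈ ℝ^d. Then |f(x + u e_k) − f(x)| ≤ min( |u| , 2|u|·|x_k|/‖x‖ + u²/c ), where x_k denotes the k-th coordinate of x. -/
open Real

theorem EuclideanSpace.norm_add_smul_single_sq {ι : Type*} [Fintype ι] [DecidableEq ι]
    (x : EuclideanSpace ℝ ι) (u : ℝ) (k : ι) :
    ‖x + u • EuclideanSpace.single k (1 : ℝ)‖ ^ 2 = ‖x‖ ^ 2 + 2 * (u * x k) + u ^ 2 := by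
  rw [norm_add_sq_real, real_inner_smul_right, EuclideanSpace.inner_single_right, norm_smul]
  simp

theorem abs_sub_le_div_add_div {a b c u t : ℝ} (ha : 0 ≤ a) (hb : 0 < b) (hc : 0 < c)
    (hcab : c ≤ a + b) (hab : a ^ 2 = b ^ 2 + 2 * (u * t) + u ^ 2) :
    |a - b| ≤ 2 * |u| * |t| / b + u ^ 2 / c := by
  have hs : 0 < a + b := by linarith
  have h : |a - b| * (a + b) ≤ 2 * |u| * |t| + u ^ 2 := by
    calc |a - b| * (a + b) = |2 * (u * t) + u ^ 2| := by
          rw [← abs_of_pos hs, ← abs_mul]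
          congr 1
          linear_combination hab
      _ ≤ |2 * (u * t)| + |u ^ 2| := abs_add_le _ _
      _ = 2 * |u| * |t| + u ^ 2 := by
          rw [abs_mul, abs_mul, abs_two, abs_of_nonneg (sq_nonneg u), mul_assoc]
  calc |a - b| ≤ (2 * |u| * |t| + u ^ 2) / (a + b) := (le_div_iff₀ hs).2 h
    _ = 2 * |u| * |t| / (a + b) + u ^ 2 / (a + b) := add_div _ _ _
    _ ≤ 2 * |u| * |t| / b + u ^ 2 / c := by
      gcongr
      linarith

/-- Increment estimate (eq. (11)) in the proof of Corollary 3 of the paper: for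
`f(y) = (‖y‖ − c)⁺` with `c > 0`, `x ≠ 0`, `u ∈ ℝ` and a canonical basis vector `eₖ`,
`|f(x + u eₖ) − f(x)| ≤ min(|u|, 2|u||xₖ|/‖x‖ + u²/c)`. -/
theorem stmt11
    {d : ℕ} (c : ℝ) (hc : 0 < c)
    (x : EuclideanSpace ℝ (Fin d)) (hx : x ≠ 0) (u : ℝ) (k : Fin d)
    (f : EuclideanSpace ℝ (Fin d) → ℝ) (hf : ∀ y, f y = max (‖y‖ - c) 0) :
    |f (x + u • EuclideanSpace.single k 1) - f x| ≤
      min |u| (2 * |u| * |x k| / ‖x‖ + u ^ 2 / c) := by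
  have hLip : |f (x + u • EuclideanSpace.single k 1) - f x| ≤
      |‖x + u • EuclideanSpace.single k (1 : ℝ)‖ - ‖x‖| := by
    rw [hf, hf]
    simpa using abs_max_sub_max_le_abs (‖x + u • EuclideanSpace.single k (1 : ℝ)‖ - c) (‖x‖ - c) 0
  have ha := norm_nonneg (x + u • EuclideanSpace.single k (1 : ℝ))
  have hb : 0 < ‖x‖ := norm_pos_iff.2 hx
  refine le_min (hLip.trans ?_) ?_
  · simpa [norm_smul] using abs_norm_sub_norm_le (x + u • EuclideanSpace.single k (1 : ℝ)) x
  · by_cases h : ‖x + u • EuclideanSpace.single k (1 : ℝ)‖ ≤ c ∧ ‖x‖ ≤ c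
    · rw [hf, hf, max_eq_right (sub_nonpos.2 h.1), max_eq_right (sub_nonpos.2 h.2), sub_self,
        abs_zero]
      positivity
    · refine hLip.trans (abs_sub_le_div_add_div ha hb hc ?_
        (EuclideanSpace.norm_add_smul_single_sq x u k))
      by_contra! hlt
      exact h ⟨by linarith, by linarith⟩
end
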